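/- Let d ≥ 1 and let μ be a compactly supported finite Borel measure on ℝ^d whose Fourier transform satisfies |μ̂(ξ)| ≤ C|ξ|^{−a} for all ξ ≠ 0, for some constant C and some a > 1/2. Then for every p > p_a = (2a+1)/(2a) there is a constant C' such that ‖M_μ f‖_{L^p(ℝ^d)} ≤ C' ‖f‖_{L^p(ℝ^d)} for every Schwartz function f on ℝ^d. -/

import Mathlib

open MeasureTheory Real Set Metric FourierTransform
open scoped ENNReal NNReal RealInnerProductSpace

noncomputable section

variable {d : ℕ}

/-- Fourier transform of a finite Borel measure on ℝ^d:  μ̂(ξ) = ∫ e^{−2πi x·ξ} dμ(x). -/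
def mFT (μ : Measure (EuclideanSpace ℝ (Fin d))) (ξ : EuclideanSpace ℝ (Fin d)) : ℂ :=
  ∫ x, Complex.exp (-(2 * (π : ℂ) * Complex.I * ((⟪x, ξ⟫ : ℝ) : ℂ))) ∂μ

/-- Convolution with the dilated measure: (f ∗ μ_t)(x) = ∫ f(x − t y) dμ(y). -/
def convM (f : EuclideanSpace ℝ (Fin d) → ℂ) (μ : Measure (EuclideanSpace ℝ (Fin d)))
    (t : ℝ) (x : EuclideanSpace ℝ (Fin d)) : ℂ :=
  ∫ y, f (x - t • y) ∂μ

/-- Global maximal function M_μ f(x) = sup_{t>0} |(f ∗ μ_t)(x)|. -/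
def Mmax (μ : Measure (EuclideanSpace ℝ (Fin d))) (f : EuclideanSpace ℝ (Fin d) → ℂ)
    (x : EuclideanSpace ℝ (Fin d)) : ℝ≥0∞ :=
  ⨆ t : {t : ℝ // 0 < t}, (‖convM f μ t x‖₊ : ℝ≥0∞)

/-- Local maximal function M_μ^{loc} f(x) = sup_{t∈[1,2]} |(f ∗ μ_t)(x)|. -/
def MmaxLoc (μ : Measure (EuclideanSpace ℝ (Fin d))) (f : EuclideanSpace ℝ (Fin d) → ℂ)
    (x : EuclideanSpace ℝ (Fin d)) : ℝ≥0∞ :=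
  ⨆ t : (Icc (1:ℝ) 2), (‖convM f μ t x‖₊ : ℝ≥0∞)

/-- L^p norm (in lintegral form) of an ℝ≥0∞-valued function on ℝ^d. -/
def lpE (g : EuclideanSpace ℝ (Fin d) → ℝ≥0∞) (p : ℝ) : ℝ≥0∞ :=
  (∫⁻ x, g x ^ p) ^ (1 / p)

/-- Weak L^q quasinorm of an ℝ≥0∞-valued function on ℝ^d. -/
def wlpE (g : EuclideanSpace ℝ (Fin d) → ℝ≥0∞) (q : ℝ) : ℝ≥0∞ :=
  ⨆ l : ℝ≥0, (l : ℝ≥0∞) * (volume {x | (l : ℝ≥0∞) < g x}) ^ (1 / q)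

/-- Lorentz L^{p,1} norm (up to a constant factor p) of a complex-valued function. -/
def lorentz1 (f : EuclideanSpace ℝ (Fin d) → ℂ) (p : ℝ) : ℝ≥0∞ :=
  ∫⁻ l in Ioi (0:ℝ), (volume {x | l < ‖f x‖}) ^ (1 / p)

/-- Lorentz L^{p,r} quasinorm of a real-valued function,
‖f‖_{p,r} = ( ∫_0^∞ (λ · d_f(λ)^{1/p})^r dλ/λ )^{1/r}. -/
def lorentzR (f : EuclideanSpace ℝ (Fin d) → ℝ) (p r : ℝ) : ℝ≥0∞ :=
  (∫⁻ l in Ioi (0:ℝ),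
      (ENNReal.ofReal l * (volume {x | l < |f x|}) ^ (1 / p)) ^ r / ENNReal.ofReal l) ^ (1 / r)

/-- Littlewood–Paley projection P_k for k ∈ ℤ: (P_k f)^(ξ) = β(2^{−k}|ξ|) f̂(ξ). -/
def Pproj (β : ℝ → ℝ) (k : ℤ) (f : EuclideanSpace ℝ (Fin d) → ℂ)
    (x : EuclideanSpace ℝ (Fin d)) : ℂ :=
  ∫ ξ, Complex.exp (2 * (π : ℂ) * Complex.I * ((⟪x, ξ⟫ : ℝ) : ℂ)) *
    ((β ((2:ℝ) ^ (-k) * ‖ξ‖) : ℝ) : ℂ) * 𝓕 f ξ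

/-- The multiplier operator T_j^t, with multiplier m_j(tξ) = μ̂(tξ) β(2^{−j}|tξ|). -/
def Tj (μ : Measure (EuclideanSpace ℝ (Fin d))) (β : ℝ → ℝ) (j : ℕ) (t : ℝ)
    (f : EuclideanSpace ℝ (Fin d) → ℂ) (x : EuclideanSpace ℝ (Fin d)) : ℂ :=
  ∫ ξ, Complex.exp (2 * (π : ℂ) * Complex.I * ((⟪x, ξ⟫ : ℝ) : ℂ)) *
    (((β ((2:ℝ) ^ (-(j:ℤ)) * ‖t • ξ‖) : ℝ) : ℂ) * mFT μ (t • ξ)) * 𝓕 f ξ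

/-- The maximal multiplier operator T_j^* f(x) = sup_{t>0} |T_j^t f(x)|. -/
def TjStar (μ : Measure (EuclideanSpace ℝ (Fin d))) (β : ℝ → ℝ) (j : ℕ)
    (f : EuclideanSpace ℝ (Fin d) → ℂ) (x : EuclideanSpace ℝ (Fin d)) : ℝ≥0∞ :=
  ⨆ t : {t : ℝ // 0 < t}, (‖Tj μ β j t f x‖₊ : ℝ≥0∞)

/-- M_j f(x) = sup_{k∈ℤ} sup_{2^{−k} ≤ t < 2^{−k+1}} |(P_{k+j} f ∗ μ_t)(x)|. -/
def Mj (μ : Measure (EuclideanSpace ℝ (Fin d))) (β : ℝ → ℝ) (j : ℕ)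
    (f : EuclideanSpace ℝ (Fin d) → ℂ) (x : EuclideanSpace ℝ (Fin d)) : ℝ≥0∞ :=
  ⨆ k : ℤ, ⨆ t : (Ico ((2:ℝ) ^ (-k)) ((2:ℝ) ^ (-k+1))),
    (‖convM (Pproj β (k + j) f) μ t x‖₊ : ℝ≥0∞)

/-- P_j(μ_t ∗ μ̄_s)(x) = ∫ e^{2πi x·ξ} β(2^{−j}|ξ|) μ̂(tξ) conj(μ̂(sξ)) dξ. -/
def Kdisp (μ : Measure (EuclideanSpace ℝ (Fin d))) (β : ℝ → ℝ) (j : ℕ) (t s : ℝ)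
    (x : EuclideanSpace ℝ (Fin d)) : ℂ :=
  ∫ ξ, Complex.exp (2 * (π : ℂ) * Complex.I * ((⟪x, ξ⟫ : ℝ) : ℂ)) *
    ((β ((2:ℝ) ^ (-(j:ℤ)) * ‖ξ‖) : ℝ) : ℂ) * (mFT μ (t • ξ) * (starRingEnd ℂ) (mFT μ (s • ξ)))

/-- Convolution of a nonnegative function with a dilated measure, valued in [0,∞]. -/
def convNN (g : EuclideanSpace ℝ (Fin d) → ℝ) (σ : Measure (EuclideanSpace ℝ (Fin d)))
    (t : ℝ) (x : EuclideanSpace ℝ (Fin d)) : ℝ≥0∞ :=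
  ∫⁻ y, ENNReal.ofReal (g (x - t • y)) ∂σ

namespace RdF

abbrev Esp (d : ℕ) := EuclideanSpace ℝ (Fin d)

/-- dyadic index of a point at level `k` -/
def idx (k : ℤ) (x : Esp d) : Fin d → ℤ := fun i => ⌊(2:ℝ)^k * x i⌋

/-- dyadic cube of side `2^{-k}` -/
def cube (k : ℤ) (n : Fin d → ℤ) : Set (Esp d) := {x | idx k x = n}

lemma idx_pred (k : ℤ) (x : Esp d) (i : Fin d) : idx (k-1) x i = idx k x i / 2 := by
  unfold idx
  have : (2:ℝ)^(k-1) * x i = ((2:ℝ)^k * x i) / (2:ℕ) := by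
    rw [zpow_sub_one₀ (by norm_num)]; push_cast; ring
  rw [this, Int.floor_div_natCast]; rfl

lemma idx_congr {k k' : ℤ} (h : k' ≤ k) {x y : Esp d} (hxy : idx k x = idx k y) :
    idx k' x = idx k' y := by
  obtain ⟨n, rfl⟩ : ∃ n : ℕ, k' = k - n := ⟨(k - k').toNat, by omega⟩
  clear h
  induction n with
  | zero => simpa using hxy
  | succ m ih =>
    have e : k - ((m+1 : ℕ) : ℤ) = (k - m) - 1 := by push_cast; ring
    funext i
    rw [e, idx_pred, idx_pred, ih]

lemma measurable_idx (k : ℤ) : Measurable (idx k : Esp d → Fin d → ℤ) := by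
  unfold idx
  refine measurable_pi_lambda _ (fun i => ?_)
  exact Int.measurable_floor.comp (by fun_prop)

lemma measurableSet_cube (k : ℤ) (n : Fin d → ℤ) : MeasurableSet (cube k n : Set (Esp d)) :=
  measurable_idx k (measurableSet_singleton n)

def corner (k : ℤ) (n : Fin d → ℤ) : Esp d := WithLp.toLp 2 (fun i => (2:ℝ)^(-k) * n i)

lemma corner_mem (k : ℤ) (n : Fin d → ℤ) : corner k n ∈ (cube k n : Set (Esp d)) := by
  change idx k (corner k n) = n
  funext i
  change ⌊(2:ℝ)^k * ((2:ℝ)^(-k) * n i)⌋ = n i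
  have : (2:ℝ)^k * ((2:ℝ)^(-k) * n i) = n i := by
    rw [← mul_assoc, ← zpow_add₀ (by norm_num)]; simp
  rw [this]; simp

lemma mem_cube_iff (k : ℤ) (n : Fin d → ℤ) (x : Esp d) :
    x ∈ (cube k n : Set (Esp d)) ↔
      ∀ i, x i ∈ Ico ((2:ℝ)^(-k) * n i) ((2:ℝ)^(-k) * n i + (2:ℝ)^(-k)) := by
  simp only [cube, mem_ofPred_eq, idx, funext_iff, Int.floor_eq_iff, mem_Ico]
  refine forall_congr' fun i => ?_
  have h2 : (0:ℝ) < 2^k := by positivity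
  rw [zpow_neg, ← mul_add_one, inv_mul_le_iff₀ h2, lt_inv_mul_iff₀ h2]

lemma volume_cube (k : ℤ) (n : Fin d → ℤ) :
    volume (cube k n : Set (Esp d)) = ENNReal.ofReal ((2:ℝ)^(-k)) ^ d := by
  have h1 : (cube k n : Set (Esp d)) = (MeasurableEquiv.toLp 2 (Fin d → ℝ)).symm ⁻¹'
      (Set.pi univ fun i => Ico ((2:ℝ)^(-k) * n i) ((2:ℝ)^(-k) * n i + (2:ℝ)^(-k))) := by
    ext x
    rw [mem_cube_iff]
    simp
  rw [h1, (EuclideanSpace.volume_preserving_symm_measurableEquiv_toLp (Fin d)).measure_preimage_equiv, volume_pi_pi]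
  simp

lemma cube_subset (k : ℤ) (n : Fin d → ℤ) :
    (cube k n : Set (Esp d)) ⊆ closedBall (corner k n) ((2:ℝ)^(-k) * Real.sqrt d) := by
  intro x hx
  rw [mem_cube_iff] at hx
  rw [mem_closedBall, EuclideanSpace.dist_eq]
  have h2 : (0:ℝ) < 2^(-k) := by positivity
  have : (2:ℝ)^(-k) * Real.sqrt d = Real.sqrt (∑ i : Fin d, ((2:ℝ)^(-k))^2) := by
    rw [Finset.sum_const, Finset.card_univ, Fintype.card_fin, nsmul_eq_mul, Real.sqrt_mul (by positivity),
      Real.sqrt_sq h2.le, mul_comm]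
  rw [this]
  apply Real.sqrt_le_sqrt
  apply Finset.sum_le_sum
  intro i _
  have := hx i
  rw [mem_Ico] at this
  simp only [corner, Real.dist_eq]
  rw [sq_abs]
  apply sq_le_sq' <;> linarith [this.1, this.2]

lemma volume_ball_cube (hd : 1 ≤ d) (k : ℤ) (n : Fin d → ℤ) :
    volume (ball (corner k n : Esp d) (2 * ((2:ℝ)^(-k) * Real.sqrt d))) ≤
      (ENNReal.ofReal (2 * Real.sqrt d) ^ d * volume (ball (0 : Esp d) 1)) *
        volume (cube k n : Set (Esp d)) := by
  have : Nonempty (Fin d) := ⟨⟨0, hd⟩⟩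
  have h2 : (0:ℝ) < 2^(-k) := by positivity
  rw [Measure.addHaar_ball _ _ (by positivity), volume_cube]
  simp only [finrank_euclideanSpace, Fintype.card_fin]
  rw [show 2 * ((2:ℝ)^(-k) * Real.sqrt d) = (2 * Real.sqrt d) * (2:ℝ)^(-k) by ring, mul_pow,
    ENNReal.ofReal_mul (by positivity), ENNReal.ofReal_pow (by positivity), ENNReal.ofReal_pow (by positivity)]
  apply le_of_eq; ring

lemma volume_cube_pos (k : ℤ) (n : Fin d → ℤ) : volume (cube k n : Set (Esp d)) ≠ 0 := by
  rw [volume_cube]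
  apply pow_ne_zero
  simp only [ne_eq, ENNReal.ofReal_eq_zero, not_le]; positivity

lemma volume_cube_ne_top (k : ℤ) (n : Fin d → ℤ) : volume (cube k n : Set (Esp d)) ≠ ∞ := by
  rw [volume_cube]
  exact ENNReal.pow_ne_top ENNReal.ofReal_ne_top

/-- bad cube at height `s` -/
def bad (f : Esp d → ℂ) (s : ℝ) (k : ℤ) (n : Fin d → ℤ) : Prop :=
  ENNReal.ofReal s * volume (cube k n : Set (Esp d)) < ∫⁻ x in cube k n, ‖f x‖ₑ

lemma bad_bdd (hd : 1 ≤ d) (f : Esp d → ℂ) (hi : Integrable f) (s : ℝ) (hs : 0 < s) :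
    ∃ k₀ : ℤ, ∀ k n, bad f s k n → k₀ ≤ k := by
  have hL : (∫⁻ x, ‖f x‖ₑ) ≠ ∞ := hi.2.ne
  set L := (∫⁻ x, ‖f x‖ₑ).toReal
  obtain ⟨N, hN⟩ := pow_unbounded_of_one_lt (L / s) (one_lt_two (α := ℝ))
  refine ⟨-N, fun k n hb => ?_⟩
  by_contra hk
  push Not at hk
  have h1 : ∫⁻ x in cube k n, ‖f x‖ₑ ≤ ENNReal.ofReal L := by
    rw [ENNReal.ofReal_toReal hL]; exact setLIntegral_le_lintegral _ _
  have h3 : (2:ℝ)^N ≤ 2^(-k) := by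
    rw [← zpow_natCast]; apply zpow_le_zpow_right₀ (by norm_num); omega
  have h4 : (1:ℝ) ≤ 2^(-k) := (one_le_pow₀ (by norm_num)).trans h3
  have h2 : ENNReal.ofReal L ≤ ENNReal.ofReal s * volume (cube k n : Set (Esp d)) := by
    rw [volume_cube, ← ENNReal.ofReal_pow (by positivity), ← ENNReal.ofReal_mul hs.le]
    apply ENNReal.ofReal_le_ofReal
    have h5 : (2:ℝ)^(-k) ≤ (2^(-k))^d := le_self_pow₀ h4 (by omega)
    have : L / s ≤ (2^(-k))^d := by linarith
    rw [div_le_iff₀ hs] at this; linarith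
  exact absurd hb (not_lt.mpr (h1.trans h2))

lemma le_of_not_bad (f : Esp d → ℂ) (hf : Continuous f) (s : ℝ) (hs : 0 < s) (x : Esp d)
    (h : ∀ k, ¬ bad f s k (idx k x)) : ‖f x‖ ≤ s := by
  by_contra hlt
  push Not at hlt
  set s' := (s + ‖f x‖) / 2 with hs'
  have hop : IsOpen {y | s' < ‖f y‖} := isOpen_lt continuous_const hf.norm
  obtain ⟨δ, hδ, hball⟩ := Metric.isOpen_iff.mp hop x (by simp [hs']; linarith)
  obtain ⟨N, hN⟩ := exists_pow_lt_of_lt_one (show 0 < δ / (2 * (Real.sqrt d + 1)) by positivity)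
    (show (1/2 : ℝ) < 1 by norm_num)
  have hsub : (cube N (idx N x) : Set (Esp d)) ⊆ ball x δ := by
    intro y hy
    have h1 := cube_subset _ _ hy
    have h2 := cube_subset _ _ (show x ∈ cube (N:ℤ) (idx N x) from rfl)
    rw [mem_closedBall] at h1 h2
    have h3 : (2:ℝ)^(-(N:ℤ)) = (1/2)^N := by simp
    rw [h3] at h1 h2
    rw [mem_ball]
    rw [lt_div_iff₀ (by positivity)] at hN
    have h4 : 0 < (1/2:ℝ)^N := by positivity
    calc dist y x ≤ dist y _ + dist x _ := dist_triangle_right _ _ (corner N (idx N x))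
      _ ≤ (1/2)^N * √d + (1/2)^N * √d := add_le_add h1 h2
      _ < δ := by nlinarith
  apply h N
  unfold bad
  calc ENNReal.ofReal s * volume (cube N (idx N x) : Set (Esp d))
      < ENNReal.ofReal s' * volume (cube N (idx N x) : Set (Esp d)) := by
        apply ENNReal.mul_lt_mul_left (volume_cube_pos _ _) (volume_cube_ne_top _ _)
        apply (ENNReal.ofReal_lt_ofReal_iff (by linarith)).mpr; linarith
    _ = ∫⁻ y in cube N (idx N x), ENNReal.ofReal s' := by simp
    _ ≤ _ := by
        apply setLIntegral_mono' (measurableSet_cube _ _)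
        intro y hy
        rw [← ofReal_norm]
        exact ENNReal.ofReal_le_ofReal (le_of_lt (hball (hsub hy)))

theorem CZ_cubes (hd : 1 ≤ d) : ∃ Cd : ℝ≥0∞, Cd ≠ ∞ ∧ ∀ (f : Esp d → ℂ), Continuous f → Integrable f →
    ∀ s : ℝ, 0 < s → ∃ (ι : Type) (_ : Countable ι) (Q : ι → Set (Esp d)) (c : ι → Esp d) (r : ι → ℝ),
      (∀ i, MeasurableSet (Q i)) ∧ Pairwise (Function.onFun Disjoint Q) ∧ (∀ i, 0 < r i) ∧
      (∀ i, Q i ⊆ closedBall (c i) (r i)) ∧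
      (∀ i, volume (ball (c i) (2 * r i)) ≤ Cd * volume (Q i)) ∧
      (∀ i, volume (Q i) ≠ 0) ∧ (∀ i, volume (Q i) ≠ ∞) ∧
      (∀ i, ENNReal.ofReal s * volume (Q i) ≤ ∫⁻ x in Q i, ‖f x‖ₑ) ∧
      (∀ i, ∫⁻ x in Q i, ‖f x‖ₑ ≤ 2 ^ d * ENNReal.ofReal s * volume (Q i)) ∧
      (∀ x, x ∉ ⋃ i, Q i → ‖f x‖ ≤ s) := by
  refine ⟨ENNReal.ofReal (2 * Real.sqrt d) ^ d * volume (ball (0 : Esp d) 1),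
    ENNReal.mul_ne_top (ENNReal.pow_ne_top ENNReal.ofReal_ne_top) measure_ball_lt_top.ne, ?_⟩
  intro f hf hi s hs
  let S := {q : ℤ × (Fin d → ℤ) // bad f s q.1 q.2 ∧
    ∀ k' < q.1, ¬ bad f s k' (idx k' (corner q.1 q.2 : Esp d))}
  have hidx : ∀ (k k' : ℤ) (n : Fin d → ℤ) (x : Esp d), k' ≤ k → x ∈ (cube k n : Set (Esp d)) →
      idx k' x = idx k' (corner k n : Esp d) := by
    intro k k' n x hk hx
    exact idx_congr hk (hx.trans (corner_mem k n).symm)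
  refine ⟨S, inferInstance, fun q => cube q.1.1 q.1.2, fun q => corner q.1.1 q.1.2,
    fun q => (2:ℝ)^(-q.1.1) * Real.sqrt d, fun q => measurableSet_cube _ _, ?_, ?_,
    fun q => cube_subset _ _, fun q => volume_ball_cube hd _ _, fun q => volume_cube_pos _ _,
    fun q => volume_cube_ne_top _ _, fun q => q.2.1.le, ?_, ?_⟩
  · rintro ⟨⟨k, n⟩, hb, hm⟩ ⟨⟨k', n'⟩, hb', hm'⟩ hne
    rw [Function.onFun, Set.disjoint_left]
    intro x hx hx'
    apply hne
    simp only at hx hx' hb hb' hm hm'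
    have hxn : idx k x = n := hx
    have hxn' : idx k' x = n' := hx'
    have hk : k = k' := by
      rcases lt_trichotomy k k' with h | h | h
      · exfalso; apply hm' k h; rw [← hidx k' k n' x h.le hx', hxn]; exact hb
      · exact h
      · exfalso; apply hm k' h; rw [← hidx k k' n x h.le hx, hxn']; exact hb'
    subst hk
    have : n = n' := hxn.symm.trans hxn'
    subst this; rfl
  · intro q
    have : (0:ℝ) < d := by exact_mod_cast hd
    positivity
  · rintro ⟨⟨k, n⟩, hb, hm⟩
    simp only at hb hm ⊢
    have hnb := hm (k-1) (by omega)
    unfold bad at hnb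
    push Not at hnb
    have hsub : (cube k n : Set (Esp d)) ⊆ cube (k-1) (idx (k-1) (corner k n : Esp d)) := by
      intro x hx
      exact hidx k (k-1) n x (by omega) hx
    calc _ ≤ _ := lintegral_mono_set hsub
      _ ≤ _ := hnb
      _ = _ := by
        rw [volume_cube, volume_cube, show -(k-1) = -k + 1 by ring, zpow_add_one₀ (by norm_num),
          ENNReal.ofReal_mul (by positivity), mul_pow]
        simp only [ENNReal.ofReal_ofNat]; ring
  · intro x hx
    apply le_of_not_bad f hf s hs x
    by_contra hcon
    push Not at hcon
    obtain ⟨k₀, hk₀⟩ := bad_bdd hd f hi s hs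
    obtain ⟨k, hk, hleast⟩ := Int.exists_least_of_bdd (P := fun k => bad f s k (idx k x))
      ⟨k₀, fun z hz => hk₀ _ _ hz⟩ hcon
    apply hx
    rw [mem_iUnion]
    refine ⟨⟨⟨k, idx k x⟩, hk, ?_⟩, rfl⟩
    intro k' hk' hb
    simp only at hk' hb
    rw [← hidx k k' _ x hk'.le rfl] at hb
    have := hleast k' hb
    omega

end RdF

namespace RdF

/-- maximal operator attached to a family of kernels -/
def TT {ι : Type*} (k : ι → Esp d → ℂ) (f : Esp d → ℂ) (x : Esp d) : ℝ≥0∞ :=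
  ⨆ i, ‖∫ z, f z * k i (x - z)‖ₑ

/-- Hörmander quantity -/
def HH {ι : Type*} (k : ι → Esp d → ℂ) (x h : Esp d) : ℝ≥0∞ := ⨆ i, ‖k i (x - h) - k i x‖ₑ

lemma measurable_HH {ι : Type*} [Countable ι] (k : ι → Esp d → ℂ) (hk : ∀ i, Continuous (k i)) :
    Measurable (fun q : Esp d × Esp d => HH k q.1 q.2) := by
  unfold HH
  refine Measurable.iSup fun i => ?_
  have := hk i
  fun_prop

lemma measurable_HH_sub {ι : Type*} [Countable ι] (k : ι → Esp d → ℂ) (hk : ∀ i, Continuous (k i))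
    (a : Esp d) : Measurable (fun q : Esp d × Esp d => HH k (q.1 - a) (q.2 - a)) := by
  unfold HH
  refine Measurable.iSup fun i => ?_
  have := hk i
  fun_prop

lemma measurable_HH_sub' {ι : Type*} [Countable ι] (k : ι → Esp d → ℂ) (hk : ∀ i, Continuous (k i))
    (a z : Esp d) : Measurable (fun x : Esp d => HH k (x - a) z) := by
  unfold HH
  refine Measurable.iSup fun i => ?_
  have := hk i
  fun_prop

lemma measurable_TT {ι : Type*} [Countable ι] (k : ι → Esp d → ℂ) (hk : ∀ i, Continuous (k i))
    (f : Esp d → ℂ) (hf : Measurable f) : Measurable (TT k f) := by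
  unfold TT
  refine Measurable.iSup fun i => Measurable.enorm ?_
  have hki := (hk i).measurable
  have h : Measurable (fun q : Esp d × Esp d => f q.2 * k i (q.1 - q.2)) := by fun_prop
  exact h.stronglyMeasurable.integral_prod_right'.measurable

lemma TT_add_le {ι : Type*} (k : ι → Esp d → ℂ) (hk : ∀ i, Continuous (k i))
    (hb : ∀ i, ∃ B, ∀ x, ‖k i x‖ ≤ B) (f g : Esp d → ℂ) (hf : Integrable f) (hg : Integrable g)
    (x : Esp d) : TT k f x ≤ TT k g x + TT k (fun z => f z - g z) x := by
  unfold TT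
  refine iSup_le fun i => ?_
  have hIntg : ∀ u : Esp d → ℂ, Integrable u → Integrable (fun z => u z * k i (x - z)) := by
    intro u hu
    obtain ⟨B, hB⟩ := hb i
    have hki := hk i
    exact hu.mul_bdd (c := B) (by fun_prop) (by filter_upwards with z using hB _)
  have : ∫ z, f z * k i (x - z) = (∫ z, g z * k i (x - z)) + ∫ z, (f z - g z) * k i (x - z) := by
    rw [← integral_add (hIntg g hg) (hIntg (fun z => f z - g z) (hf.sub hg))]
    congr 1; funext z; ring
  rw [this]
  refine (enorm_add_le _ _).trans ?_
  gcongr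
  · exact le_iSup (fun i => ‖∫ z, g z * k i (x - z)‖ₑ) i
  · exact le_iSup (fun i => ‖∫ z, (f z - g z) * k i (x - z)‖ₑ) i

/-- Pointwise bound for a function supported in disjoint cubes with mean zero on each. -/
lemma TT_bad_le {ι κ : Type*} [Countable κ] (k : ι → Esp d → ℂ) (hk : ∀ i, Continuous (k i))
    (hb : ∀ i, ∃ B, ∀ x, ‖k i x‖ ≤ B) (Q : κ → Set (Esp d)) (c : κ → Esp d)
    (hQ : ∀ q, MeasurableSet (Q q)) (hdisj : Pairwise (Function.onFun Disjoint Q))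
    (b : Esp d → ℂ) (hbi : Integrable b) (hb0 : ∀ x, x ∉ ⋃ q, Q q → b x = 0)
    (hmean : ∀ q, ∫ z in Q q, b z = 0) (x : Esp d) :
    TT k b x ≤ ∑' q, ∫⁻ z in Q q, ‖b z‖ₑ * HH k (x - c q) (z - c q) := by
  unfold TT
  refine iSup_le fun i => ?_
  obtain ⟨B, hB⟩ := hb i
  have hki := hk i
  have hIntg : ∀ y, Integrable (fun z => b z * k i (y - z)) := fun y =>
    hbi.mul_bdd (c := B) (by fun_prop) (by filter_upwards with z using hB _)
  have h1 : ∫ z, b z * k i (x - z) = ∫ z in ⋃ q, Q q, b z * k i (x - z) := by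
    rw [setIntegral_eq_integral_of_forall_compl_eq_zero]
    intro z hz; rw [hb0 z hz, zero_mul]
  rw [h1]
  have h2 := hasSum_integral_iUnion hQ hdisj ((hIntg x).integrableOn (s := ⋃ q, Q q))
  rw [← h2.tsum_eq]
  refine (enorm_tsum_le_tsum_enorm).trans ?_
  refine ENNReal.tsum_le_tsum fun q => ?_
  have h3 : ∫ z in Q q, b z * k i (x - z) =
      ∫ z in Q q, b z * (k i ((x - c q) - (z - c q)) - k i (x - c q)) := by
    have : ∫ z in Q q, b z * (k i ((x - c q) - (z - c q)) - k i (x - c q)) =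
        (∫ z in Q q, b z * k i (x - z)) - ∫ z in Q q, b z * k i (x - c q) := by
      rw [← integral_sub (hIntg x).integrableOn ((hbi.mul_const _).integrableOn)]
      congr 1; funext z
      rw [show x - c q - (z - c q) = x - z by abel]; ring
    rw [this, integral_mul_const, hmean q]; simp
  rw [h3]
  refine (enorm_integral_le_lintegral_enorm _).trans ?_
  refine lintegral_mono fun z => ?_
  rw [enorm_mul]
  gcongr
  exact le_iSup (fun i => ‖k i ((x - c q) - (z - c q)) - k i (x - c q)‖ₑ) i

/-- The bad part away from the dilated cubes. -/
lemma lintegral_bad_le {ι κ : Type*} [Countable ι] [Countable κ] (k : ι → Esp d → ℂ)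
    (hk : ∀ i, Continuous (k i))
    (hb : ∀ i, ∃ B, ∀ x, ‖k i x‖ ≤ B) (A : ℝ≥0∞)
    (hA : ∀ r : ℝ, 0 < r → ∀ h : Esp d, ‖h‖ ≤ r → ∫⁻ x in (ball 0 (2*r))ᶜ, HH k x h ≤ A)
    (Q : κ → Set (Esp d)) (c : κ → Esp d) (r : κ → ℝ)
    (hQ : ∀ q, MeasurableSet (Q q)) (hdisj : Pairwise (Function.onFun Disjoint Q))
    (hr : ∀ q, 0 < r q) (hsub : ∀ q, Q q ⊆ closedBall (c q) (r q))
    (b : Esp d → ℂ) (hbm : Measurable b) (hbi : Integrable b) (hb0 : ∀ x, x ∉ ⋃ q, Q q → b x = 0)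
    (hmean : ∀ q, ∫ z in Q q, b z = 0) :
    ∫⁻ x in (⋃ q, ball (c q) (2 * r q))ᶜ, TT k b x ≤ ∑' q, A * ∫⁻ z in Q q, ‖b z‖ₑ := by
  calc ∫⁻ x in (⋃ q, ball (c q) (2 * r q))ᶜ, TT k b x
      ≤ ∫⁻ x in (⋃ q, ball (c q) (2 * r q))ᶜ,
        ∑' q, ∫⁻ z in Q q, ‖b z‖ₑ * HH k (x - c q) (z - c q) :=
        lintegral_mono fun x => TT_bad_le k hk hb Q c hQ hdisj b hbi hb0 hmean x
    _ = ∑' q, ∫⁻ x in (⋃ q, ball (c q) (2 * r q))ᶜ,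
        ∫⁻ z in Q q, ‖b z‖ₑ * HH k (x - c q) (z - c q) := by
        refine lintegral_tsum fun q => ?_
        refine (Measurable.lintegral_prod_right' (f := fun p : Esp d × Esp d =>
          ‖b p.2‖ₑ * HH k (p.1 - c q) (p.2 - c q)) ?_).aemeasurable
        have : Measurable (fun p : Esp d × Esp d => HH k (p.1 - c q) (p.2 - c q)) :=
          measurable_HH_sub k hk (c q)
        exact (hbm.enorm.comp measurable_snd).mul this
    _ ≤ ∑' q, A * ∫⁻ z in Q q, ‖b z‖ₑ := by
        refine ENNReal.tsum_le_tsum fun q => ?_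
        have hm : Measurable (fun p : Esp d × Esp d => HH k (p.1 - c q) (p.2 - c q)) :=
          measurable_HH_sub k hk (c q)
        calc ∫⁻ x in (⋃ q, ball (c q) (2 * r q))ᶜ, ∫⁻ z in Q q, ‖b z‖ₑ * HH k (x - c q) (z - c q)
            ≤ ∫⁻ x in (ball (c q) (2 * r q))ᶜ, ∫⁻ z in Q q, ‖b z‖ₑ * HH k (x - c q) (z - c q) := by
              apply lintegral_mono_set
              exact compl_subset_compl.mpr (subset_iUnion (fun q => ball (c q) (2 * r q)) q)
          _ = ∫⁻ z in Q q, ∫⁻ x in (ball (c q) (2 * r q))ᶜ, ‖b z‖ₑ * HH k (x - c q) (z - c q) := by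
              apply lintegral_lintegral_swap
              apply Measurable.aemeasurable
              exact (hbm.enorm.comp measurable_snd).mul hm
          _ ≤ ∫⁻ z in Q q, ‖b z‖ₑ * A := by
              apply setLIntegral_mono' (hQ q)
              intro z hz
              have hm2 : Measurable (fun x => HH k (x - c q) (z - c q)) :=
                measurable_HH_sub' k hk (c q) (z - c q)
              rw [lintegral_const_mul _ hm2]
              gcongr
              have h1 : ∫⁻ x in (ball (c q) (2 * r q))ᶜ, HH k (x - c q) (z - c q) =
                  ∫⁻ x in (ball 0 (2 * r q))ᶜ, HH k x (z - c q) := by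
                rw [← lintegral_indicator measurableSet_ball.compl,
                  ← lintegral_indicator measurableSet_ball.compl]
                rw [← lintegral_sub_right_eq_self (μ := volume) (indicator (ball 0 (2 * r q))ᶜ
                  fun x => HH k x (z - c q)) (c q)]
                congr 1
                funext x
                simp only [indicator, mem_compl_iff, mem_ball, dist_eq_norm, sub_zero]
              rw [h1]
              apply hA _ (hr q)
              have := hsub q hz
              rwa [mem_closedBall, dist_eq_norm] at this
          _ = A * ∫⁻ z in Q q, ‖b z‖ₑ := by
              rw [lintegral_mul_const _ hbm.enorm, mul_comm]

theorem CZ_weak (hd : 1 ≤ d) : ∃ Cd : ℝ≥0∞, Cd ≠ ∞ ∧ ∀ (ι : Type) [Countable ι] (k : ι → Esp d → ℂ),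
    (∀ i, Continuous (k i)) → (∀ i, ∃ B, ∀ x, ‖k i x‖ ≤ B) → ∀ (A : ℝ≥0∞),
    (∀ r : ℝ, 0 < r → ∀ h : Esp d, ‖h‖ ≤ r → ∫⁻ x in (ball 0 (2*r))ᶜ, HH k x h ≤ A) →
    ∀ (f : Esp d → ℂ), Continuous f → Integrable f → ∀ s : ℝ, 0 < s →
    ∃ (g : Esp d → ℂ) (Ω : Set (Esp d)), Measurable g ∧ Integrable g ∧ (∀ x, ‖g x‖ ≤ 2 ^ d * s) ∧
      MeasurableSet Ω ∧ (∀ x, x ∉ Ω → g x = f x ∧ ‖f x‖ ≤ s) ∧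
      ENNReal.ofReal (s/2) * volume Ω ≤ ∫⁻ x in {x | s / 2 < ‖f x‖}, ‖f x‖ₑ ∧
      volume {x | ENNReal.ofReal s < TT k (fun z => f z - g z) x} ≤ Cd * (1 + A) * volume Ω := by
  obtain ⟨C0, hC0, hcz⟩ := CZ_cubes hd
  refine ⟨C0 + 2 ^ (d+1), ENNReal.add_ne_top.mpr ⟨hC0, ENNReal.pow_ne_top (by norm_num)⟩, ?_⟩
  intro ι _ k hk hb A hA f hf hi s hs
  obtain ⟨κ, _, Q, c, r, hQ, hdisj, hr, hsub, hvol, hv0, hvt, hlow, hup, hout⟩ := hcz f hf hi s hs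
  set Ω := ⋃ q, Q q with hΩ
  have hΩm : MeasurableSet Ω := MeasurableSet.iUnion hQ
  let avg : κ → ℂ := fun q => ((volume (Q q)).toReal⁻¹ : ℝ) • ∫ z in Q q, f z
  classical
  let g : Esp d → ℂ := fun x => if h : ∃ q, x ∈ Q q then avg h.choose else f x
  have hgQ : ∀ q, ∀ x ∈ Q q, g x = avg q := by
    intro q x hx
    have h : ∃ q, x ∈ Q q := ⟨q, hx⟩
    simp only [g, dif_pos h]
    congr 1
    by_contra hne
    exact (Set.disjoint_left.mp (hdisj hne)) h.choose_spec hx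
  have hgΩ : ∀ x, x ∉ Ω → g x = f x := by
    intro x hx
    have : ¬ ∃ q, x ∈ Q q := by simpa [hΩ] using hx
    simp only [g, dif_neg this]
  have hgm : Measurable g := by
    intro S hS
    have : g ⁻¹' S = (Ωᶜ ∩ f ⁻¹' S) ∪ ⋃ q : {q // avg q ∈ S}, Q q.1 := by
      ext x
      by_cases hx : ∃ q, x ∈ Q q
      · obtain ⟨q, hq⟩ := hx
        have hxΩ : x ∈ Ω := mem_iUnion.mpr ⟨q, hq⟩
        simp only [mem_preimage, hgQ q x hq, mem_union, mem_inter_iff, mem_compl_iff, hxΩ,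
          not_true_eq_false, false_and, false_or, mem_iUnion]
        constructor
        · intro h; exact ⟨⟨q, h⟩, hq⟩
        · rintro ⟨⟨q', h'⟩, hq'⟩
          have := (hgQ q x hq).symm.trans (hgQ q' x hq')
          rw [this]; exact h'
      · have hxΩ : x ∉ Ω := by simpa [hΩ] using hx
        push Not at hx
        simp [hgΩ x hxΩ, hxΩ, hx]
    rw [this]
    exact (hΩm.compl.inter (hf.measurable hS)).union (MeasurableSet.iUnion fun q => hQ _)
  have havg : ∀ q, ‖avg q‖ₑ * volume (Q q) ≤ ∫⁻ x in Q q, ‖f x‖ₑ := by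
    intro q
    have h1 : ‖∫ z in Q q, f z‖ₑ ≤ ∫⁻ x in Q q, ‖f x‖ₑ := enorm_integral_le_lintegral_enorm _
    have h2 : ‖avg q‖ₑ = (volume (Q q))⁻¹ * ‖∫ z in Q q, f z‖ₑ := by
      simp only [avg, enorm_smul]
      congr 1
      rw [Real.enorm_of_nonneg (by positivity), ENNReal.ofReal_inv_of_pos (ENNReal.toReal_pos (hv0 q) (hvt q)),
        ENNReal.ofReal_toReal (hvt q)]
    rw [h2, mul_right_comm, ENNReal.inv_mul_cancel (hv0 q) (hvt q), one_mul]
    exact h1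
  have havgs : ∀ q, ‖avg q‖ ≤ 2 ^ d * s := by
    intro q
    have h1 := (havg q).trans (hup q)
    have h2 := (ENNReal.mul_le_mul_iff_left (hv0 q) (hvt q)).mp h1
    rw [← ofReal_norm, show (2:ℝ≥0∞)^d = ENNReal.ofReal (2^d) by
      rw [ENNReal.ofReal_pow (by norm_num)]; simp, ← ENNReal.ofReal_mul (by positivity)] at h2
    exact (ENNReal.ofReal_le_ofReal_iff (by positivity)).mp h2
  have hgQint : ∀ q, ∫⁻ x in Q q, ‖g x‖ₑ ≤ ∫⁻ x in Q q, ‖f x‖ₑ := by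
    intro q
    refine le_trans (le_of_eq ?_) (havg q)
    rw [setLIntegral_congr_fun (g := fun _ => ‖avg q‖ₑ) (hQ q) (fun x hx => by simp only [hgQ q x hx])]
    simp
  have hgi : Integrable g := by
    refine ⟨hgm.aestronglyMeasurable, ?_⟩
    refine lt_of_le_of_lt ?_ hi.2
    rw [← lintegral_add_compl _ hΩm, ← lintegral_add_compl (fun x => ‖f x‖ₑ) hΩm]
    gcongr ?_ + ?_
    · rw [lintegral_iUnion hQ hdisj, lintegral_iUnion hQ hdisj]
      exact ENNReal.tsum_le_tsum hgQint
    · apply le_of_eq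
      apply setLIntegral_congr_fun hΩm.compl
      intro x hx; simp only [hgΩ x hx]
  have hvolΩ : volume Ω = ∑' q, volume (Q q) := measure_iUnion hdisj hQ
  refine ⟨g, Ω, hgm, hgi, ?_, hΩm, fun x hx => ⟨hgΩ x hx, hout x hx⟩, ?_, ?_⟩
  · intro x
    by_cases hx : ∃ q, x ∈ Q q
    · obtain ⟨q, hq⟩ := hx
      rw [hgQ q x hq]; exact havgs q
    · have hxΩ : x ∉ Ω := by simpa [hΩ] using hx
      rw [hgΩ x hxΩ]
      have : (1:ℝ) ≤ 2^d := one_le_pow₀ (by norm_num)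
      nlinarith [hout x hxΩ]
  · have hSm : MeasurableSet {x | s / 2 < ‖f x‖} := (isOpen_lt continuous_const hf.norm).measurableSet
    rw [hvolΩ, ← ENNReal.tsum_mul_left]
    calc ∑' q, ENNReal.ofReal (s/2) * volume (Q q)
        ≤ ∑' q, ∫⁻ x in Q q, indicator {x | s / 2 < ‖f x‖} (fun x => ‖f x‖ₑ) x := by
          refine ENNReal.tsum_le_tsum fun q => ?_
          have h1 : ∫⁻ x in Q q, ‖f x‖ₑ ≤ (∫⁻ x in Q q, indicator {x | s / 2 < ‖f x‖} (fun x => ‖f x‖ₑ) x)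
              + ENNReal.ofReal (s/2) * volume (Q q) := by
            rw [← setLIntegral_const, ← lintegral_add_right _ measurable_const]
            refine lintegral_mono fun x => ?_
            by_cases hx : s / 2 < ‖f x‖
            · rw [indicator_of_mem (by exact hx)]; exact le_self_add
            · rw [indicator_of_notMem (by exact hx), zero_add, ← ofReal_norm]
              exact ENNReal.ofReal_le_ofReal (not_lt.mp hx)
          have h2 := (hlow q).trans h1
          have h3 : ENNReal.ofReal s = ENNReal.ofReal (s/2) + ENNReal.ofReal (s/2) := by
            rw [← ENNReal.ofReal_add (by positivity) (by positivity)]; congr 1; ring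
          rw [h3, add_mul] at h2
          exact (ENNReal.add_le_add_iff_right (ENNReal.mul_ne_top ENNReal.ofReal_ne_top (hvt q))).mp h2
      _ = ∫⁻ x in Ω, indicator {x | s / 2 < ‖f x‖} (fun x => ‖f x‖ₑ) x :=
          (lintegral_iUnion hQ hdisj _).symm
      _ ≤ ∫⁻ x, indicator {x | s / 2 < ‖f x‖} (fun x => ‖f x‖ₑ) x := setLIntegral_le_lintegral _ _
      _ = _ := lintegral_indicator hSm _
  · set b : Esp d → ℂ := fun z => f z - g z with hbdef
    have hbm : Measurable b := hf.measurable.sub hgm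
    have hbi : Integrable b := hi.sub hgi
    have hmean : ∀ q, ∫ z in Q q, b z = 0 := by
      intro q
      have h1 : ∫ z in Q q, g z = ∫ z in Q q, f z := by
        rw [setIntegral_congr_fun (g := fun _ => avg q) (hQ q) (fun x hx => hgQ q x hx), setIntegral_const]
        simp only [avg, Measure.real]
        rw [smul_smul, mul_inv_cancel₀ (ENNReal.toReal_pos (hv0 q) (hvt q)).ne', one_smul]
      rw [integral_sub hi.integrableOn hgi.integrableOn, h1, sub_self]
    have hmain := lintegral_bad_le k hk hb A hA Q c r hQ hdisj hr hsub b hbm hbi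
      (fun x hx => by simp [hbdef, hgΩ x hx]) hmean
    set Ωs := ⋃ q, ball (c q) (2 * r q) with hΩs
    have hΩsm : MeasurableSet Ωs := MeasurableSet.iUnion fun q => measurableSet_ball
    have hbQ : ∀ q, ∫⁻ z in Q q, ‖b z‖ₑ ≤ 2 ^ (d+1) * ENNReal.ofReal s * volume (Q q) := by
      intro q
      calc ∫⁻ z in Q q, ‖b z‖ₑ ≤ ∫⁻ z in Q q, (‖f z‖ₑ + ‖g z‖ₑ) :=
            lintegral_mono fun z => enorm_sub_le
        _ = (∫⁻ z in Q q, ‖f z‖ₑ) + ∫⁻ z in Q q, ‖g z‖ₑ := lintegral_add_right _ hgm.enorm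
        _ ≤ 2 ^ d * ENNReal.ofReal s * volume (Q q) + 2 ^ d * ENNReal.ofReal s * volume (Q q) :=
            add_le_add (hup q) ((hgQint q).trans (hup q))
        _ = _ := by ring
    have hTm : Measurable (TT k b) := measurable_TT k hk b hbm
    have hs0 : ENNReal.ofReal s ≠ 0 := by simpa using hs
    have hIntg : ∫⁻ x in Ωsᶜ, TT k b x ≤ ENNReal.ofReal s * (2 ^ (d+1) * A * volume Ω) := by
      refine hmain.trans ?_
      rw [hvolΩ, ← ENNReal.tsum_mul_left, ← ENNReal.tsum_mul_left]
      refine ENNReal.tsum_le_tsum fun q => ?_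
      calc A * (∫⁻ z in Q q, ‖b z‖ₑ) ≤ A * (2 ^ (d+1) * ENNReal.ofReal s * volume (Q q)) := by gcongr; exact hbQ q
        _ = _ := by ring
    have hcheb : volume ({x | ENNReal.ofReal s < TT k b x} ∩ Ωsᶜ) ≤ 2 ^ (d+1) * A * volume Ω := by
      have h1 := mul_meas_ge_le_lintegral (μ := volume.restrict Ωsᶜ) hTm (ENNReal.ofReal s)
      have h2 : volume ({x | ENNReal.ofReal s < TT k b x} ∩ Ωsᶜ) ≤
          (volume.restrict Ωsᶜ) {x | ENNReal.ofReal s ≤ TT k b x} := by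
        rw [Measure.restrict_apply (measurableSet_le measurable_const hTm)]
        apply measure_mono
        exact inter_subset_inter_left _ (fun x hx => (show ENNReal.ofReal s ≤ TT k b x from le_of_lt hx))
      have h3 : ENNReal.ofReal s * volume ({x | ENNReal.ofReal s < TT k b x} ∩ Ωsᶜ) ≤
          ENNReal.ofReal s * (2 ^ (d+1) * A * volume Ω) :=
        (mul_le_mul_right h2 _).trans (h1.trans hIntg)
      exact (ENNReal.mul_le_mul_iff_right hs0 ENNReal.ofReal_ne_top).mp h3
    have hΩsv : volume Ωs ≤ C0 * volume Ω := by
      refine (measure_iUnion_le _).trans ?_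
      rw [hvolΩ, ← ENNReal.tsum_mul_left]
      exact ENNReal.tsum_le_tsum hvol
    calc volume {x | ENNReal.ofReal s < TT k b x}
        ≤ volume (Ωs ∪ ({x | ENNReal.ofReal s < TT k b x} ∩ Ωsᶜ)) := by
          apply measure_mono
          intro x hx
          by_cases h : x ∈ Ωs
          · exact Or.inl h
          · exact Or.inr ⟨hx, h⟩
      _ ≤ C0 * volume Ω + 2 ^ (d+1) * A * volume Ω :=
          (measure_union_le _ _).trans (add_le_add hΩsv hcheb)
      _ ≤ _ := by
          rw [← add_mul]
          gcongr
          rw [mul_add, mul_one, add_mul]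
          gcongr
          · exact le_self_add
          · exact le_add_self

end RdF

namespace RdF

lemma lintegral_rpow_Ioo (q b : ℝ) (hq : -1 < q) (hb : 0 ≤ b) :
    ∫⁻ s in Ioo 0 b, ENNReal.ofReal (s ^ q) = ENNReal.ofReal (b ^ (q+1) / (q+1)) := by
  have hIntg := (intervalIntegral.intervalIntegrable_rpow' (a := 0) (b := b) hq)
  rw [intervalIntegrable_iff_integrableOn_Ioo_of_le hb] at hIntg
  rw [← ofReal_integral_eq_lintegral_ofReal hIntg]
  · rw [← integral_Ioc_eq_integral_Ioo, ← intervalIntegral.integral_of_le hb, integral_rpow (Or.inl hq),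
      Real.zero_rpow (by linarith), sub_zero]
  · rw [Filter.EventuallyLE, ae_restrict_iff' measurableSet_Ioo]
    filter_upwards with s hs
    exact Real.rpow_nonneg hs.1.le _

lemma lintegral_rpow_Ici (q b : ℝ) (hq : q < -1) (hb : 0 < b) :
    ∫⁻ s in Ici b, ENNReal.ofReal (s ^ q) = ENNReal.ofReal (b ^ (q+1) / (-(q+1))) := by
  rw [setLIntegral_congr Ioi_ae_eq_Ici.symm]
  have hIntg := integrableOn_Ioi_rpow_of_lt hq hb
  rw [← ofReal_integral_eq_lintegral_ofReal hIntg]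
  · rw [integral_Ioi_rpow_of_lt hq hb]; congr 1; rw [div_neg, neg_div]
  · rw [Filter.EventuallyLE, ae_restrict_iff' measurableSet_Ioi]
    filter_upwards with s hs
    exact Real.rpow_nonneg (hb.le.trans (le_of_lt hs)) _

lemma tonelli {α : Type*} [MeasurableSpace α] (μ : Measure α) [SFinite μ] (w : ℝ → ℝ≥0∞)
    (hw : Measurable w) (u : α → ℝ≥0∞) (hu : Measurable u) (P : ℝ → α → Prop)
    (hP : MeasurableSet {q : ℝ × α | P q.1 q.2}) :
    ∫⁻ s in Ioi 0, w s * ∫⁻ x in {x | P s x}, u x ∂μ =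
      ∫⁻ x, u x * (∫⁻ s in {s | P s x ∧ 0 < s}, w s) ∂μ := by
  have h1 : ∀ s, MeasurableSet {x | P s x} := fun s =>
    (measurable_prodMk_left (x := s)) hP
  have h2 : ∀ x, MeasurableSet {s | P s x} := fun x => (measurable_prodMk_right (y := x)) hP
  have h3 : ∀ x, MeasurableSet {s | P s x ∧ 0 < s} := fun x => (h2 x).inter measurableSet_Ioi
  let F : ℝ → α → ℝ≥0∞ := fun s x =>
    indicator {q : ℝ × α | P q.1 q.2} (fun q => w q.1 * u q.2) (s, x)
  have hF : Measurable (Function.uncurry F) := by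
    have : Measurable (fun q : ℝ × α => w q.1 * u q.2) := by fun_prop
    exact this.indicator hP
  have e1 : ∀ s, w s * ∫⁻ x in {x | P s x}, u x ∂μ = ∫⁻ x, F s x ∂μ := by
    intro s
    rw [← lintegral_const_mul _ hu, ← lintegral_indicator (h1 s)]
    rfl
  have e2 : ∀ x, u x * ∫⁻ s in {s | P s x ∧ 0 < s}, w s = ∫⁻ s in Ioi 0, F s x := by
    intro x
    rw [← lintegral_const_mul _ hw, ← lintegral_indicator (h3 x), ← lintegral_indicator measurableSet_Ioi]
    congr 1; funext s
    simp only [indicator, F, mem_ofPred_eq, mem_Ioi]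
    by_cases a : P s x <;> by_cases b : 0 < s <;> simp [a, b, mul_comm]
  simp_rw [e1, e2]
  exact lintegral_lintegral_swap hF.aemeasurable

lemma rpow_le_layer (p : ℝ) (hp : 0 < p) (y : ℝ≥0∞) :
    y ^ p ≤ ∫⁻ s in {s : ℝ | ENNReal.ofReal s < y ∧ 0 < s}, ENNReal.ofReal (p * s ^ (p - 1)) := by
  have key : ∀ b : ℝ, 0 ≤ b → ENNReal.ofReal b ≤ y → ENNReal.ofReal b ^ p ≤
      ∫⁻ s in {s : ℝ | ENNReal.ofReal s < y ∧ 0 < s}, ENNReal.ofReal (p * s ^ (p - 1)) := by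
    intro b hb hby
    have h1 : Ioo 0 b ⊆ {s : ℝ | ENNReal.ofReal s < y ∧ 0 < s} := by
      intro s hs
      refine ⟨lt_of_lt_of_le ?_ hby, hs.1⟩
      exact (ENNReal.ofReal_lt_ofReal_iff (hs.1.trans hs.2)).mpr hs.2
    refine le_trans ?_ (lintegral_mono_set h1)
    have h2 := lintegral_rpow_Ioo (p-1) b (by linarith) hb
    simp_rw [ENNReal.ofReal_mul hp.le]
    rw [lintegral_const_mul _ (by fun_prop), h2, ENNReal.ofReal_rpow_of_nonneg hb hp.le,
      ← ENNReal.ofReal_mul hp.le]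
    apply ENNReal.ofReal_le_ofReal
    rw [sub_add_cancel, mul_div_cancel₀ _ hp.ne']
  by_cases hy : y = ∞
  · subst hy
    rw [ENNReal.top_rpow_of_pos hp, top_le_iff]
    refine ENNReal.eq_top_of_forall_nnreal_le fun r => ?_
    have := key ((r:ℝ) ^ (1/p)) (by positivity) le_top
    rw [ENNReal.ofReal_rpow_of_nonneg (by positivity) hp.le, ← Real.rpow_mul (by positivity)] at this
    simpa [hp.ne'] using this
  · have := key y.toReal ENNReal.toReal_nonneg (by rw [ENNReal.ofReal_toReal hy])
    rwa [ENNReal.ofReal_toReal hy] at this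

lemma lintegral_rpow_le_layer {α : Type*} [MeasurableSpace α] (μ : Measure α) [SFinite μ]
    (p : ℝ) (hp : 0 < p) (g : α → ℝ≥0∞) (hg : Measurable g) :
    ∫⁻ x, g x ^ p ∂μ ≤ ∫⁻ s in Ioi 0, ENNReal.ofReal (p * s ^ (p - 1)) *
      μ {x | ENNReal.ofReal s < g x} := by
  have := tonelli μ (fun s => ENNReal.ofReal (p * s ^ (p-1))) (by fun_prop) (fun _ => 1)
    measurable_const (fun s x => ENNReal.ofReal s < g x)
    (measurableSet_lt (by fun_prop) (by fun_prop))
  simp only [lintegral_one, Measure.restrict_apply MeasurableSet.univ, univ_inter, one_mul] at this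
  rw [this]
  exact lintegral_mono fun x => rpow_le_layer p hp _

lemma layer_low (p : ℝ) (hp1 : 1 < p) (hp2 : p < 2) (f : Esp d → ℂ) (hf : Continuous f) :
    ∫⁻ s in Ioi 0, ENNReal.ofReal (s ^ (p - 3)) * ∫⁻ x in {x | ‖f x‖ ≤ s}, ‖f x‖ₑ ^ 2 ≤
      ENNReal.ofReal (1/(2-p)) * ∫⁻ x, ‖f x‖ₑ ^ p := by
  rw [tonelli volume (fun s => ENNReal.ofReal (s ^ (p-3))) (by fun_prop) (fun x => ‖f x‖ₑ ^ 2)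
    (by fun_prop) (fun s x => ‖f x‖ ≤ s)
    (measurableSet_le (by fun_prop) (by fun_prop)), ← lintegral_const_mul _ (by fun_prop)]
  refine lintegral_mono fun x => ?_
  by_cases h0 : f x = 0
  · simp [h0]
  have hpos : 0 < ‖f x‖ := norm_pos_iff.mpr h0
  calc _ ≤ ‖f x‖ₑ ^ 2 * ∫⁻ s in Ici ‖f x‖, ENNReal.ofReal (s ^ (p-3)) := by
        gcongr; intro s hs; exact hs.1
    _ = _ := by
        rw [lintegral_rpow_Ici _ _ (by linarith) hpos, ← ofReal_norm, ENNReal.ofReal_rpow_of_pos hpos,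
          ← ENNReal.ofReal_pow hpos.le, ← ENNReal.ofReal_mul (by positivity),
          ← ENNReal.ofReal_mul (by rw [one_div, inv_nonneg]; linarith)]
        congr 1
        have e3 : ‖f x‖ ^ p = ‖f x‖ ^ 2 * ‖f x‖ ^ (p - 3 + 1) := by
          rw [← Real.rpow_two, ← Real.rpow_add hpos]; ring_nf
        rw [show -(p - 3 + 1) = 2 - p by ring, e3]
        ring

lemma layer_high (p : ℝ) (hp1 : 1 < p) (f : Esp d → ℂ) (hf : Continuous f) :
    ∫⁻ s in Ioi 0, ENNReal.ofReal (s ^ (p - 2)) * ∫⁻ x in {x | s / 2 < ‖f x‖}, ‖f x‖ₑ ≤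
      ENNReal.ofReal (2 ^ (p-1) / (p-1)) * ∫⁻ x, ‖f x‖ₑ ^ p := by
  rw [tonelli volume (fun s => ENNReal.ofReal (s ^ (p-2))) (by fun_prop) (fun x => ‖f x‖ₑ)
    (by fun_prop) (fun s x => s / 2 < ‖f x‖)
    (measurableSet_lt (by fun_prop) (by fun_prop)), ← lintegral_const_mul _ (by fun_prop)]
  refine lintegral_mono fun x => ?_
  by_cases h0 : f x = 0
  · simp [h0]
  have hpos : 0 < ‖f x‖ := norm_pos_iff.mpr h0
  have hp' : 0 < p - 1 := by linarith
  calc _ ≤ ‖f x‖ₑ * ∫⁻ s in Ioo 0 (2 * ‖f x‖), ENNReal.ofReal (s ^ (p-2)) := by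
        gcongr; intro s hs; exact ⟨hs.2, by have := hs.1; linarith⟩
    _ = _ := by
        rw [lintegral_rpow_Ioo _ _ (by linarith) (by positivity), ← ofReal_norm, ENNReal.ofReal_rpow_of_pos hpos,
          ← ENNReal.ofReal_mul (by positivity),
          ← ENNReal.ofReal_mul (by positivity)]
        congr 1
        rw [show p - 2 + 1 = p - 1 by ring, Real.mul_rpow (by norm_num) hpos.le]
        have e3 : ‖f x‖ ^ p = ‖f x‖ * ‖f x‖ ^ (p - 1) := by
          conv_rhs => rw [← Real.rpow_one_add' hpos.le (by linarith)]
          ring_nf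
        rw [e3]
        ring

lemma interp (hd : 1 ≤ d) (p : ℝ) (hp1 : 1 < p) (hp2 : p < 2) :
    ∃ C : ℝ≥0∞, C ≠ ∞ ∧ ∀ (ι : Type) [Countable ι] (k : ι → Esp d → ℂ),
      (∀ i, Continuous (k i)) → (∀ i, ∃ B : ℝ, ∀ x, ‖k i x‖ ≤ B) → ∀ A1 A2 : ℝ≥0∞,
      (∀ r : ℝ, 0 < r → ∀ h : Esp d, ‖h‖ ≤ r → ∫⁻ x in (ball 0 (2*r))ᶜ, HH k x h ≤ A1) →
      (∀ s : ℝ, 0 < s → ∀ g : Esp d → ℂ, Measurable g → Integrable g →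
        (∀ x, ‖g x‖ ≤ 2 ^ d * s) →
        ENNReal.ofReal (s^2) * volume {x | ENNReal.ofReal s < TT k g x} ≤ A2 * ∫⁻ x, ‖g x‖ₑ ^ 2) →
      ∀ f : Esp d → ℂ, Continuous f → Integrable f →
        ∫⁻ x, TT k f x ^ p ≤ C * (1 + A1 + A2) * ∫⁻ x, ‖f x‖ₑ ^ p := by
  obtain ⟨Cd, hCd, hCZ⟩ := CZ_weak (d := d) hd
  set c1 : ℝ≥0∞ := ENNReal.ofReal (1/(2-p))
  set c2 : ℝ≥0∞ := ENNReal.ofReal (2 ^ (p-1) / (p-1))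
  set D : ℝ≥0∞ := 1 + 2 * (4 ^ d + Cd) with hD
  refine ⟨2 ^ p * (ENNReal.ofReal p * (D * (c1 + c2))), ?_, ?_⟩
  · finiteness
  intro ι _ k hk hb A1 A2 hA1 hA2 f hf hfi
  set L : ℝ → ℝ≥0∞ := fun s => ∫⁻ x in {x | ‖f x‖ ≤ s}, ‖f x‖ₑ ^ 2 with hL
  set H : ℝ → ℝ≥0∞ := fun s => ∫⁻ x in {x | s / 2 < ‖f x‖}, ‖f x‖ₑ with hH
  have mL : Measurable L := by
    refine Monotone.measurable fun s t hst => lintegral_mono_set fun x hx => ?_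
    exact le_trans hx hst
  have mH : Measurable H := by
    refine Antitone.measurable fun s t hst => lintegral_mono_set fun x hx => ?_
    exact lt_of_le_of_lt (div_le_div_of_nonneg_right hst (by norm_num)) hx
  have mT : Measurable (TT k f) := measurable_TT k hk f hf.measurable
  have key : ∀ s : ℝ, 0 < s → volume {x | ENNReal.ofReal s < TT k f x / 2} ≤
      A2 * (ENNReal.ofReal (s ^ (-2:ℝ)) * L s) +
      (2 * (4 ^ d * A2 + Cd * (1 + A1))) * (ENNReal.ofReal (s ^ (-1:ℝ)) * H s) := by
    intro s hs
    obtain ⟨g, Ω, mg, ig, bg, mΩ, hgf, hΩ, hbad⟩ := hCZ ι k hk hb A1 hA1 f hf hfi s hs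
    have h1 : volume {x | ENNReal.ofReal s < TT k f x / 2} ≤
        volume {x | ENNReal.ofReal s < TT k g x} +
        volume {x | ENNReal.ofReal s < TT k (fun z => f z - g z) x} := by
      refine le_trans (measure_mono ?_) (measure_union_le _ _)
      intro x hx
      by_contra hcon
      rw [mem_union, not_or] at hcon
      have ha : TT k g x ≤ ENNReal.ofReal s := not_lt.mp hcon.1
      have hb' : TT k (fun z => f z - g z) x ≤ ENNReal.ofReal s := not_lt.mp hcon.2
      have hx' : ENNReal.ofReal s < TT k f x / 2 := hx
      refine absurd hx' (not_lt.mpr ?_)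
      refine ENNReal.div_le_of_le_mul ?_
      rw [mul_two]
      exact (TT_add_le k hk hb f g hfi ig x).trans (add_le_add ha hb')
    have hV : volume Ω ≤ 2 * (ENNReal.ofReal (s ^ (-1:ℝ)) * H s) := by
      calc volume Ω = 2 * (ENNReal.ofReal (s ^ (-1:ℝ)) * (ENNReal.ofReal (s/2) * volume Ω)) := by
            have e : 2 * ENNReal.ofReal (s ^ (-1:ℝ)) * ENNReal.ofReal (s/2) = 1 := by
              rw [show (2:ℝ≥0∞) = ENNReal.ofReal 2 by simp,
                ← ENNReal.ofReal_mul (by positivity), ← ENNReal.ofReal_mul (by positivity),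
                Real.rpow_neg_one, show 2 * s⁻¹ * (s / 2) = 1 by field_simp]
              simp
            rw [← mul_assoc, ← mul_assoc, e, one_mul]
        _ ≤ _ := by gcongr
    have hg2 : ∫⁻ x, ‖g x‖ₑ ^ 2 ≤ L s + ENNReal.ofReal (4 ^ d * s^2) * volume Ω := by
      rw [← lintegral_add_compl _ mΩ, add_comm]
      gcongr
      · rw [hL]
        calc ∫⁻ x in Ωᶜ, ‖g x‖ₑ ^ 2 = ∫⁻ x in Ωᶜ, ‖f x‖ₑ ^ 2 := by
              refine setLIntegral_congr_fun mΩ.compl fun x hx => ?_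
              simp only [(hgf x hx).1]
          _ ≤ _ := lintegral_mono_set fun x hx => (hgf x hx).2
      · calc ∫⁻ x in Ω, ‖g x‖ₑ ^ 2 ≤ ∫⁻ x in Ω, ENNReal.ofReal (4 ^ d * s^2) := by
              refine lintegral_mono fun x => ?_
              rw [← ofReal_norm, ← ENNReal.ofReal_pow (norm_nonneg _)]
              apply ENNReal.ofReal_le_ofReal
              calc ‖g x‖ ^ 2 ≤ (2 ^ d * s)^2 := by gcongr; exact bg x
                _ = _ := by rw [mul_pow, ← pow_mul, mul_comm d 2, pow_mul]; norm_num
          _ = _ := by simp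
    have hwg : volume {x | ENNReal.ofReal s < TT k g x} ≤
        A2 * (ENNReal.ofReal (s ^ (-2:ℝ)) * L s) + 4 ^ d * A2 * volume Ω := by
      have e : ENNReal.ofReal (s ^ (-2:ℝ)) * ENNReal.ofReal (s^2) = 1 := by
        rw [← ENNReal.ofReal_mul (by positivity), Real.rpow_neg hs.le, Real.rpow_two,
          inv_mul_cancel₀ (by positivity)]; simp
      calc _ = ENNReal.ofReal (s ^ (-2:ℝ)) * (ENNReal.ofReal (s^2) *
            volume {x | ENNReal.ofReal s < TT k g x}) := by rw [← mul_assoc, e, one_mul]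
        _ ≤ ENNReal.ofReal (s ^ (-2:ℝ)) * (A2 * (L s + ENNReal.ofReal (4 ^ d * s^2) * volume Ω)) := by
            exact mul_le_mul_right ((hA2 s hs g mg ig bg).trans (mul_le_mul_right hg2 _)) _
        _ = A2 * (ENNReal.ofReal (s ^ (-2:ℝ)) * L s) +
            (ENNReal.ofReal (s ^ (-2:ℝ)) * ENNReal.ofReal (s^2)) * (4 ^ d * A2 * volume Ω) := by
            rw [ENNReal.ofReal_mul (by positivity), ENNReal.ofReal_pow (by norm_num)]
            rw [show ENNReal.ofReal 4 = 4 by simp]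
            ring
        _ = _ := by rw [e, one_mul]
    calc _ ≤ _ := h1
      _ ≤ _ := add_le_add hwg hbad
      _ = A2 * (ENNReal.ofReal (s ^ (-2:ℝ)) * L s) + (4 ^ d * A2 + Cd * (1 + A1)) * volume Ω := by ring
      _ ≤ A2 * (ENNReal.ofReal (s ^ (-2:ℝ)) * L s) + (4 ^ d * A2 + Cd * (1 + A1)) *
          (2 * (ENNReal.ofReal (s ^ (-1:ℝ)) * H s)) := by gcongr
      _ = _ := by ring
  have main : ∫⁻ x, (TT k f x / 2) ^ p ≤ ENNReal.ofReal p * (A2 * (c1 * ∫⁻ x, ‖f x‖ₑ ^ p) +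
      (2 * (4 ^ d * A2 + Cd * (1 + A1))) * (c2 * ∫⁻ x, ‖f x‖ₑ ^ p)) := by
    refine (lintegral_rpow_le_layer volume p (by linarith) (fun x => TT k f x / 2)
      (mT.div_const 2)).trans ?_
    calc _ ≤ ∫⁻ s in Ioi 0, ENNReal.ofReal p * (A2 * (ENNReal.ofReal (s ^ (p-3)) * L s) +
          (2 * (4 ^ d * A2 + Cd * (1 + A1))) * (ENNReal.ofReal (s ^ (p-2)) * H s)) := by
          refine setLIntegral_mono' measurableSet_Ioi fun s hs => ?_
          have hs : 0 < s := hs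
          rw [ENNReal.ofReal_mul (by linarith), mul_assoc]
          gcongr
          refine (mul_le_mul_right (key s hs) _).trans (le_of_eq ?_)
          rw [show s ^ (p-3) = s ^ (p-1) * s ^ (-2:ℝ) by rw [← Real.rpow_add hs]; ring_nf,
            show s ^ (p-2) = s ^ (p-1) * s ^ (-1:ℝ) by rw [← Real.rpow_add hs]; ring_nf,
            ENNReal.ofReal_mul (by positivity), ENNReal.ofReal_mul (by positivity)]
          ring
      _ = ENNReal.ofReal p * (A2 * (∫⁻ s in Ioi 0, ENNReal.ofReal (s ^ (p-3)) * L s) +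
          (2 * (4 ^ d * A2 + Cd * (1 + A1))) * ∫⁻ s in Ioi 0, ENNReal.ofReal (s ^ (p-2)) * H s) := by
          rw [lintegral_const_mul _ (by fun_prop), lintegral_add_left (by fun_prop),
            lintegral_const_mul _ (by fun_prop), lintegral_const_mul _ (by fun_prop)]
      _ ≤ _ := by
          gcongr
          · exact layer_low p hp1 hp2 f hf
          · exact layer_high p hp1 f hf
  have e2 : ∫⁻ x, TT k f x ^ p = 2 ^ p * ∫⁻ x, (TT k f x / 2) ^ p := by
    rw [← lintegral_const_mul _ (by fun_prop)]
    congr 1; funext x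
    rw [← ENNReal.mul_rpow_of_nonneg _ _ (by linarith), ENNReal.mul_div_cancel (by simp) (by simp)]
  rw [e2]
  calc _ ≤ 2 ^ p * (ENNReal.ofReal p * (A2 * (c1 * ∫⁻ x, ‖f x‖ₑ ^ p) +
      (2 * (4 ^ d * A2 + Cd * (1 + A1))) * (c2 * ∫⁻ x, ‖f x‖ₑ ^ p))) := by gcongr
    _ ≤ 2 ^ p * (ENNReal.ofReal p * ((D * (1 + A1 + A2)) * (c1 * ∫⁻ x, ‖f x‖ₑ ^ p) +
      (D * (1 + A1 + A2)) * (c2 * ∫⁻ x, ‖f x‖ₑ ^ p))) := by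
        have hx1 : A2 ≤ D * (1 + A1 + A2) := by
          calc A2 = 1 * A2 := (one_mul _).symm
            _ ≤ _ := by exact mul_le_mul' le_self_add le_add_self
        have hx2 : 2 * (4 ^ d * A2 + Cd * (1 + A1)) ≤ D * (1 + A1 + A2) := by
          calc 2 * (4 ^ d * A2 + Cd * (1 + A1)) ≤ 2 * (4 ^ d * (1 + A1 + A2) + Cd * (1 + A1 + A2)) := by
                have q1 : A2 ≤ 1 + A1 + A2 := le_add_self
                have q2 : 1 + A1 ≤ 1 + A1 + A2 := le_self_add
                gcongr
            _ = (2 * (4 ^ d + Cd)) * (1 + A1 + A2) := by ring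
            _ ≤ _ := mul_le_mul_left le_add_self _
        exact mul_le_mul_right (mul_le_mul_right (add_le_add (mul_le_mul_left hx1 _)
          (mul_le_mul_left hx2 _)) _) _
    _ = _ := by ring

end RdF

namespace RdF

lemma TT_smul {ι : Type*} (k : ι → Esp d → ℂ) (α : ℝ) (hα : 0 ≤ α) (f : Esp d → ℂ) (x : Esp d) :
    TT (fun i x => (α : ℂ) * k i x) f x = ENNReal.ofReal α * TT k f x := by
  unfold TT
  rw [ENNReal.mul_iSup]
  congr 1; funext i
  have : (fun z => f z * ((α : ℂ) * k i (x - z))) = fun z => (α : ℂ) * (f z * k i (x - z)) := by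
    funext z; ring
  rw [this, integral_const_mul, enorm_mul]
  congr 1
  rw [← ofReal_norm]; simp [abs_of_nonneg hα]

lemma HH_smul {ι : Type*} (k : ι → Esp d → ℂ) (α : ℝ) (hα : 0 ≤ α) (x h : Esp d) :
    HH (fun i x => (α : ℂ) * k i x) x h = ENNReal.ofReal α * HH k x h := by
  unfold HH
  rw [ENNReal.mul_iSup]
  congr 1; funext i
  rw [← mul_sub, enorm_mul]
  congr 1
  rw [← ofReal_norm]; simp [abs_of_nonneg hα]

lemma interp_scaled (hd : 1 ≤ d) (p : ℝ) (hp1 : 1 < p) (hp2 : p < 2) :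
    ∃ C : ℝ≥0∞, C ≠ ∞ ∧ ∀ (ι : Type) [Countable ι] (k : ι → Esp d → ℂ),
      (∀ i, Continuous (k i)) → (∀ i, ∃ B : ℝ, ∀ x, ‖k i x‖ ≤ B) → ∀ A1 A2 : ℝ≥0∞,
      (∀ r : ℝ, 0 < r → ∀ h : Esp d, ‖h‖ ≤ r → ∫⁻ x in (ball 0 (2*r))ᶜ, HH k x h ≤ A1) →
      (∀ g : Esp d → ℂ, Measurable g → Integrable g → (∃ B : ℝ, ∀ x, ‖g x‖ ≤ B) →
        ∫⁻ x, TT k g x ^ 2 ≤ A2 * ∫⁻ x, ‖g x‖ₑ ^ 2) →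
      ∀ α : ℝ, 0 < α → ∀ f : Esp d → ℂ, Continuous f → Integrable f →
        ∫⁻ x, TT k f x ^ p ≤ C * ENNReal.ofReal (α ^ (-p)) * (1 + ENNReal.ofReal α * A1 +
          ENNReal.ofReal (α^2) * A2) * ∫⁻ x, ‖f x‖ₑ ^ p := by
  obtain ⟨C, hC, hI⟩ := interp (d := d) hd p hp1 hp2
  refine ⟨C, hC, ?_⟩
  intro ι _ k hk hb A1 A2 hA1 hA2 α hα f hf hfi
  have := hI ι (fun i x => (α : ℂ) * k i x) (fun i => continuous_const.mul (hk i)) (fun i => by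
      obtain ⟨B, hB⟩ := hb i
      refine ⟨α * B, fun x => ?_⟩
      rw [norm_mul, Complex.norm_real, Real.norm_of_nonneg hα.le]
      exact mul_le_mul_of_nonneg_left (hB x) hα.le) (ENNReal.ofReal α * A1) (ENNReal.ofReal (α^2) * A2)
      (by
        intro r hr h hh
        simp_rw [HH_smul k α hα.le]
        rw [lintegral_const_mul' _ _ (by simp)]
        gcongr
        exact hA1 r hr h hh) (by
        intro s hs g mg ig bg
        simp_rw [TT_smul k α hα.le]
        have mT : Measurable (TT k g) := measurable_TT k hk g mg
        have h1 := mul_meas_ge_le_lintegral (μ := volume)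
          (((mT.const_mul (ENNReal.ofReal α)).pow_const 2)) (ENNReal.ofReal (s^2))
        refine le_trans ?_ (h1.trans ?_)
        · gcongr with x
          intro hx
          rw [ENNReal.ofReal_pow hs.le]
          gcongr
        · simp_rw [mul_pow]
          rw [lintegral_const_mul' _ _ (by simp), ENNReal.ofReal_pow hα.le, mul_assoc]
          gcongr
          exact hA2 g mg ig ⟨_, bg⟩) f hf hfi
  simp_rw [TT_smul k α hα.le, ENNReal.mul_rpow_of_nonneg _ _ (show 0 ≤ p by linarith)] at this
  rw [lintegral_const_mul' _ _ (by finiteness)] at this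
  have e : ENNReal.ofReal (α ^ (-p)) * ENNReal.ofReal α ^ p = 1 := by
    rw [ENNReal.ofReal_rpow_of_pos hα, ← ENNReal.ofReal_mul (by positivity), ← Real.rpow_add hα]
    simp
  calc _ = ENNReal.ofReal (α ^ (-p)) * (ENNReal.ofReal α ^ p * ∫⁻ x, TT k f x ^ p) := by
        rw [← mul_assoc, e, one_mul]
    _ ≤ _ := mul_le_mul_right this _
    _ = _ := by ring

lemma interp_infty (hd : 1 ≤ d) (p : ℝ) (hp1 : 1 < p) (hp2 : p < 2) (ι : Type) [Countable ι]
    (k : ι → Esp d → ℂ)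
    (hk : ∀ i, Continuous (k i)) (hb : ∀ i, ∃ B : ℝ, ∀ x, ‖k i x‖ ≤ B) (A1 : ℝ≥0∞) (hA1' : A1 ≠ ∞)
    (hA1 : ∀ r : ℝ, 0 < r → ∀ h : Esp d, ‖h‖ ≤ r → ∫⁻ x in (ball 0 (2*r))ᶜ, HH k x h ≤ A1)
    (B : ℝ) (hB : 0 < B)
    (hA2 : ∀ g : Esp d → ℂ, Measurable g → Integrable g → ∀ M : ℝ, 0 < M → (∀ x, ‖g x‖ ≤ M) →
        ∀ x, TT k g x ≤ ENNReal.ofReal (B * M)) :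
    ∃ C : ℝ≥0∞, C ≠ ∞ ∧ ∀ f : Esp d → ℂ, Continuous f → Integrable f →
        ∫⁻ x, TT k f x ^ p ≤ C * ∫⁻ x, ‖f x‖ₑ ^ p := by
  obtain ⟨C, hC, hI⟩ := interp (d := d) hd p hp1 hp2
  set α : ℝ := (B * 2 ^ d)⁻¹ with hα'
  have hα : 0 < α := by positivity
  refine ⟨C * ENNReal.ofReal (α ^ (-p)) * (1 + ENNReal.ofReal α * A1), by finiteness, ?_⟩
  intro f hf hfi
  have := hI ι (fun i x => (α : ℂ) * k i x) (fun i => continuous_const.mul (hk i)) (fun i => by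
      obtain ⟨B, hB⟩ := hb i
      refine ⟨α * B, fun x => ?_⟩
      rw [norm_mul, Complex.norm_real, Real.norm_of_nonneg hα.le]
      exact mul_le_mul_of_nonneg_left (hB x) hα.le) (ENNReal.ofReal α * A1) 0
      (by
        intro r hr h hh
        simp_rw [HH_smul k α hα.le]
        rw [lintegral_const_mul' _ _ (by simp)]
        gcongr
        exact hA1 r hr h hh) (by
        intro s hs g mg ig bg
        simp_rw [TT_smul k α hα.le]
        have : {x | ENNReal.ofReal s < ENNReal.ofReal α * TT k g x} = ∅ := by
          rw [eq_empty_iff_forall_notMem]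
          intro x hx
          have hx' : ENNReal.ofReal s < ENNReal.ofReal α * TT k g x := hx
          refine absurd hx' (not_lt.mpr ?_)
          calc _ ≤ ENNReal.ofReal α * ENNReal.ofReal (B * (2 ^ d * s)) := by
                gcongr; exact hA2 g mg ig _ (by positivity) bg x
            _ = _ := by
                rw [← ENNReal.ofReal_mul hα.le]; congr 1; rw [hα']; field_simp
        rw [this]; simp) f hf hfi
  simp_rw [TT_smul k α hα.le, ENNReal.mul_rpow_of_nonneg _ _ (show 0 ≤ p by linarith)] at this
  rw [lintegral_const_mul' _ _ (by finiteness)] at this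
  have e : ENNReal.ofReal (α ^ (-p)) * ENNReal.ofReal α ^ p = 1 := by
    rw [ENNReal.ofReal_rpow_of_pos hα, ← ENNReal.ofReal_mul (by positivity), ← Real.rpow_add hα]
    simp
  calc _ = ENNReal.ofReal (α ^ (-p)) * (ENNReal.ofReal α ^ p * ∫⁻ x, TT k f x ^ p) := by
        rw [← mul_assoc, e, one_mul]
    _ ≤ _ := mul_le_mul_right this _
    _ = _ := by rw [add_zero]; ring

end RdF

namespace RdF

lemma lintegral_scale (t : ℝ) (ht : 0 < t) (g : Esp d → ℝ≥0∞) (hg : Measurable g) :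
    ∫⁻ x, ENNReal.ofReal ((t ^ d)⁻¹) * g (t⁻¹ • x) = ∫⁻ x, g x := by
  have h := Measure.map_addHaar_smul (volume : Measure (Esp d)) (r := t⁻¹) (by positivity)
  have h2 : ∫⁻ x, g (t⁻¹ • x) = ∫⁻ y, g y ∂(Measure.map (t⁻¹ • ·) (volume : Measure (Esp d))) := by
    rw [lintegral_map hg (by fun_prop)]
  rw [lintegral_const_mul _ (by fun_prop), h2, h, lintegral_smul_measure, smul_eq_mul, ← mul_assoc,
    ← ENNReal.ofReal_mul (by positivity), finrank_euclideanSpace_fin, inv_pow, inv_inv,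
    abs_of_pos (by positivity), inv_mul_cancel₀ (by positivity)]
  simp

def dil (t : ℝ) (L : Esp d → ℂ) (x : Esp d) : ℂ := (((t ^ d)⁻¹ : ℝ) : ℂ) * L (t⁻¹ • x)

lemma enorm_dil (t : ℝ) (ht : 0 < t) (L : Esp d → ℂ) (x : Esp d) :
    ‖dil t L x‖ₑ = ENNReal.ofReal ((t ^ d)⁻¹) * ‖L (t⁻¹ • x)‖ₑ := by
  rw [dil, enorm_mul, ← ofReal_norm, Complex.norm_real, Real.norm_of_nonneg (by positivity)]

lemma trans_L1 (L : Esp d → ℂ) (hL : ContDiff ℝ 1 L) (v : Esp d) :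
    ∫⁻ z, ‖L (z - v) - L z‖ₑ ≤ ‖v‖ₑ * ∫⁻ z, ‖fderiv ℝ L z‖ₑ := by
  have cD : Continuous (fderiv ℝ L) := hL.continuous_fderiv one_ne_zero
  have hpt : ∀ z, ‖L (z - v) - L z‖ₑ ≤ ∫⁻ s in Ioc (0:ℝ) 1, ‖v‖ₑ * ‖fderiv ℝ L (z - s • v)‖ₑ := by
    intro z
    have hder : ∀ s ∈ uIcc (0:ℝ) 1, HasDerivAt (fun s : ℝ => L (z - s • v))
        (fderiv ℝ L (z - s • v) (-v)) s := by
      intro s _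
      have h1 : HasDerivAt (fun s : ℝ => z - s • v) (-v) s := by
        simpa using ((hasDerivAt_id s).smul_const v).const_sub z
      exact ((hL.differentiable one_ne_zero _).hasFDerivAt).comp_hasDerivAt s h1
    have hc : Continuous fun s : ℝ => fderiv ℝ L (z - s • v) (-v) := by fun_prop
    have h2 := intervalIntegral.integral_eq_sub_of_hasDerivAt hder (hc.intervalIntegrable _ _)
    simp only [one_smul, zero_smul, sub_zero] at h2
    rw [← h2, intervalIntegral.integral_of_le zero_le_one]
    refine (enorm_integral_le_lintegral_enorm _).trans (lintegral_mono fun s => ?_)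
    calc _ ≤ ‖fderiv ℝ L (z - s • v)‖ₑ * ‖-v‖ₑ := ContinuousLinearMap.le_opENorm _ _
      _ = _ := by rw [enorm_neg, mul_comm]
  calc _ ≤ ∫⁻ z, ∫⁻ s in Ioc (0:ℝ) 1, ‖v‖ₑ * ‖fderiv ℝ L (z - s • v)‖ₑ := lintegral_mono hpt
    _ = ∫⁻ s in Ioc (0:ℝ) 1, ∫⁻ z, ‖v‖ₑ * ‖fderiv ℝ L (z - s • v)‖ₑ := by
        refine lintegral_lintegral_swap ?_
        have : Continuous fun q : Esp d × ℝ => fderiv ℝ L (q.1 - q.2 • v) := by fun_prop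
        exact (this.enorm.measurable.const_mul _).aemeasurable
    _ = ∫⁻ s in Ioc (0:ℝ) 1, ‖v‖ₑ * ∫⁻ z, ‖fderiv ℝ L z‖ₑ := by
        congr 1; funext s
        rw [lintegral_const_mul' _ _ (by simp)]
        congr 1
        exact lintegral_sub_right_eq_self (fun z => ‖fderiv ℝ L z‖ₑ) (s • v)
    _ = _ := by simp

lemma dil_large (L : Esp d → ℂ) (hL : ContDiff ℝ 1 L) (t : ℝ) (ht : 0 < t) (r : ℝ)
    (h : Esp d) (hh : ‖h‖ ≤ r) :
    ∫⁻ x, ‖dil t L (x - h) - dil t L x‖ₑ ≤ ENNReal.ofReal (r / t) * ∫⁻ z, ‖fderiv ℝ L z‖ₑ := by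
  have cL : Continuous L := hL.continuous
  have e : ∀ x, ‖dil t L (x - h) - dil t L x‖ₑ = ENNReal.ofReal ((t ^ d)⁻¹) *
      (fun z => ‖L (z - t⁻¹ • h) - L z‖ₑ) (t⁻¹ • x) := by
    intro x
    simp only [dil]
    rw [← mul_sub, enorm_mul, ← ofReal_norm, Complex.norm_real, Real.norm_of_nonneg (by positivity),
      smul_sub]
  rw [lintegral_congr e, lintegral_scale t ht (fun z => ‖L (z - t⁻¹ • h) - L z‖ₑ) (by fun_prop)]
  refine (trans_L1 L hL _).trans ?_
  gcongr
  rw [← ofReal_norm, norm_smul, Real.norm_of_nonneg (by positivity)]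
  apply ENNReal.ofReal_le_ofReal
  rw [inv_mul_eq_div]
  gcongr

lemma dil_small (L : Esp d → ℂ) (cL : Continuous L) (ε : ℝ) (hε : 0 < ε) (t : ℝ) (ht : 0 < t)
    (r : ℝ) (hr : 0 < r) (h : Esp d) (hh : ‖h‖ ≤ r) :
    ∫⁻ x in (ball 0 (2*r))ᶜ, ‖dil t L (x - h) - dil t L x‖ₑ ≤
      2 * (ENNReal.ofReal ((t/r) ^ ε) * ∫⁻ z, ENNReal.ofReal (‖z‖ ^ ε) * ‖L z‖ₑ) := by
  set u : Esp d → ℝ≥0∞ := fun x => ENNReal.ofReal ((‖x‖ / r) ^ ε) * ‖dil t L x‖ₑ with hu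
  have cdil : Continuous (dil t L) := by unfold dil; fun_prop
  have mu : Measurable u := by
    refine Measurable.mul ?_ cdil.enorm.measurable
    fun_prop
  have hge : ∀ x : Esp d, r ≤ ‖x‖ → ‖dil t L x‖ₑ ≤ u x := by
    intro x hx
    rw [hu]
    calc _ = 1 * ‖dil t L x‖ₑ := (one_mul _).symm
      _ ≤ _ := by
        refine mul_le_mul_left ?_ _
        rw [ENNReal.one_le_ofReal]
        apply Real.one_le_rpow _ hε.le
        rwa [one_le_div hr]
  calc _ ≤ ∫⁻ x in (ball 0 (2*r))ᶜ, (u (x - h) + u x) := by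
        refine setLIntegral_mono' measurableSet_ball.compl fun x hx => ?_
        have hx : 2 * r ≤ ‖x‖ := by simpa using hx
        have hxh : r ≤ ‖x - h‖ := by
          have := norm_sub_norm_le x h; linarith
        exact enorm_sub_le.trans (add_le_add (hge _ hxh) (hge _ (by linarith)))
    _ ≤ ∫⁻ x, (u (x - h) + u x) := setLIntegral_le_lintegral _ _
    _ = 2 * ∫⁻ x, u x := by
        rw [lintegral_add_right _ mu, lintegral_sub_right_eq_self u h, two_mul]
    _ = 2 * ∫⁻ z, ENNReal.ofReal ((t * ‖z‖ / r) ^ ε) * ‖L z‖ₑ := by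
        congr 1
        rw [← lintegral_scale t ht (fun z => ENNReal.ofReal ((t * ‖z‖ / r) ^ ε) * ‖L z‖ₑ) (by fun_prop)]
        congr 1; funext x
        rw [hu]
        simp only
        rw [enorm_dil t ht, norm_smul, Real.norm_of_nonneg (by positivity), mul_inv_cancel_left₀ ht.ne']
        ring
    _ = _ := by
        congr 1
        rw [← lintegral_const_mul' _ _ (by simp)]
        congr 1; funext z
        rw [← mul_assoc, ← ENNReal.ofReal_mul (by positivity), ← Real.mul_rpow (by positivity) (by positivity)]
        ring_nf

lemma horm_abs (L : Esp d → ℂ) (hL : ContDiff ℝ 1 L) (ε : ℝ) (hε : 0 < ε) (B : ℝ≥0∞)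
    (hB1 : ∫⁻ z, ENNReal.ofReal (‖z‖ ^ ε) * ‖L z‖ₑ ≤ B) (hB2 : ∫⁻ z, ‖fderiv ℝ L z‖ₑ ≤ B)
    (r : ℝ) (hr : 0 < r) (h : Esp d) (hh : ‖h‖ ≤ r) :
    ∫⁻ x in (ball 0 (2*r))ᶜ, ∫⁻ t in Ioi (0:ℝ),
      ENNReal.ofReal t⁻¹ * ‖dil t L (x - h) - dil t L x‖ₑ ≤ ENNReal.ofReal (2/ε + 1) * B := by
  have cL : Continuous L := hL.continuous
  have mm : Measurable (Function.uncurry fun (x : Esp d) (t : ℝ) =>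
      ENNReal.ofReal t⁻¹ * ‖dil t L (x - h) - dil t L x‖ₑ) := by
    unfold dil; simp only [Function.uncurry_def]; 
    have m1 : Measurable fun q : Esp d × ℝ => q.2⁻¹ • (q.1 - h) := by fun_prop
    have m2 : Measurable fun q : Esp d × ℝ => q.2⁻¹ • (q.1) := by fun_prop
    have m3 := cL.measurable.comp m1
    have m4 := cL.measurable.comp m2
    simp only [Function.comp_def] at m3 m4
    have m5 : Measurable fun q : Esp d × ℝ => (((q.2 ^ d)⁻¹ : ℝ) : ℂ) := by fun_prop
    exact Measurable.mul (by fun_prop) ((m5.mul m3).sub (m5.mul m4)).enorm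
  rw [lintegral_lintegral_swap mm.aemeasurable]
  have e1 : ∀ t, ∫⁻ x in (ball 0 (2*r))ᶜ, ENNReal.ofReal t⁻¹ * ‖dil t L (x - h) - dil t L x‖ₑ =
      ENNReal.ofReal t⁻¹ * ∫⁻ x in (ball 0 (2*r))ᶜ, ‖dil t L (x - h) - dil t L x‖ₑ := fun t =>
    lintegral_const_mul' _ _ (by simp)
  simp_rw [e1]
  rw [← Ioo_union_Ici_eq_Ioi hr]
  refine (lintegral_union_le _ _ _).trans ?_
  have b1 : ∫⁻ t in Ioo 0 r, ENNReal.ofReal t⁻¹ *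
      ∫⁻ x in (ball 0 (2*r))ᶜ, ‖dil t L (x - h) - dil t L x‖ₑ ≤ ENNReal.ofReal (2/ε) * B := by
    calc _ ≤ ∫⁻ t in Ioo 0 r, (2 * ENNReal.ofReal ((r^ε)⁻¹) * B) * ENNReal.ofReal (t ^ (ε - 1)) := by
          refine setLIntegral_mono' measurableSet_Ioo fun t ht => ?_
          calc _ ≤ ENNReal.ofReal t⁻¹ * (2 * (ENNReal.ofReal ((t/r) ^ ε) * B)) := by
                gcongr
                exact (dil_small L cL ε hε t ht.1 r hr h hh).trans (by gcongr)
            _ = (2 * B) * (ENNReal.ofReal t⁻¹ * ENNReal.ofReal ((t/r) ^ ε)) := by ring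
            _ = (2 * B) * (ENNReal.ofReal ((r^ε)⁻¹) * ENNReal.ofReal (t ^ (ε - 1))) := by
                congr 1
                have := ht.1
                rw [← ENNReal.ofReal_mul (by positivity), ← ENNReal.ofReal_mul (by positivity),
                  Real.div_rpow ht.1.le hr.le, Real.rpow_sub_one ht.1.ne']
                congr 1; ring
            _ = _ := by ring
      _ = _ := by
          rw [lintegral_const_mul _ (by fun_prop), lintegral_rpow_Ioo _ _ (by linarith) hr.le,
            sub_add_cancel, mul_right_comm, mul_assoc 2, ← ENNReal.ofReal_mul (by positivity)]
          congr 1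
          rw [show (2:ℝ≥0∞) = ENNReal.ofReal 2 by simp, ← ENNReal.ofReal_mul (by positivity)]
          congr 1
          have : 0 < r ^ ε := by positivity
          field_simp
  have b2 : ∫⁻ t in Ici r, ENNReal.ofReal t⁻¹ *
      ∫⁻ x in (ball 0 (2*r))ᶜ, ‖dil t L (x - h) - dil t L x‖ₑ ≤ 1 * B := by
    calc _ ≤ ∫⁻ t in Ici r, (ENNReal.ofReal r * B) * ENNReal.ofReal (t ^ (-2:ℝ)) := by
          refine setLIntegral_mono' measurableSet_Ici fun t ht => ?_
          have ht' : 0 < t := hr.trans_le ht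
          calc _ ≤ ENNReal.ofReal t⁻¹ * (ENNReal.ofReal (r/t) * B) := by
                gcongr
                exact (setLIntegral_le_lintegral _ _).trans
                  ((dil_large L hL t ht' r h hh).trans (by gcongr))
            _ = B * (ENNReal.ofReal t⁻¹ * ENNReal.ofReal (r/t)) := by ring
            _ = B * (ENNReal.ofReal r * ENNReal.ofReal (t ^ (-2:ℝ))) := by
                congr 1
                rw [← ENNReal.ofReal_mul (by positivity), ← ENNReal.ofReal_mul (by positivity),
                  Real.rpow_neg ht'.le, Real.rpow_two]
                congr 1; field_simp
            _ = _ := by ring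
      _ = _ := by
          rw [lintegral_const_mul _ (by fun_prop), lintegral_rpow_Ici _ _ (by norm_num) hr,
            mul_right_comm, ← ENNReal.ofReal_mul (by positivity)]
          congr 1
          norm_num [Real.rpow_neg_one, hr.ne']
  refine (add_le_add b1 b2).trans (le_of_eq ?_)
  rw [← add_mul, ENNReal.ofReal_add (by positivity) (by norm_num)]; simp

end RdF

namespace RdF

lemma ftc_enorm (G G' : ℝ → ℂ) (hG : ∀ t, 0 < t → HasDerivAt G (G' t) t)
    (hc : ContinuousOn G' (Ioi 0)) (t T : ℝ) (ht : 0 < t) (hT : 0 < T) :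
    ‖G t‖ₑ ≤ ‖G T‖ₑ + ∫⁻ s in Ioi (0:ℝ), ‖G' s‖ₑ := by
  have hsub : uIcc T t ⊆ Ioi 0 := by
    intro s hs
    exact lt_of_lt_of_le (lt_min hT ht) hs.1
  have h2 := intervalIntegral.integral_eq_sub_of_hasDerivAt (fun s hs => hG s (hsub hs))
    ((hc.mono hsub).intervalIntegrable)
  have h3 : G t = G T + ∫ s in T..t, G' s := by rw [h2]; ring
  rw [h3]
  refine (enorm_add_le _ _).trans ?_
  gcongr
  rw [intervalIntegral.intervalIntegral_eq_integral_uIoc, enorm_smul]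
  have : ‖(if T ≤ t then (1:ℝ) else -1)‖ₑ = 1 := by split_ifs <;> simp
  rw [this, one_mul]
  refine (enorm_integral_le_lintegral_enorm _).trans (lintegral_mono_set ?_)
  exact uIoc_subset_uIcc.trans hsub

lemma ftc_limit (G G' : ℝ → ℂ) (hG : ∀ t, 0 < t → HasDerivAt G (G' t) t)
    (hc : ContinuousOn G' (Ioi 0)) (l : Filter ℝ) [l.NeBot] (hl : ∀ᶠ T in l, 0 < T)
    (h0 : Filter.Tendsto G l (nhds 0)) (t : ℝ) (ht : 0 < t) :
    ‖G t‖ₑ ≤ ∫⁻ s in Ioi (0:ℝ), ‖G' s‖ₑ := by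
  have h1 : Filter.Tendsto (fun T => ‖G T‖ₑ + ∫⁻ s in Ioi (0:ℝ), ‖G' s‖ₑ) l
      (nhds (0 + ∫⁻ s in Ioi (0:ℝ), ‖G' s‖ₑ)) := by
    refine Filter.Tendsto.add ?_ tendsto_const_nhds
    simpa using h0.enorm
  rw [zero_add] at h1
  refine ge_of_tendsto h1 ?_
  filter_upwards [hl] with T hT
  exact ftc_enorm G G' hG hc t T ht hT

/-- generator kernel -/
def LL (ψ : SchwartzMap (Esp d) ℂ) (y : Esp d) (z : Esp d) : ℂ :=
  -((d : ℂ) * ψ (z - y) + fderiv ℝ ψ (z - y) z)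

lemma hasDerivAt_dil (ψ : SchwartzMap (Esp d) ℂ) (y x : Esp d) (t : ℝ) (ht : 0 < t) :
    HasDerivAt (fun t => dil t (fun z => ψ (z - y)) x)
      (((t⁻¹ : ℝ) : ℂ) * dil t (LL ψ y) x) t := by
  have h1 : HasDerivAt (fun t : ℝ => (t ^ d)⁻¹) (-(d:ℝ) * t⁻¹ * (t^d)⁻¹) t := by
    have := (hasDerivAt_pow d t).fun_inv (by positivity)
    refine this.congr_deriv ?_
    rcases d with _ | n
    · simp
    · simp only [Nat.add_sub_cancel]
      field_simp
      ring
  have h2 : HasDerivAt (fun t : ℝ => t⁻¹ • x - y) (-(t⁻¹ * t⁻¹) • x) t := by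
    have := ((hasDerivAt_inv ht.ne').smul_const x).sub_const y
    refine this.congr_deriv ?_
    congr 1
    field_simp
  have h3 : HasDerivAt (fun t : ℝ => ψ (t⁻¹ • x - y)) (fderiv ℝ ψ (t⁻¹ • x - y) (-(t⁻¹ * t⁻¹) • x)) t :=
    (ψ.differentiableAt.hasFDerivAt).comp_hasDerivAt t h2
  have h4 := h1.ofReal_comp.mul h3
  unfold dil
  refine h4.congr_deriv ?_
  simp only [LL]
  rw [map_smul, map_smul, Complex.real_smul, Complex.real_smul]
  push_cast
  ring

lemma continuous_LL (ψ : SchwartzMap (Esp d) ℂ) : Continuous (fun q : Esp d × Esp d => LL ψ q.1 q.2) := by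
  have c1 : Continuous (fderiv ℝ ψ) := (ψ.smooth 1).continuous_fderiv one_ne_zero
  have c2 : Continuous ψ := ψ.continuous
  unfold LL
  exact ((continuous_const.mul (c2.comp (continuous_snd.sub continuous_fst))).add
    ((c1.comp (continuous_snd.sub continuous_fst)).clm_apply continuous_snd)).neg

lemma sup_le (hd : 1 ≤ d) (ψ : SchwartzMap (Esp d) ℂ) (y x x' : Esp d) (t : ℝ) (ht : 0 < t) :
    ‖dil t (fun z => ψ (z - y)) x' - dil t (fun z => ψ (z - y)) x‖ₑ ≤
      ∫⁻ s in Ioi (0:ℝ), ENNReal.ofReal s⁻¹ * ‖dil s (LL ψ y) x' - dil s (LL ψ y) x‖ₑ := by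
  have cL : Continuous (LL ψ y) := (continuous_LL ψ).comp (continuous_const.prodMk continuous_id)
  have cdil : ∀ x, ContinuousOn (fun s => dil s (LL ψ y) x) (Ioi 0) := by
    intro x
    unfold dil
    have c1 : ContinuousOn (fun s : ℝ => (s^d)⁻¹) (Ioi 0) :=
      (continuousOn_pow d).inv₀ fun s hs => (pow_pos hs d).ne'
    have c0 : ContinuousOn (fun s : ℝ => s⁻¹) (Ioi (0:ℝ)) :=
      continuousOn_inv₀.mono fun s hs => ne_of_gt (mem_Ioi.mp hs)
    have c2 : ContinuousOn (fun s : ℝ => s⁻¹ • x) (Ioi (0:ℝ)) :=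
      ContinuousOn.smul c0 continuousOn_const
    exact (Complex.continuous_ofReal.comp_continuousOn c1).mul (cL.comp_continuousOn c2)
  have lim : ∀ x, Filter.Tendsto (fun s => dil s (fun z => ψ (z - y)) x) Filter.atTop (nhds 0) := by
    intro x
    obtain ⟨B, hB⟩ := ψ.decay 0 0
    have hB' : ∀ z, ‖ψ z‖ ≤ B := fun z => by simpa using hB.2 z
    have t1 : Filter.Tendsto (fun s : ℝ => (s^d)⁻¹ * B) Filter.atTop (nhds (0 * B)) :=
      (Filter.Tendsto.inv_tendsto_atTop (Filter.tendsto_pow_atTop (by omega))).mul_const B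
    rw [zero_mul] at t1
    refine squeeze_zero_norm' ?_ t1
    filter_upwards [Filter.eventually_gt_atTop 0] with s hs
    simp only [dil]
    rw [norm_mul, Complex.norm_real, Real.norm_of_nonneg (by positivity)]
    gcongr
    exact hB' _
  have := ftc_limit (fun s => dil s (fun z => ψ (z - y)) x' - dil s (fun z => ψ (z - y)) x)
    (fun s => ((s⁻¹ : ℝ) : ℂ) * dil s (LL ψ y) x' - ((s⁻¹ : ℝ) : ℂ) * dil s (LL ψ y) x)
    (fun s hs => (hasDerivAt_dil ψ y x' s hs).sub (hasDerivAt_dil ψ y x s hs))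
    (by
      have c3 : ContinuousOn (fun s : ℝ => ((s⁻¹ : ℝ) : ℂ)) (Ioi 0) :=
        Complex.continuous_ofReal.comp_continuousOn
          (continuousOn_id.inv₀ fun s hs => (show 0 < s from hs).ne')
      exact (c3.mul (cdil x')).sub (c3.mul (cdil x)))
    Filter.atTop (Filter.eventually_gt_atTop 0)
    (by simpa using (lim x').sub (lim x)) t ht
  refine this.trans (le_of_eq (setLIntegral_congr_fun measurableSet_Ioi fun s hs => ?_))
  have hs : 0 < s := hs
  rw [← mul_sub, enorm_mul, ← ofReal_norm, Complex.norm_real, Real.norm_of_nonneg (by positivity)]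

/-- weight -/
def WW (ψ : SchwartzMap (Esp d) ℂ) (w : Esp d) : ℝ :=
  (1 + ‖w‖)^2 * (d * ‖ψ w‖ + (d+1) * ‖fderiv ℝ ψ w‖ + ‖fderiv ℝ (fderiv ℝ ψ) w‖)

lemma integrable_weight {F : Type*} [NormedAddCommGroup F] [NormedSpace ℝ F]
    (g : SchwartzMap (Esp d) F) :
    Integrable (fun w => (1 + ‖w‖)^2 * ‖g w‖) := by
  have h0 := g.integrable_pow_mul (μ := volume) 0
  have h1 := g.integrable_pow_mul (μ := volume) 1
  have h2 := g.integrable_pow_mul (μ := volume) 2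
  refine ((h0.add (h1.const_mul 2)).add h2).congr (Filter.Eventually.of_forall fun w => ?_)
  simp only [Pi.add_apply]; ring

lemma integrable_WW (ψ : SchwartzMap (Esp d) ℂ) : Integrable (WW ψ) := by
  have h0 := integrable_weight ψ
  have h1 := integrable_weight (SchwartzMap.fderivCLM ℝ _ _ ψ)
  have h2 := integrable_weight (SchwartzMap.fderivCLM ℝ _ _ (SchwartzMap.fderivCLM ℝ _ _ ψ))
  have e : ⇑(SchwartzMap.fderivCLM ℝ (Esp d) ℂ ψ) = fderiv ℝ ψ := by
    funext w; exact SchwartzMap.fderivCLM_apply ..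
  refine (((h0.const_mul d).add (h1.const_mul (d+1))).add h2).congr
    (Filter.Eventually.of_forall fun w => ?_)
  simp only [Pi.add_apply, SchwartzMap.fderivCLM_apply, WW, e]; ring

lemma contDiff_LL (ψ : SchwartzMap (Esp d) ℂ) (y : Esp d) : ContDiff ℝ 1 (LL ψ y) := by
  have h1 : ContDiff ℝ 1 (fderiv ℝ ψ) := (ψ.smooth 2).fderiv_right (by norm_num)
  have h2 : ContDiff ℝ 1 ψ := ψ.smooth 1
  unfold LL
  have h3 : ContDiff ℝ 1 (fun z : Esp d => z - y) := contDiff_id.sub contDiff_const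
  exact ((contDiff_const.mul (h2.comp h3)).add ((h1.comp h3).clm_apply contDiff_id)).neg

lemma norm_le_rho (ρ : ℝ) (hρ : 1 ≤ ρ) (y z : Esp d) (hy : ‖y‖ ≤ ρ) : ‖z‖ ≤ ρ * (1 + ‖z - y‖) := by
  have := norm_sub_norm_le z y
  nlinarith [norm_nonneg (z - y)]

lemma norm_LL_le (ψ : SchwartzMap (Esp d) ℂ) (ρ : ℝ) (hρ : 1 ≤ ρ) (y z : Esp d) (hy : ‖y‖ ≤ ρ) :
    ‖LL ψ y z‖ ≤ ρ * (1 + ‖z - y‖) * (d * ‖ψ (z-y)‖ + ‖fderiv ℝ ψ (z - y)‖) := by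
  have hz := norm_le_rho ρ hρ y z hy
  unfold LL
  rw [norm_neg]
  refine (norm_add_le _ _).trans ?_
  rw [norm_mul, Complex.norm_natCast, mul_add]
  have h1 : 1 ≤ ρ * (1 + ‖z - y‖) := by nlinarith [norm_nonneg (z - y)]
  refine add_le_add ?_ ?_
  · exact le_mul_of_one_le_left (by positivity) h1
  · refine (ContinuousLinearMap.le_opNorm _ _).trans ?_
    rw [mul_comm]
    gcongr

lemma norm_fderiv_LL_le (ψ : SchwartzMap (Esp d) ℂ) (ρ : ℝ) (hρ : 1 ≤ ρ) (y z : Esp d) (hy : ‖y‖ ≤ ρ) :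
    ‖fderiv ℝ (LL ψ y) z‖ ≤ ρ * WW ψ (z - y) := by
  have hz := norm_le_rho ρ hρ y z hy
  have hsub : HasFDerivAt (fun z : Esp d => z - y) (ContinuousLinearMap.id ℝ (Esp d)) z :=
    (hasFDerivAt_id z).sub_const y
  have hD : HasFDerivAt (fderiv ℝ ψ) (fderiv ℝ (fderiv ℝ ψ) (z - y)) (z - y) :=
    (((ψ.smooth 2).fderiv_right (m := 1) (by norm_num)).differentiable one_ne_zero _).hasFDerivAt
  have h1 : HasFDerivAt (fun z => ψ (z - y)) (fderiv ℝ ψ (z - y)) z := by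
    exact ((ψ.differentiableAt.hasFDerivAt).comp z hsub).congr_fderiv (by ext; simp)
  have h2 : HasFDerivAt (fun z => fderiv ℝ ψ (z - y)) (fderiv ℝ (fderiv ℝ ψ) (z - y)) z := by
    exact (hD.comp z hsub).congr_fderiv (by ext; simp)
  have h3 := ((h1.const_mul (d:ℂ)).add (h2.clm_apply (hasFDerivAt_id z))).neg
  have h4 : fderiv ℝ (LL ψ y) z = _ := h3.fderiv
  rw [h4, norm_neg]
  have hw := norm_nonneg (z - y)
  have h1' : 1 ≤ ρ * (1 + ‖z - y‖)^2 := by nlinarith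
  refine ContinuousLinearMap.opNorm_le_bound _ (by unfold WW; positivity) fun v => ?_
  simp only [ContinuousLinearMap.add_apply, ContinuousLinearMap.smul_apply,
    ContinuousLinearMap.comp_apply, ContinuousLinearMap.flip_apply, ContinuousLinearMap.id_apply, id]
  have b1 : ‖fderiv ℝ ψ (z - y) v‖ ≤ ‖fderiv ℝ ψ (z - y)‖ * ‖v‖ := ContinuousLinearMap.le_opNorm _ _
  have b2 : ‖fderiv ℝ (fderiv ℝ ψ) (z - y) v z‖ ≤ ‖fderiv ℝ (fderiv ℝ ψ) (z - y)‖ * ‖v‖ * ‖z‖ :=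
    ContinuousLinearMap.le_opNorm₂ _ _ _
  calc _ ≤ d * (‖fderiv ℝ ψ (z - y)‖ * ‖v‖) + (‖fderiv ℝ ψ (z - y)‖ * ‖v‖ +
        ‖fderiv ℝ (fderiv ℝ ψ) (z - y)‖ * ‖v‖ * (ρ * (1 + ‖z - y‖))) := by
        refine (norm_add_le _ _).trans (add_le_add ?_ ((norm_add_le _ _).trans (add_le_add b1 ?_)))
        · rw [norm_smul, Complex.norm_natCast]; gcongr
        · exact b2.trans (by gcongr)
    _ = (1 * ((d + 1) * ‖fderiv ℝ ψ (z - y)‖) +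
        (ρ * (1 + ‖z - y‖)) * ‖fderiv ℝ (fderiv ℝ ψ) (z - y)‖) * ‖v‖ := by ring
    _ ≤ (ρ * (1 + ‖z - y‖)^2 * ((d + 1) * ‖fderiv ℝ ψ (z - y)‖) +
        (ρ * (1 + ‖z - y‖)^2) * ‖fderiv ℝ (fderiv ℝ ψ) (z - y)‖) * ‖v‖ := by
        gcongr
        nlinarith
    _ ≤ _ := by
        gcongr
        unfold WW
        have : 0 ≤ ρ * (1 + ‖z - y‖)^2 * (d * ‖ψ (z - y)‖) := by positivity
        nlinarith

lemma weight_LL_le (ψ : SchwartzMap (Esp d) ℂ) (ε : ℝ) (hε : 0 < ε) (hε1 : ε ≤ 1)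
    (ρ : ℝ) (hρ : 1 ≤ ρ) (y z : Esp d) (hy : ‖y‖ ≤ ρ) :
    ‖z‖ ^ ε * ‖LL ψ y z‖ ≤ ρ ^ (1 + ε) * WW ψ (z - y) := by
  have hz := norm_le_rho ρ hρ y z hy
  have hw := norm_nonneg (z - y)
  have hρ0 : 0 < ρ := by linarith
  calc _ ≤ (ρ ^ ε * (1 + ‖z - y‖)) * (ρ * (1 + ‖z - y‖) * (d * ‖ψ (z-y)‖ + ‖fderiv ℝ ψ (z - y)‖)) := by
        gcongr
        · calc ‖z‖ ^ ε ≤ (ρ * (1 + ‖z - y‖)) ^ ε := by gcongr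
            _ = ρ ^ ε * (1 + ‖z - y‖) ^ ε := Real.mul_rpow (by positivity) (by positivity)
            _ ≤ ρ ^ ε * (1 + ‖z - y‖) ^ (1:ℝ) := by gcongr; linarith
            _ = _ := by rw [Real.rpow_one]
        · exact norm_LL_le ψ ρ hρ y z hy
    _ = ρ ^ (1 + ε) * ((1 + ‖z - y‖)^2 * (d * ‖ψ (z-y)‖ + 1 * ‖fderiv ℝ ψ (z - y)‖ + 0)) := by
        rw [Real.rpow_add hρ0, Real.rpow_one]; ring
    _ ≤ _ := by
        unfold WW
        gcongr
        · simp
        · positivity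

lemma horm_single (ψ : SchwartzMap (Esp d) ℂ) (ε : ℝ) (hε : 0 < ε) (hε1 : ε ≤ 1) :
    ∃ K : ℝ≥0∞, K ≠ ∞ ∧ ∀ ρ : ℝ, 1 ≤ ρ → ∀ y : Esp d, ‖y‖ ≤ ρ → ∀ r : ℝ, 0 < r → ∀ h : Esp d,
      ‖h‖ ≤ r → ∫⁻ x in (ball 0 (2*r))ᶜ, ∫⁻ t in Ioi (0:ℝ),
      ENNReal.ofReal t⁻¹ * ‖dil t (LL ψ y) (x - h) - dil t (LL ψ y) x‖ₑ ≤
        ENNReal.ofReal (ρ ^ (1 + ε)) * K := by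
  have hW0 : ∀ w, 0 ≤ WW ψ w := fun w => by unfold WW; positivity
  have hfin : ∫⁻ w, ENNReal.ofReal (WW ψ w) ≠ ∞ := (integrable_WW ψ).lintegral_lt_top.ne
  refine ⟨ENNReal.ofReal (2/ε + 1) * ∫⁻ w, ENNReal.ofReal (WW ψ w), by finiteness, ?_⟩
  intro ρ hρ y hy r hr h hh
  have hρ0 : 0 < ρ := by linarith
  have e : ∫⁻ z, ENNReal.ofReal (ρ ^ (1+ε) * WW ψ (z - y)) =
      ENNReal.ofReal (ρ ^ (1+ε)) * ∫⁻ w, ENNReal.ofReal (WW ψ w) := by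
    simp_rw [ENNReal.ofReal_mul (show 0 ≤ ρ ^ (1+ε) by positivity)]
    rw [lintegral_const_mul' _ _ (by simp)]
    congr 1
    exact lintegral_sub_right_eq_self (fun w => ENNReal.ofReal (WW ψ w)) y
  have := horm_abs (LL ψ y) (contDiff_LL ψ y) ε hε
    (ENNReal.ofReal (ρ ^ (1+ε)) * ∫⁻ w, ENNReal.ofReal (WW ψ w))
    (by
      rw [← e]
      refine lintegral_mono fun z => ?_
      rw [← ofReal_norm, ← ENNReal.ofReal_mul (by positivity)]
      exact ENNReal.ofReal_le_ofReal (weight_LL_le ψ ε hε hε1 ρ hρ y z hy))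
    (by
      rw [← e]
      refine lintegral_mono fun z => ?_
      rw [← ofReal_norm]
      refine ENNReal.ofReal_le_ofReal ((norm_fderiv_LL_le ψ ρ hρ y z hy).trans ?_)
      refine mul_le_mul_of_nonneg_right ?_ (hW0 _)
      calc ρ = ρ ^ (1:ℝ) := (Real.rpow_one _).symm
        _ ≤ _ := by gcongr <;> linarith) r hr h hh
  exact this.trans (le_of_eq (by ring))

end RdF

namespace RdF

/-- kernel of `f ↦ f * ψ_t * ν_t`. -/
def ker (ψ : SchwartzMap (Esp d) ℂ) (ν : Measure (Esp d)) (t : ℝ) (x : Esp d) : ℂ :=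
  ∫ y, dil t (fun z => ψ (z - y)) x ∂ν

abbrev Idx := {q : ℚ // 0 < q}

def kfam (ψ : SchwartzMap (Esp d) ℂ) (ν : Measure (Esp d)) (i : Idx) : Esp d → ℂ :=
  ker ψ ν ((i : ℚ) : ℝ)

lemma Idx_pos (i : Idx) : (0:ℝ) < ((i : ℚ) : ℝ) := by exact_mod_cast i.2

lemma schwartz_bdd (ψ : SchwartzMap (Esp d) ℂ) : ∃ B : ℝ, 0 ≤ B ∧ ∀ z, ‖ψ z‖ ≤ B := by
  obtain ⟨B, hB⟩ := ψ.decay 0 0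
  have hB' : ∀ z, ‖ψ z‖ ≤ B := fun z => by simpa using hB.2 z
  exact ⟨B, (norm_nonneg _).trans (hB' 0), hB'⟩

lemma norm_dil_le (ψ : SchwartzMap (Esp d) ℂ) (B : ℝ) (hB : ∀ z, ‖ψ z‖ ≤ B) (t : ℝ) (ht : 0 < t)
    (x y : Esp d) : ‖dil t (fun z => ψ (z - y)) x‖ ≤ (t^d)⁻¹ * B := by
  unfold dil
  rw [norm_mul, Complex.norm_real, Real.norm_of_nonneg (by positivity)]
  gcongr
  exact hB _

lemma continuous_dil (ψ : SchwartzMap (Esp d) ℂ) (t : ℝ) :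
    Continuous (fun q : Esp d × Esp d => dil t (fun z => ψ (z - q.2)) q.1) := by
  have := ψ.continuous
  unfold dil
  fun_prop

lemma integrable_dil (ψ : SchwartzMap (Esp d) ℂ) (ν : Measure (Esp d)) [IsFiniteMeasure ν] (t : ℝ)
    (ht : 0 < t) (x : Esp d) : Integrable (fun y => dil t (fun z => ψ (z - y)) x) ν := by
  obtain ⟨B, hB0, hB⟩ := schwartz_bdd ψ
  refine Integrable.of_bound (C := (t^d)⁻¹ * B) ?_ ?_
  · exact ((continuous_dil ψ t).comp (continuous_const.prodMk continuous_id)).aestronglyMeasurable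
  · exact Filter.Eventually.of_forall fun y => norm_dil_le ψ B hB t ht x y

lemma continuous_ker (ψ : SchwartzMap (Esp d) ℂ) (ν : Measure (Esp d)) [IsFiniteMeasure ν] (t : ℝ)
    (ht : 0 < t) : Continuous (ker ψ ν t) := by
  obtain ⟨B, hB0, hB⟩ := schwartz_bdd ψ
  unfold ker
  refine continuous_of_dominated (bound := fun _ => (t^d)⁻¹ * B) ?_ ?_ (integrable_const _) ?_
  · intro x
    exact (integrable_dil ψ ν t ht x).1
  · intro x
    exact Filter.Eventually.of_forall fun y => norm_dil_le ψ B hB t ht x y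
  · exact Filter.Eventually.of_forall fun y =>
      (continuous_dil ψ t).comp (continuous_id.prodMk continuous_const)

lemma bdd_ker (ψ : SchwartzMap (Esp d) ℂ) (ν : Measure (Esp d)) [IsFiniteMeasure ν] (t : ℝ)
    (ht : 0 < t) : ∃ B : ℝ, ∀ x, ‖ker ψ ν t x‖ ≤ B := by
  obtain ⟨B, hB0, hB⟩ := schwartz_bdd ψ
  refine ⟨_, fun x => norm_integral_le_of_norm_le_const
    (Filter.Eventually.of_forall fun y => norm_dil_le ψ B hB t ht x y)⟩

lemma lintegral_ker_le (ψ : SchwartzMap (Esp d) ℂ) (ν : Measure (Esp d)) [IsFiniteMeasure ν] (t : ℝ)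
    (ht : 0 < t) : ∫⁻ x, ‖ker ψ ν t x‖ₑ ≤ ν univ * ∫⁻ z, ‖ψ z‖ₑ := by
  calc _ ≤ ∫⁻ x, ∫⁻ y, ‖dil t (fun z => ψ (z - y)) x‖ₑ ∂ν :=
        lintegral_mono fun x => enorm_integral_le_lintegral_enorm _
    _ = ∫⁻ y, (∫⁻ x, ‖dil t (fun z => ψ (z - y)) x‖ₑ) ∂ν :=
        lintegral_lintegral_swap (continuous_dil ψ t).enorm.measurable.aemeasurable
    _ = ∫⁻ y, (∫⁻ z, ‖ψ z‖ₑ) ∂ν := by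
        congr 1; funext y
        simp_rw [enorm_dil t ht]
        have hm : Measurable fun z => ‖ψ (z - y)‖ₑ :=
          (ψ.continuous.comp (continuous_id.sub continuous_const)).enorm.measurable
        rw [lintegral_scale t ht (fun z => ‖ψ (z - y)‖ₑ) hm]
        exact lintegral_sub_right_eq_self (fun z => ‖ψ z‖ₑ) y
    _ = _ := by simp [mul_comm]

lemma TT_infty (ψ : SchwartzMap (Esp d) ℂ) (ν : Measure (Esp d)) [IsFiniteMeasure ν] 
    (g : Esp d → ℂ) (M : ℝ) (hM : ∀ x, ‖g x‖ ≤ M) (x : Esp d) :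
    TT (kfam ψ ν) g x ≤ (ν univ * ∫⁻ z, ‖ψ z‖ₑ) * ENNReal.ofReal M := by
  refine iSup_le fun i => ?_
  calc _ ≤ ∫⁻ z, ‖g z * kfam ψ ν i (x - z)‖ₑ := enorm_integral_le_lintegral_enorm _
    _ ≤ ∫⁻ z, ENNReal.ofReal M * ‖kfam ψ ν i (x - z)‖ₑ := by
        refine lintegral_mono fun z => ?_
        rw [enorm_mul]
        gcongr
        rw [← ofReal_norm]; exact ENNReal.ofReal_le_ofReal (hM z)
    _ = ENNReal.ofReal M * ∫⁻ z, ‖kfam ψ ν i z‖ₑ := by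
        rw [lintegral_const_mul' _ _ (by simp)]
        congr 1
        exact lintegral_sub_left_eq_self (fun z => ‖kfam ψ ν i z‖ₑ) x
    _ ≤ _ := by
        rw [mul_comm]; gcongr
        exact lintegral_ker_le ψ ν _ (Idx_pos i)

lemma horm_main (hd : 1 ≤ d) (ψ : SchwartzMap (Esp d) ℂ) (ε : ℝ) (hε : 0 < ε) (hε1 : ε ≤ 1) :
    ∃ K : ℝ≥0∞, K ≠ ∞ ∧ ∀ ρ : ℝ, 1 ≤ ρ → ∀ (ν : Measure (Esp d)) [IsFiniteMeasure ν],
      (∀ᵐ y ∂ν, ‖y‖ ≤ ρ) → ∀ r : ℝ, 0 < r → ∀ h : Esp d,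
      ‖h‖ ≤ r → ∫⁻ x in (ball 0 (2*r))ᶜ, HH (kfam ψ ν) x h ≤
        ENNReal.ofReal (ρ ^ (1 + ε)) * K * ν univ := by
  obtain ⟨K, hK, hS⟩ := horm_single ψ ε hε hε1
  refine ⟨K, hK, ?_⟩
  intro ρ hρ ν _ hν r hr h hh
  set Φ : Esp d → Esp d → ℝ≥0∞ := fun x y => ∫⁻ t in Ioi (0:ℝ),
      ENNReal.ofReal t⁻¹ * ‖dil t (LL ψ y) (x - h) - dil t (LL ψ y) x‖ₑ with hΦ
  have mΦ : Measurable (Function.uncurry Φ) := by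
    have cL := continuous_LL ψ
    have mm : Measurable fun q : (Esp d × Esp d) × ℝ =>
        ENNReal.ofReal q.2⁻¹ * ‖dil q.2 (LL ψ q.1.2) (q.1.1 - h) - dil q.2 (LL ψ q.1.2) q.1.1‖ₑ := by
      unfold dil
      have m1 : Measurable fun q : (Esp d × Esp d) × ℝ => (q.1.2, q.2⁻¹ • (q.1.1 - h)) := by fun_prop
      have m2 : Measurable fun q : (Esp d × Esp d) × ℝ => (q.1.2, q.2⁻¹ • (q.1.1)) := by fun_prop
      have m3 := cL.measurable.comp m1
      have m4 := cL.measurable.comp m2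
      simp only [Function.comp_def] at m3 m4
      have m5 : Measurable fun q : (Esp d × Esp d) × ℝ => (((q.2 ^ d)⁻¹ : ℝ) : ℂ) := by fun_prop
      exact Measurable.mul (by fun_prop) ((m5.mul m3).sub (m5.mul m4)).enorm
    exact mm.lintegral_prod_right'
  have hpt : ∀ x, HH (kfam ψ ν) x h ≤ ∫⁻ y, Φ x y ∂ν := by
    intro x
    refine iSup_le fun i => ?_
    have hi := Idx_pos i
    unfold kfam ker
    rw [← integral_sub (integrable_dil ψ ν _ hi _) (integrable_dil ψ ν _ hi _)]
    refine (enorm_integral_le_lintegral_enorm _).trans (lintegral_mono fun y => ?_)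
    exact sup_le hd ψ y x (x - h) _ hi
  calc _ ≤ ∫⁻ x in (ball 0 (2*r))ᶜ, ∫⁻ y, Φ x y ∂ν := lintegral_mono hpt
    _ = ∫⁻ y, (∫⁻ x in (ball 0 (2*r))ᶜ, Φ x y) ∂ν := lintegral_lintegral_swap mΦ.aemeasurable
    _ ≤ ∫⁻ y, ENNReal.ofReal (ρ ^ (1 + ε)) * K ∂ν := by
        refine lintegral_mono_ae ?_
        filter_upwards [hν] with y hy
        exact hS ρ hρ y hy r hr h hh
    _ = _ := by simp

end RdF

namespace RdF

open scoped ContDiff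

/-- multiplier operator on the frequency side. -/
def MO (m g : Esp d → ℂ) (t : ℝ) (x : Esp d) : ℂ :=
  ∫ ξ, 𝐞 ⟪ξ, x⟫ • (g ξ * m (t • ξ))

lemma continuous_MO (m g : Esp d → ℂ) (hm : Continuous m) (hg : Continuous g) (hgi : Integrable g)
    (a0 : ℝ) (ha : ∀ ξ, ‖m ξ‖ ≤ a0) : Continuous (fun q : ℝ × Esp d => MO m g q.1 q.2) := by
  unfold MO
  refine continuous_of_dominated (bound := fun ξ => ‖g ξ‖ * a0) ?_ ?_ (hgi.norm.mul_const _) ?_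
  · intro q
    refine Continuous.aestronglyMeasurable ?_
    have : Continuous fun ξ : Esp d => 𝐞 ⟪ξ, q.2⟫ := Real.continuous_fourierChar.comp (by fun_prop)
    fun_prop
  · intro q
    refine Filter.Eventually.of_forall fun ξ => ?_
    rw [Circle.norm_smul, norm_mul]
    gcongr
    exact ha _
  · refine Filter.Eventually.of_forall fun ξ => ?_
    have : Continuous fun q : ℝ × Esp d => 𝐞 ⟪ξ, q.2⟫ := Real.continuous_fourierChar.comp (by fun_prop)
    fun_prop

lemma continuous_MO_left (m g : Esp d → ℂ) (x : Esp d)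
    (h : Continuous (fun q : ℝ × Esp d => MO m g q.1 q.2)) : Continuous fun s => MO m g s x :=
  Continuous.comp (g := fun q : ℝ × Esp d => MO m g q.1 q.2) (f := fun s => (s, x)) h (by fun_prop)

/-- radial derivative. -/
def rad (m : Esp d → ℂ) (ξ : Esp d) : ℂ := fderiv ℝ m ξ ξ

lemma contDiff_rad (m : Esp d → ℂ) (hm : ContDiff ℝ ∞ m) : ContDiff ℝ ∞ (rad m) := by
  unfold rad
  exact (hm.fderiv_right (m := ∞) (by simp)).clm_apply contDiff_id

lemma hasDerivAt_MO (m g : Esp d → ℂ) (hm : ContDiff ℝ ∞ m) (hg : Continuous g) (hgi : Integrable g)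
    (a0 b0 : ℝ) (ha : ∀ ξ, ‖m ξ‖ ≤ a0) (hb : ∀ ξ, ‖rad m ξ‖ ≤ b0) (x : Esp d) (t : ℝ) (ht : 0 < t) :
    HasDerivAt (fun t => MO m g t x) (((t⁻¹ : ℝ) : ℂ) * MO (rad m) g t x) t := by
  have hmc := hm.continuous
  have hrc := (contDiff_rad m hm).continuous
  have hb0 : 0 ≤ b0 := (norm_nonneg _).trans (hb 0)
  have hch : Continuous fun ξ : Esp d => 𝐞 ⟪ξ, x⟫ := Real.continuous_fourierChar.comp (by fun_prop)
  have key := hasDerivAt_integral_of_dominated_loc_of_deriv_le (μ := (volume : Measure (Esp d)))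
    (F := fun t ξ => 𝐞 ⟪ξ, x⟫ • (g ξ * m (t • ξ)))
    (F' := fun t ξ => 𝐞 ⟪ξ, x⟫ • (g ξ * (((t⁻¹ : ℝ) : ℂ) * rad m (t • ξ))))
    (x₀ := t) (s := ball t (t/2)) (bound := fun ξ => ‖g ξ‖ * ((t/2)⁻¹ * b0))
    (ball_mem_nhds t (by positivity)) ?_ ?_ ?_ ?_ ?_ ?_
  · have h2 := key.2
    refine h2.congr_deriv ?_
    unfold MO
    rw [← integral_const_mul]
    congr 1; funext ξ
    simp only [Circle.smul_def, smul_eq_mul]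
    ring
  · refine Filter.Eventually.of_forall fun t => Continuous.aestronglyMeasurable ?_
    fun_prop
  · refine (hgi.norm.mul_const a0).mono' (Continuous.aestronglyMeasurable (by fun_prop)) ?_
    refine Filter.Eventually.of_forall fun ξ => ?_
    rw [Circle.norm_smul, norm_mul]
    gcongr
    exact ha _
  · exact Continuous.aestronglyMeasurable (by fun_prop)
  · refine Filter.Eventually.of_forall fun ξ s hs => ?_
    rw [mem_ball, Real.dist_eq, abs_lt] at hs
    have hs' : t/2 < s := by linarith [hs.1]
    rw [Circle.norm_smul, norm_mul, norm_mul, Complex.norm_real, Real.norm_of_nonneg (by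
      rw [inv_nonneg]; linarith)]
    gcongr
    exact hb _
  · exact hgi.norm.mul_const _
  · refine Filter.Eventually.of_forall fun ξ s hs => ?_
    rw [mem_ball, Real.dist_eq, abs_lt] at hs
    have hs' : 0 < s := by linarith [hs.1]
    have h1 : HasDerivAt (fun s : ℝ => s • ξ) ξ s := by
      simpa using (hasDerivAt_id s).smul_const ξ
    have h2 : HasDerivAt (fun s : ℝ => m (s • ξ)) (fderiv ℝ m (s • ξ) ξ) s :=
      ((hm.differentiable (by simp)) (s • ξ)).hasFDerivAt.comp_hasDerivAt s h1
    have h3 : fderiv ℝ m (s • ξ) ξ = ((s⁻¹ : ℝ) : ℂ) * rad m (s • ξ) := by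
      unfold rad
      rw [map_smul, Complex.real_smul, ← mul_assoc, ← Complex.ofReal_mul, inv_mul_cancel₀ hs'.ne']
      simp
    rw [h3] at h2
    have h4 := (h2.const_mul (g ξ)).const_mul ((𝐞 ⟪ξ, x⟫ : Circle) : ℂ)
    simpa only [Circle.smul_def, smul_eq_mul] using h4

lemma plancherel_MO (m g : Esp d → ℂ) (hm : ContDiff ℝ ∞ m) (hmc : HasCompactSupport m)
    (hg : ContDiff ℝ ∞ g) (t : ℝ) (ht : 0 < t) :
    ∫⁻ x, ‖MO m g t x‖ₑ ^ 2 = ∫⁻ ξ, ‖g ξ‖ₑ ^ 2 * ‖m (t • ξ)‖ₑ ^ 2 := by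
  set u : Esp d → ℂ := fun ξ => g ξ * m (t • ξ) with hu
  have hus : ContDiff ℝ ∞ u := hg.mul (hm.comp (contDiff_const_smul t))
  have huc : HasCompactSupport u := by
    refine HasCompactSupport.mul_left ?_
    exact hmc.comp_smul ht.ne'
  set U : SchwartzMap (Esp d) ℂ := huc.toSchwartzMap hus with hU
  have hUu : ∀ ξ, U ξ = u ξ := fun ξ => rfl
  have h1 : ∀ x, MO m g t x = (𝓕⁻ U) x := by
    intro x
    rw [SchwartzMap.fourierInv_coe, Real.fourierInv_eq]
    rfl
  have h2 := SchwartzMap.integral_norm_sq_fourier (𝓕⁻ U)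
  have h3 : 𝓕 (𝓕⁻ U) = U := by simp
  rw [h3] at h2
  have e : ∀ (f : SchwartzMap (Esp d) ℂ), ∫⁻ x, ‖f x‖ₑ ^ 2 = ENNReal.ofReal (∫ x, ‖f x‖^2) := by
    intro f
    rw [ofReal_integral_eq_lintegral_ofReal]
    · congr 1; funext x
      rw [ENNReal.ofReal_pow (norm_nonneg _), ofReal_norm]
    · exact (f.memLp 2).integrable_norm_pow (by simp)
    · exact Filter.Eventually.of_forall fun x => by positivity
  calc _ = ∫⁻ x, ‖(𝓕⁻ U) x‖ₑ ^ 2 := by simp_rw [h1]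
    _ = ∫⁻ ξ, ‖U ξ‖ₑ^2 := by rw [e, e, h2]
    _ = _ := by
      congr 1; funext ξ
      rw [hUu, hu, enorm_mul, mul_pow]

lemma lintegral_log (r : ℝ) (hr : 0 < r) :
    ∫⁻ s in Icc (1/2/r) (2/r), ENNReal.ofReal s⁻¹ = ENNReal.ofReal (Real.log 4) := by
  have hle : 1/2/r ≤ 2/r := by gcongr; norm_num
  have hpos : 0 < 1/2/r := by positivity
  rw [← ofReal_integral_eq_lintegral_ofReal]
  · rw [integral_Icc_eq_integral_Ioc, ← intervalIntegral.integral_of_le hle,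
      integral_inv_of_pos hpos (by positivity)]
    congr 2
    field_simp
    norm_num
  · refine ContinuousOn.integrableOn_Icc ?_
    refine continuousOn_inv₀.mono fun s hs => ?_
    have : 0 < s := hpos.trans_le hs.1
    exact this.ne'
  · refine (ae_restrict_mem measurableSet_Icc).mono fun s hs => ?_
    have : 0 < s := hpos.trans_le hs.1
    show 0 ≤ s⁻¹
    positivity

lemma square_MO (m g : Esp d → ℂ) (hm : ContDiff ℝ ∞ m) 
    (hs : ∀ ξ, m ξ ≠ 0 → 1/2 ≤ ‖ξ‖ ∧ ‖ξ‖ ≤ 2)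
    (hg : ContDiff ℝ ∞ g) (hgi : Integrable g) (a0 : ℝ) (ha : ∀ ξ, ‖m ξ‖ ≤ a0) :
    ∫⁻ x, ∫⁻ s in Ioi (0:ℝ), ENNReal.ofReal s⁻¹ * ‖MO m g s x‖ₑ ^ 2 ≤
      ENNReal.ofReal (a0^2 * Real.log 4) * ∫⁻ ξ, ‖g ξ‖ₑ ^ 2 := by
  have hmc : HasCompactSupport m := by
    refine HasCompactSupport.intro (isCompact_closedBall (0:Esp d) 2) fun ξ hξ => ?_
    by_contra h
    exact hξ (by simpa using (hs ξ h).2)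
  have hc := continuous_MO m g hm.continuous hg.continuous hgi a0 ha
  have hmeas : Measurable (fun q : Esp d × ℝ => ENNReal.ofReal q.2⁻¹ * ‖MO m g q.2 q.1‖ₑ ^ 2) := by
    have h1 : Measurable fun q : Esp d × ℝ => ‖MO m g q.2 q.1‖ₑ :=
      (hc.comp continuous_swap).enorm.measurable
    fun_prop
  have hmc' := hm.continuous
  have hgc' := hg.continuous
  have hmeas2 : Measurable (fun q : ℝ × Esp d =>
      ENNReal.ofReal q.1⁻¹ * (‖g q.2‖ₑ ^ 2 * ‖m (q.1 • q.2)‖ₑ ^ 2)) := by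
    have h1 : Measurable fun q : ℝ × Esp d => ‖m (q.1 • q.2)‖ₑ :=
      Continuous.measurable (by fun_prop)
    have h2 : Measurable fun q : ℝ × Esp d => ‖g q.2‖ₑ :=
      Continuous.measurable (by fun_prop)
    fun_prop
  rw [lintegral_lintegral_swap hmeas.aemeasurable]
  calc _ = ∫⁻ s in Ioi (0:ℝ), ∫⁻ ξ, ENNReal.ofReal s⁻¹ * (‖g ξ‖ₑ ^ 2 * ‖m (s • ξ)‖ₑ ^ 2) := by
        refine setLIntegral_congr_fun measurableSet_Ioi fun s hs => ?_
        have hs : 0 < s := hs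
        rw [lintegral_const_mul' _ _ (by simp), lintegral_const_mul' _ _ (by simp),
          plancherel_MO m g hm hmc hg s hs]
    _ = ∫⁻ ξ, ∫⁻ s in Ioi (0:ℝ), ENNReal.ofReal s⁻¹ * (‖g ξ‖ₑ ^ 2 * ‖m (s • ξ)‖ₑ ^ 2) :=
        lintegral_lintegral_swap hmeas2.aemeasurable
    _ ≤ ∫⁻ ξ, ENNReal.ofReal (a0^2 * Real.log 4) * ‖g ξ‖ₑ ^ 2 := by
        refine lintegral_mono fun ξ => ?_
        by_cases hξ : ξ = 0
        · have : ∀ s : ℝ, m (s • ξ) = 0 := by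
            intro s; by_contra h
            have := (hs _ h).1
            simp [hξ] at this
            linarith
          simp [this]
        have hr : 0 < ‖ξ‖ := norm_pos_iff.2 hξ
        calc _ ≤ ∫⁻ s in Ioi (0:ℝ), (Icc (1/2/‖ξ‖) (2/‖ξ‖)).indicator
                (fun s => ENNReal.ofReal s⁻¹ * (‖g ξ‖ₑ ^ 2 * ENNReal.ofReal (a0^2))) s := by
              refine setLIntegral_mono' measurableSet_Ioi fun s hs0 => ?_
              have hs0 : 0 < s := hs0
              by_cases h : m (s • ξ) = 0
              · simp [h]
              have hh := hs _ h
              rw [norm_smul, Real.norm_of_nonneg hs0.le] at hh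
              rw [indicator_of_mem (show s ∈ Icc (1/2/‖ξ‖) (2/‖ξ‖) from
                ⟨by rw [div_le_iff₀ hr]; exact hh.1, by rw [le_div_iff₀ hr]; exact hh.2⟩)]
              gcongr
              rw [← ofReal_norm, ← ENNReal.ofReal_pow (norm_nonneg _)]
              exact ENNReal.ofReal_le_ofReal (by gcongr; exact ha _)
          _ ≤ ∫⁻ s, (Icc (1/2/‖ξ‖) (2/‖ξ‖)).indicator
                (fun s => ENNReal.ofReal s⁻¹ * (‖g ξ‖ₑ ^ 2 * ENNReal.ofReal (a0^2))) s :=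
              setLIntegral_le_lintegral _ _
          _ = _ := by
              rw [lintegral_indicator measurableSet_Icc, lintegral_mul_const _ (by fun_prop),
                lintegral_log _ hr, ENNReal.ofReal_mul (by positivity)]
              ring
    _ = _ := lintegral_const_mul' _ _ (by simp)

lemma rad_supp (m : Esp d → ℂ) (hs : ∀ ξ, m ξ ≠ 0 → 1/2 ≤ ‖ξ‖ ∧ ‖ξ‖ ≤ 2) (ξ : Esp d)
    (h : rad m ξ ≠ 0) : 1/2 ≤ ‖ξ‖ ∧ ‖ξ‖ ≤ 2 := by
  have h1 : fderiv ℝ m ξ ≠ 0 := by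
    intro h0; apply h; unfold rad; rw [h0]; simp
  have h1' : ξ ∈ Function.support (fderiv ℝ m) := h1
  have h2 : ξ ∈ tsupport m := support_fderiv_subset ℝ h1'
  have hcl : IsClosed {ξ : Esp d | 1/2 ≤ ‖ξ‖ ∧ ‖ξ‖ ≤ 2} :=
    (isClosed_le continuous_const continuous_norm).inter (isClosed_le continuous_norm continuous_const)
  have := closure_minimal (s := Function.support m) (t := {ξ : Esp d | 1/2 ≤ ‖ξ‖ ∧ ‖ξ‖ ≤ 2})
    (fun ξ hξ => hs ξ hξ) hcl
  exact this h2

lemma sup_MO (m g : Esp d → ℂ) (hm : ContDiff ℝ ∞ m) 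
    (hs : ∀ ξ, m ξ ≠ 0 → 1/2 ≤ ‖ξ‖ ∧ ‖ξ‖ ≤ 2)
    (hg : Continuous g) (hgi : Integrable g) (a0 b0 : ℝ) (ha : ∀ ξ, ‖m ξ‖ ≤ a0)
    (hb : ∀ ξ, ‖rad m ξ‖ ≤ b0) (c : ℝ) (hc : 0 < c) (x : Esp d) (t : ℝ) (ht : 0 < t) :
    ‖MO m g t x‖ₑ ^ 2 ≤ ENNReal.ofReal c * (∫⁻ s in Ioi (0:ℝ), ENNReal.ofReal s⁻¹ * ‖MO m g s x‖ₑ ^ 2)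
      + ENNReal.ofReal c⁻¹ * (∫⁻ s in Ioi (0:ℝ), ENNReal.ofReal s⁻¹ * ‖MO (rad m) g s x‖ₑ ^ 2) := by
  have hcont := continuous_MO m g hm.continuous hg hgi a0 ha
  have hcont' := continuous_MO (rad m) g (contDiff_rad m hm).continuous hg hgi b0 hb
  have hc1 : Continuous fun s => MO m g s x := continuous_MO_left m g x hcont
  have hc2 : Continuous fun s => MO (rad m) g s x := continuous_MO_left (rad m) g x hcont'
  have hm0 : m 0 = 0 := by
    by_contra h
    have := (hs 0 h).1
    simp at this
    linarith
  have hz : MO m g 0 x = 0 := by unfold MO; simp [hm0]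
  have h := ftc_limit (fun s => MO m g s x ^ 2)
    (fun s => 2 * MO m g s x * (((s⁻¹ : ℝ) : ℂ) * MO (rad m) g s x)) ?_ ?_ (nhdsWithin 0 (Ioi 0)) ?_ ?_ t ht
  · rw [enorm_pow] at h
    refine h.trans ?_
    rw [← lintegral_const_mul' _ _ (by simp), ← lintegral_const_mul' _ _ (by simp), ← lintegral_add_left]
    · refine setLIntegral_mono' measurableSet_Ioi fun s hs0 => ?_
      have hs0 : 0 < s := hs0
      simp only [← ofReal_norm]
      rw [← ENNReal.ofReal_pow (norm_nonneg _), ← ENNReal.ofReal_pow (norm_nonneg _),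
        ← ENNReal.ofReal_mul (by positivity), ← ENNReal.ofReal_mul (by positivity),
        ← ENNReal.ofReal_mul (by positivity), ← ENNReal.ofReal_mul (by positivity),
        ← ENNReal.ofReal_add (by positivity) (by positivity)]
      refine ENNReal.ofReal_le_ofReal ?_
      rw [norm_mul, norm_mul, norm_mul, Complex.norm_real, Real.norm_of_nonneg (by positivity)]
      set A := ‖MO m g s x‖
      set B := ‖MO (rad m) g s x‖
      have h2 : ‖(2:ℂ)‖ = 2 := by simp
      rw [h2]
      have h3 : 2 * A * B ≤ c * A^2 + c⁻¹ * B^2 := by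
        have : c * A^2 + c⁻¹ * B^2 - 2 * A * B = c⁻¹ * (c * A - B)^2 := by field_simp; ring
        have h5 : 0 ≤ c⁻¹ * (c * A - B)^2 := by positivity
        linarith
      calc 2 * A * (s⁻¹ * B) = s⁻¹ * (2 * A * B) := by ring
        _ ≤ s⁻¹ * (c * A^2 + c⁻¹ * B^2) := by gcongr
        _ = _ := by ring
    · have := hc1.enorm.measurable
      fun_prop
  · intro s hs0
    have := (hasDerivAt_MO m g hm hg hgi a0 b0 ha hb x s hs0).pow 2
    refine this.congr_deriv ?_
    simp
  · have : ContinuousOn (fun s : ℝ => ((s⁻¹ : ℝ) : ℂ)) (Ioi 0) :=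
      Complex.continuous_ofReal.comp_continuousOn (continuousOn_inv₀.mono fun s hs0 => by
        have hs0 : 0 < s := hs0
        exact hs0.ne')
    exact (by fun_prop : Continuous fun s => 2 * MO m g s x).continuousOn.mul (this.mul hc2.continuousOn)
  · exact eventually_nhdsWithin_of_forall fun s hs => hs
  · have h6 : Filter.Tendsto (fun s => MO m g s x ^ 2) (nhds 0) (nhds (MO m g 0 x ^ 2)) :=
      (hc1.pow 2).tendsto 0
    rw [hz] at h6
    simp only [ne_eq, OfNat.ofNat_ne_zero, not_false_eq_true, zero_pow] at h6
    exact h6.mono_left nhdsWithin_le_nhds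

lemma L2_MO (m g : Esp d → ℂ) (hm : ContDiff ℝ ∞ m) 
    (hs : ∀ ξ, m ξ ≠ 0 → 1/2 ≤ ‖ξ‖ ∧ ‖ξ‖ ≤ 2)
    (hg : ContDiff ℝ ∞ g) (hgi : Integrable g) (a0 b0 : ℝ) (ha0 : 0 < a0) (hb0 : 0 < b0)
    (ha : ∀ ξ, ‖m ξ‖ ≤ a0)
    (hb : ∀ ξ, ‖rad m ξ‖ ≤ b0) :
    ∫⁻ x, (⨆ i : Idx, ‖MO m g ((i:ℚ):ℝ) x‖ₑ) ^ 2 ≤ ENNReal.ofReal (2 * a0 * b0 * Real.log 4) *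
      ∫⁻ ξ, ‖g ξ‖ₑ ^ 2 := by
  have h1 := square_MO m g hm hs hg hgi a0 ha
  have h2 := square_MO (rad m) g (contDiff_rad m hm) (rad_supp m hs) hg hgi b0 hb
  have hl : 0 ≤ Real.log 4 := Real.log_nonneg (by norm_num)
  have hcont := continuous_MO m g hm.continuous hg.continuous hgi a0 ha
  calc _ ≤ ∫⁻ x, (ENNReal.ofReal (b0/a0) * (∫⁻ s in Ioi (0:ℝ), ENNReal.ofReal s⁻¹ * ‖MO m g s x‖ₑ ^ 2)
      + ENNReal.ofReal (b0/a0)⁻¹ * (∫⁻ s in Ioi (0:ℝ), ENNReal.ofReal s⁻¹ * ‖MO (rad m) g s x‖ₑ ^ 2)) := by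
        refine lintegral_mono fun x => ?_
        have h3 : ∀ i : Idx, _ := fun i => sup_MO m g hm hs hg.continuous hgi a0 b0 ha hb (b0/a0)
          (by positivity) x _ (Idx_pos i)
        rw [ENNReal.iSup_pow]
        exact iSup_le h3
    _ = ENNReal.ofReal (b0/a0) * (∫⁻ x, ∫⁻ s in Ioi (0:ℝ), ENNReal.ofReal s⁻¹ * ‖MO m g s x‖ₑ ^ 2)
      + ENNReal.ofReal (b0/a0)⁻¹ * (∫⁻ x, ∫⁻ s in Ioi (0:ℝ), ENNReal.ofReal s⁻¹ * ‖MO (rad m) g s x‖ₑ ^ 2) := by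
        rw [lintegral_add_left, lintegral_const_mul' _ _ (by simp), lintegral_const_mul' _ _ (by simp)]
        refine Measurable.const_mul ?_ _
        refine Measurable.lintegral_prod_right' (f := fun q : Esp d × ℝ =>
          ENNReal.ofReal q.2⁻¹ * ‖MO m g q.2 q.1‖ₑ ^ 2) ?_
        have h1 : Measurable fun q : Esp d × ℝ => ‖MO m g q.2 q.1‖ₑ :=
          (hcont.comp continuous_swap).enorm.measurable
        fun_prop
    _ ≤ ENNReal.ofReal (b0/a0) * (ENNReal.ofReal (a0^2 * Real.log 4) * ∫⁻ ξ, ‖g ξ‖ₑ ^ 2)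
      + ENNReal.ofReal (b0/a0)⁻¹ * (ENNReal.ofReal (b0^2 * Real.log 4) * ∫⁻ ξ, ‖g ξ‖ₑ ^ 2) :=
        add_le_add (mul_le_mul_right h1 _) (mul_le_mul_right h2 _)
    _ = _ := by
        rw [← mul_assoc, ← mul_assoc, ← add_mul, ← ENNReal.ofReal_mul (by positivity),
          ← ENNReal.ofReal_mul (by positivity), ← ENNReal.ofReal_add (by positivity) (by positivity)]
        congr 2
        field_simp
        ring

end RdF

namespace RdF

open scoped ContDiff

lemma inv_formula (f : SchwartzMap (Esp d) ℂ) (u : Esp d) :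
    f u = ∫ ξ, 𝐞 ⟪ξ, u⟫ • (𝓕 (f : Esp d → ℂ)) ξ := by
  have h : (𝓕⁻ (𝓕 f)) u = f u := by simp
  rw [SchwartzMap.fourierInv_coe, Real.fourierInv_eq, SchwartzMap.fourier_coe] at h
  exact h.symm

lemma continuous_hat (f : SchwartzMap (Esp d) ℂ) : Continuous (𝓕 (f : Esp d → ℂ)) := by
  rw [← SchwartzMap.fourier_coe]; exact (𝓕 f).continuous

lemma integrable_hat (f : SchwartzMap (Esp d) ℂ) : Integrable (𝓕 (f : Esp d → ℂ)) := by
  rw [← SchwartzMap.fourier_coe]; exact (𝓕 f).integrable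

lemma contDiff_hat (f : SchwartzMap (Esp d) ℂ) : ContDiff ℝ ∞ (𝓕 (f : Esp d → ℂ)) := by
  rw [← SchwartzMap.fourier_coe]; exact (𝓕 f).smooth ⊤

lemma continuous_echar : Continuous fun u : ℝ => ((𝐞 u : Circle) : ℂ) :=
  continuous_induced_dom.comp Real.continuous_fourierChar

lemma char_split (ξ x y : Esp d) (t : ℝ) :
    𝐞 ⟪ξ, x - t • y⟫ = 𝐞 ⟪ξ, x⟫ * 𝐞 (-⟪y, t • ξ⟫) := by
  rw [← AddChar.map_add_eq_mul]
  congr 1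
  rw [inner_sub_right, inner_smul_right, inner_smul_right, real_inner_comm y ξ]
  ring

/-- General identity: averages of translates as multiplier operators. -/
lemma avg_eq_MO {X : Type*} [MeasurableSpace X] (κ : Measure X) [SFinite κ] (T : X → Esp d)
    (hT : Measurable T) (w : X → ℂ) (hw : Integrable w κ) (f : SchwartzMap (Esp d) ℂ) (t : ℝ)
    (x : Esp d) :
    ∫ q, f (x - t • T q) * w q ∂κ =
      MO (fun η => ∫ q, 𝐞 (-⟪T q, η⟫) • w q ∂κ) (𝓕 (f : Esp d → ℂ)) t x := by
  have h1 : ∀ q, f (x - t • T q) * w q =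
      ∫ ξ, 𝐞 ⟪ξ, x⟫ • ((𝓕 (f : Esp d → ℂ)) ξ * (𝐞 (-⟪T q, t • ξ⟫) • w q)) := by
    intro q
    rw [inv_formula f, ← integral_mul_const]
    congr 1; funext ξ
    rw [char_split]
    simp only [Circle.smul_def, smul_eq_mul, Circle.coe_mul]
    ring
  simp_rw [h1]
  unfold MO
  rw [integral_integral_swap]
  · congr 1; funext ξ
    simp only [Circle.smul_def, smul_eq_mul]
    rw [← integral_const_mul, ← integral_const_mul]
  · have hi : Integrable (fun z : X × Esp d => w z.1 * (𝓕 (f : Esp d → ℂ)) z.2) (κ.prod volume) :=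
      hw.mul_prod (integrable_hat f)
    refine hi.mono ?_ ?_
    · have hc : Measurable fun z : X × Esp d => ((𝐞 ⟪z.2, x⟫ : Circle) : ℂ) := by
        refine (Continuous.measurable (f := fun ξ : Esp d => ((𝐞 ⟪ξ, x⟫ : Circle) : ℂ)) ?_).comp measurable_snd
        exact continuous_echar.comp (by fun_prop)
      have hc2 : Measurable fun z : X × Esp d => ((𝐞 (-⟪T z.1, t • z.2⟫) : Circle) : ℂ) := by
        refine continuous_echar.measurable.comp ?_
        have : Measurable fun z : X × Esp d => T z.1 := hT.comp measurable_fst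
        fun_prop
      have e : (Function.uncurry fun q ξ => 𝐞 ⟪ξ, x⟫ • ((𝓕 (f : Esp d → ℂ)) ξ * (𝐞 (-⟪T q, t • ξ⟫) • w q)))
        = fun z : X × Esp d => (((𝐞 ⟪z.2, x⟫ : Circle) : ℂ) * ((𝐞 (-⟪T z.1, t • z.2⟫) : Circle) : ℂ)) *
          (w z.1 * (𝓕 (f : Esp d → ℂ)) z.2) := by
        funext z
        simp only [Function.uncurry, Circle.smul_def, smul_eq_mul]
        ring
      rw [e]
      exact (hc.mul hc2).aestronglyMeasurable.mul hi.1
    · refine Filter.Eventually.of_forall fun z => ?_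
      simp only [Function.uncurry]
      rw [Circle.norm_smul, norm_mul, norm_mul, Circle.norm_smul, mul_comm]

lemma mFT_eq (μ : Measure (Esp d)) (ξ : Esp d) : mFT μ ξ = ∫ y, 𝐞 (-⟪y, ξ⟫) • (1:ℂ) ∂μ := by
  unfold mFT
  congr 1; funext y
  rw [Circle.smul_def, Real.fourierChar_apply, smul_eq_mul, mul_one]
  congr 1
  push_cast
  ring

lemma convM_eq_MO (μ : Measure (Esp d)) [IsFiniteMeasure μ] (f : SchwartzMap (Esp d) ℂ) (t : ℝ)
    (x : Esp d) : convM f μ t x = MO (mFT μ) (𝓕 (f : Esp d → ℂ)) t x := by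
  have h := avg_eq_MO μ id measurable_id (fun _ => (1:ℂ)) (integrable_const _) f t x
  have e : mFT μ = fun η => ∫ q, 𝐞 (-⟪id q, η⟫) • (1:ℂ) ∂μ := by
    funext η; rw [mFT_eq]; rfl
  rw [e, ← h]
  unfold convM
  simp

lemma shift_dil (f : Esp d → ℂ) (L : Esp d → ℂ) (t : ℝ) (ht : 0 < t) (x y : Esp d) :
    ∫ z, f z * dil t (fun z => L (z - y)) (x - z) = ∫ w, f (x - t • (y + w)) * L w := by
  have h1 : ∫ z, f z * dil t (fun z => L (z - y)) (x - z) =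
      ∫ z, f (x - z) * dil t (fun z => L (z - y)) z := by
    rw [← integral_sub_left_eq_self (fun z => f z * dil t (fun z => L (z - y)) (x - z)) volume x]
    simp
  have h2 := Measure.integral_comp_inv_smul (volume : Measure (Esp d))
    (fun w => f (x - t • w) * L (w - y)) t
  rw [h1]
  have h3 : ∀ z, f (x - z) * dil t (fun z => L (z - y)) z =
      (((t^d)⁻¹:ℝ):ℂ) * (f (x - t • (t⁻¹ • z)) * L (t⁻¹ • z - y)) := by
    intro z
    rw [smul_inv_smul₀ ht.ne']
    unfold dil
    ring
  simp_rw [h3]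
  rw [integral_const_mul, h2]
  have hf : Module.finrank ℝ (Esp d) = d := by simp
  rw [hf, abs_of_pos (by positivity), Complex.real_smul, ← mul_assoc, ← Complex.ofReal_mul,
    inv_mul_cancel₀ (by positivity), Complex.ofReal_one, one_mul]
  rw [← integral_add_left_eq_self (fun w => f (x - t • w) * L (w - y)) y]
  simp

lemma ker_eq_MO (ψ : SchwartzMap (Esp d) ℂ) (ν : Measure (Esp d)) [IsFiniteMeasure ν]
    (f : SchwartzMap (Esp d) ℂ) (t : ℝ) (ht : 0 < t) (x : Esp d) :
    ∫ z, f z * ker ψ ν t (x - z) =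
      MO (fun η => mFT ν η * (𝓕 (ψ : Esp d → ℂ)) η) (𝓕 (f : Esp d → ℂ)) t x := by
  obtain ⟨B, hB0, hB⟩ := schwartz_bdd ψ
  obtain ⟨Bf, hBf0, hBf⟩ := schwartz_bdd f
  have hw : Integrable (fun q : Esp d × Esp d => ψ q.2) (ν.prod volume) := by
    have := (integrable_const (1:ℂ) : Integrable _ ν).mul_prod (SchwartzMap.integrable (μ := volume) ψ)
    simpa using this
  have h := avg_eq_MO (ν.prod volume) (fun q : Esp d × Esp d => q.1 + q.2) (by fun_prop)
    (fun q => ψ q.2) hw f t x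
  have e : (fun η => ∫ q : Esp d × Esp d, 𝐞 (-⟪q.1 + q.2, η⟫) • ψ q.2 ∂(ν.prod volume)) =
      (fun η => mFT ν η * (𝓕 (ψ : Esp d → ℂ)) η) := by
    funext η
    rw [mFT_eq, Real.fourier_eq, ← integral_prod_mul]
    congr 1; funext q
    rw [inner_add_left, neg_add, AddChar.map_add_eq_mul]
    simp only [Circle.smul_def, smul_eq_mul, Circle.coe_mul]
    ring
  rw [← e, ← h]
  rw [integral_prod]
  · simp_rw [← shift_dil f ψ t ht]
    unfold ker
    simp_rw [← integral_const_mul]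
    rw [integral_integral_swap]
    refine Integrable.mono' (g := fun q : Esp d × Esp d => ‖f q.1‖ * ((t^d)⁻¹ * B)) ?_ ?_ ?_
    · have := (SchwartzMap.integrable (μ := volume) f).norm.mul_prod (integrable_const ((t^d)⁻¹ * B) : Integrable _ ν)
      simpa using this
    · refine Continuous.aestronglyMeasurable ?_
      have h1 := f.continuous
      have h2 : Continuous fun q : Esp d × Esp d => dil t (fun z => ψ (z - q.2)) (x - q.1) :=
        Continuous.comp (g := fun q : Esp d × Esp d => dil t (fun z => ψ (z - q.2)) q.1)
          (f := fun q : Esp d × Esp d => (x - q.1, q.2)) (continuous_dil ψ t) (by fun_prop)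
      exact (h1.comp continuous_fst).mul h2
    · refine Filter.Eventually.of_forall fun q => ?_
      simp only [Function.uncurry]
      rw [norm_mul]
      gcongr
      exact norm_dil_le ψ B hB t ht _ _
  · refine hw.bdd_mul (c := Bf) ?_ (Filter.Eventually.of_forall fun q => hBf _)
    refine Continuous.aestronglyMeasurable ?_
    exact f.continuous.comp (by fun_prop)

lemma plancherel_hat (f : SchwartzMap (Esp d) ℂ) :
    ∫⁻ ξ, ‖(𝓕 (f : Esp d → ℂ)) ξ‖ₑ ^ 2 = ∫⁻ x, ‖f x‖ₑ ^ 2 := by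
  have e : ∀ (f : SchwartzMap (Esp d) ℂ), ∫⁻ x, ‖f x‖ₑ ^ 2 = ENNReal.ofReal (∫ x, ‖f x‖^2) := by
    intro f
    rw [ofReal_integral_eq_lintegral_ofReal]
    · congr 1; funext x
      rw [ENNReal.ofReal_pow (norm_nonneg _), ofReal_norm]
    · exact (f.memLp 2).integrable_norm_pow (by simp)
    · exact Filter.Eventually.of_forall fun x => by positivity
  rw [← SchwartzMap.fourier_coe, e, e, SchwartzMap.integral_norm_sq_fourier]

lemma L2_schwartz (ψ : SchwartzMap (Esp d) ℂ) (ν : Measure (Esp d)) [IsFiniteMeasure ν]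
    (hm : ContDiff ℝ ∞ (fun η => mFT ν η * (𝓕 (ψ : Esp d → ℂ)) η))
    (hs : ∀ ξ, (𝓕 (ψ : Esp d → ℂ)) ξ ≠ 0 → 1/2 ≤ ‖ξ‖ ∧ ‖ξ‖ ≤ 2)
    (a0 b0 : ℝ) (ha0 : 0 < a0) (hb0 : 0 < b0)
    (ha : ∀ ξ, ‖mFT ν ξ * (𝓕 (ψ : Esp d → ℂ)) ξ‖ ≤ a0)
    (hb : ∀ ξ, ‖rad (fun η => mFT ν η * (𝓕 (ψ : Esp d → ℂ)) η) ξ‖ ≤ b0)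
    (f : SchwartzMap (Esp d) ℂ) :
    ∫⁻ x, TT (kfam ψ ν) f x ^ 2 ≤ ENNReal.ofReal (2 * a0 * b0 * Real.log 4) * ∫⁻ x, ‖f x‖ₑ ^ 2 := by
  have h := L2_MO (fun η => mFT ν η * (𝓕 (ψ : Esp d → ℂ)) η) (𝓕 (f : Esp d → ℂ)) hm
    (fun ξ h => hs ξ (right_ne_zero_of_mul h)) (contDiff_hat f) (integrable_hat f) a0 b0 ha0 hb0 ha hb
  rw [plancherel_hat] at h
  refine le_trans (le_of_eq ?_) h
  unfold TT kfam
  congr 1; funext x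
  congr 1
  congr 1; funext i
  rw [ker_eq_MO ψ ν f _ (Idx_pos i)]

lemma L2_extend {ι : Type*} [Countable ι] [Nonempty ι] (k : ι → Esp d → ℂ) (hk : ∀ i, Continuous (k i))
    (hk2 : ∀ i, MemLp (k i) 2) (A : ℝ≥0∞) (hA : A ≠ (⊤:ℝ≥0∞))
    (h : ∀ f : SchwartzMap (Esp d) ℂ, ∫⁻ x, TT k f x ^ 2 ≤ A * ∫⁻ x, ‖f x‖ₑ ^ 2)
    (g : Esp d → ℂ) (hg : MemLp g 2) :
    ∫⁻ x, TT k g x ^ 2 ≤ A * ∫⁻ x, ‖g x‖ₑ ^ 2 := by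
  have hsq : ∀ u : Esp d → ℂ, ∫⁻ x, ‖u x‖ₑ ^ 2 = eLpNorm u 2 volume ^ 2 := by
    intro u
    rw [eLpNorm_eq_lintegral_rpow_enorm_toReal (by simp) (by simp)]
    rw [← ENNReal.rpow_natCast, ← ENNReal.rpow_mul]
    simp
  have hap : ∀ n : ℕ, ∃ f : SchwartzMap (Esp d) ℂ, eLpNorm (g - (f : Esp d → ℂ)) 2 volume ≤ ENNReal.ofReal ((n+1:ℝ)⁻¹) := by
    intro n
    obtain ⟨u, h1, h2, h3⟩ := hg.exist_eLpNorm_sub_le (by simp) (by norm_num) (ε := (n+1:ℝ)⁻¹) (by positivity)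
    exact ⟨h1.toSchwartzMap h2, h3⟩
  choose f hf using hap
  have hlim0 : Filter.Tendsto (fun n : ℕ => ENNReal.ofReal ((n+1:ℝ)⁻¹)) Filter.atTop (nhds 0) := by
    rw [← ENNReal.ofReal_zero]
    refine (ENNReal.continuous_ofReal.tendsto 0).comp ?_
    simpa using tendsto_one_div_add_atTop_nhds_zero_nat (𝕜 := ℝ)
  have hk2x : ∀ i x, MemLp (fun z => k i (x - z)) 2 volume := by
    intro i x
    exact (hk2 i).comp_measurePreserving (Measure.measurePreserving_sub_left volume x)
  have hpt : ∀ i x, Filter.Tendsto (fun n => ∫ z, f n z * k i (x - z)) Filter.atTop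
      (nhds (∫ z, g z * k i (x - z))) := by
    intro i x
    have hIntg : ∀ u : Esp d → ℂ, MemLp u 2 volume → Integrable fun z => u z * k i (x - z) :=
      fun u hu => hu.integrable_mul (hk2x i x)
    rw [tendsto_iff_edist_tendsto_0]
    have hb : ∀ n, edist (∫ z, f n z * k i (x - z)) (∫ z, g z * k i (x - z)) ≤
        ENNReal.ofReal ((n+1:ℝ)⁻¹) * eLpNorm (fun z => k i (x - z)) 2 volume := by
      intro n
      rw [edist_comm, edist_eq_enorm_sub, ← integral_sub (hIntg g hg) (hIntg _ ((f n).memLp 2))]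
      calc _ ≤ ∫⁻ z, ‖g z * k i (x - z) - f n z * k i (x - z)‖ₑ := enorm_integral_le_lintegral_enorm _
        _ = eLpNorm ((g - (f n : Esp d → ℂ)) * fun z => k i (x - z)) 1 volume := by
            rw [eLpNorm_one_eq_lintegral_enorm]
            congr 1; funext z
            simp [sub_mul]
        _ ≤ eLpNorm (g - (f n : Esp d → ℂ)) 2 volume * eLpNorm (fun z => k i (x - z)) 2 volume := by
            have := eLpNorm_smul_le_mul_eLpNorm (p := 2) (q := 2) (r := 1)
              (hk2x i x).1 (hg.sub ((f n).memLp 2)).1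
            exact this
        _ ≤ _ := by gcongr; exact hf n
    refine tendsto_of_tendsto_of_tendsto_of_le_of_le tendsto_const_nhds ?_ (fun n => zero_le) hb
    have := ENNReal.Tendsto.mul_const (b := eLpNorm (fun z => k i (x - z)) 2 volume) hlim0
      (Or.inr (hk2x i x).eLpNorm_ne_top)
    simpa using this
  have hle : ∀ x, TT k g x ^ 2 ≤ Filter.liminf (fun n => TT k (f n) x ^ 2) Filter.atTop := by
    intro x
    unfold TT
    rw [ENNReal.iSup_pow]
    refine iSup_le fun i => ?_
    have h1 : Filter.Tendsto (fun n => ‖∫ z, f n z * k i (x - z)‖ₑ ^ 2) Filter.atTop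
        (nhds (‖∫ z, g z * k i (x - z)‖ₑ ^ 2)) :=
      ((ENNReal.continuous_pow 2).tendsto _).comp (hpt i x).enorm
    rw [← h1.liminf_eq]
    refine Filter.liminf_le_liminf (Filter.Eventually.of_forall fun n => ?_)
    gcongr
    exact le_iSup (fun i => ‖∫ z, f n z * k i (x - z)‖ₑ) i
  have hlim : Filter.Tendsto (fun n : ℕ => A * (eLpNorm g 2 volume + ENNReal.ofReal ((n+1:ℝ)⁻¹)) ^ 2)
      Filter.atTop (nhds (A * (eLpNorm g 2 volume + 0)^2)) := by
    refine ENNReal.Tendsto.const_mul ?_ (Or.inr hA)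
    exact ((ENNReal.continuous_pow 2).tendsto _).comp (tendsto_const_nhds.add hlim0)
  calc _ ≤ ∫⁻ x, Filter.liminf (fun n => TT k (f n) x ^ 2) Filter.atTop := lintegral_mono hle
    _ ≤ Filter.liminf (fun n => ∫⁻ x, TT k (f n) x ^ 2) Filter.atTop := by
        refine lintegral_liminf_le fun n => ?_
        exact (measurable_TT k hk (f n) (f n).continuous.measurable).pow_const 2
    _ ≤ Filter.liminf (fun n : ℕ => A * (eLpNorm g 2 volume + ENNReal.ofReal ((n+1:ℝ)⁻¹)) ^ 2) Filter.atTop := by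
        refine Filter.liminf_le_liminf (Filter.Eventually.of_forall fun n => ?_)
        refine (h (f n)).trans ?_
        rw [hsq]
        gcongr
        have e : (f n : Esp d → ℂ) = g - (g - (f n : Esp d → ℂ)) := by simp
        calc eLpNorm (f n) 2 volume = eLpNorm (g - (g - (f n : Esp d → ℂ))) 2 volume := by rw [← e]
          _ ≤ eLpNorm g 2 volume + eLpNorm (g - (f n : Esp d → ℂ)) 2 volume :=
            eLpNorm_sub_le hg.1 (hg.sub ((f n).memLp 2)).1 (by norm_num)
          _ ≤ _ := by gcongr; exact hf n
    _ = _ := by rw [hlim.liminf_eq, add_zero, hsq]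

end RdF

namespace RdF

open scoped ContDiff

lemma mFT_charFun (μ : Measure (Esp d)) : mFT μ = fun ξ => charFun μ ((-(2*π)) • ξ) := by
  funext ξ
  unfold mFT
  rw [charFun_apply]
  congr 1; funext y
  congr 1
  rw [inner_smul_right]
  push_cast
  ring

lemma contDiff_mFT (μ : Measure (Esp d)) [IsFiniteMeasure μ] (R : ℝ) (hR : ∀ᵐ y ∂μ, ‖y‖ ≤ R) :
    ContDiff ℝ ∞ (mFT μ) := by
  rw [mFT_charFun]
  have h : ContDiff ℝ ∞ (charFun μ) := by
    refine contDiff_charFun' (n := ⊤) fun k => ?_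
    exact MemLp.of_bound measurable_id.aestronglyMeasurable R hR
  exact h.comp (contDiff_const_smul _)

lemma norm_mFT_le (μ : Measure (Esp d)) [IsFiniteMeasure μ] (ξ : Esp d) : ‖mFT μ ξ‖ ≤ μ.real univ := by
  rw [mFT_eq]
  have := norm_integral_le_of_norm_le_const (μ := μ) (f := fun y => 𝐞 (-⟪y, ξ⟫) • (1:ℂ)) (C := 1)
    (Filter.Eventually.of_forall fun y => by rw [Circle.norm_smul]; simp)
  simpa using this

lemma rad_mFT (μ : Measure (Esp d)) [IsFiniteMeasure μ] (R : ℝ) (hR : ∀ᵐ y ∂μ, ‖y‖ ≤ R) (ξ : Esp d) :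
    rad (mFT μ) ξ = ∫ y, (-(2 * (π:ℂ) * Complex.I * ((⟪y, ξ⟫ : ℝ) : ℂ))) *
      Complex.exp (-(2 * (π:ℂ) * Complex.I * ((⟪y, ξ⟫ : ℝ) : ℂ))) ∂μ := by
  have key := hasDerivAt_integral_of_dominated_loc_of_deriv_le (μ := μ)
    (F := fun (s : ℝ) y => Complex.exp ((s:ℂ) * (-(2 * (π:ℂ) * Complex.I * ((⟪y, ξ⟫ : ℝ) : ℂ)))))
    (F' := fun (s : ℝ) y => Complex.exp ((s:ℂ) * (-(2 * (π:ℂ) * Complex.I * ((⟪y, ξ⟫ : ℝ) : ℂ)))) * 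
      (-(2 * (π:ℂ) * Complex.I * ((⟪y, ξ⟫ : ℝ) : ℂ))))
    (x₀ := (1:ℝ)) (s := univ) (bound := fun y => 2 * π * (R * ‖ξ‖))
    Filter.univ_mem ?_ ?_ ?_ ?_ ?_ ?_
  · have h2 := key.2
    have h1 : HasDerivAt (fun s : ℝ => s • ξ) ξ 1 := by
      simpa using (hasDerivAt_id (1:ℝ)).smul_const ξ
    have h0 : HasFDerivAt (mFT μ) (fderiv ℝ (mFT μ) ((1:ℝ) • ξ)) ((fun s : ℝ => s • ξ) 1) :=
      (((contDiff_mFT μ R hR).differentiable (by simp)) ((1:ℝ) • ξ)).hasFDerivAt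
    have h3 : HasDerivAt (fun s : ℝ => mFT μ (s • ξ)) (fderiv ℝ (mFT μ) ((1:ℝ) • ξ) ξ) 1 :=
      HasFDerivAt.comp_hasDerivAt (f := fun s : ℝ => s • ξ) (1:ℝ) h0 h1
    have e : (fun s : ℝ => mFT μ (s • ξ)) = fun s : ℝ => ∫ y, Complex.exp ((s:ℂ) * (-(2 * (π:ℂ) * Complex.I * ((⟪y, ξ⟫ : ℝ) : ℂ)))) ∂μ := by
      funext s
      unfold mFT
      congr 1; funext y; congr 1
      rw [inner_smul_right]; push_cast; ring
    rw [e] at h3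
    have h4 := h3.unique h2
    rw [one_smul] at h4
    unfold rad
    rw [h4]
    congr 1; funext y
    simp only [Complex.ofReal_one, one_mul]
    ring
  · exact Filter.Eventually.of_forall fun s => Continuous.aestronglyMeasurable (by fun_prop)
  · refine Integrable.of_bound (C := 1) (Continuous.aestronglyMeasurable (by fun_prop)) 
      (Filter.Eventually.of_forall fun y => ?_)
    rw [Complex.norm_exp]
    simp
  · exact Continuous.aestronglyMeasurable (by fun_prop)
  · refine hR.mono fun y hy s _ => ?_
    rw [norm_mul, Complex.norm_exp, norm_neg, norm_mul, norm_mul, norm_mul, Complex.norm_real,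
      Complex.norm_real, Complex.norm_I]
    have h1 : ‖⟪y, ξ⟫‖ ≤ R * ‖ξ‖ := (norm_inner_le_norm y ξ).trans (by gcongr)
    simp only [Complex.norm_ofNat, mul_one]
    rw [Real.norm_of_nonneg pi_pos.le]
    have : Real.exp ((s:ℂ) * (-(2 * (π:ℂ) * Complex.I * ((⟪y, ξ⟫ : ℝ) : ℂ)))).re = 1 := by simp
    rw [this, one_mul]
    gcongr
  · exact integrable_const _
  · refine Filter.Eventually.of_forall fun y s _ => ?_
    have h1 : HasDerivAt (fun s : ℝ => (s:ℂ) * (-(2 * (π:ℂ) * Complex.I * ((⟪y, ξ⟫ : ℝ) : ℂ)))) 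
      (1 * (-(2 * (π:ℂ) * Complex.I * ((⟪y, ξ⟫ : ℝ) : ℂ)))) s := 
      (Complex.ofRealCLM.hasDerivAt (x := s)).mul_const _
    have := h1.cexp
    simpa using this

/-- a Schwartz function equal to `-2πi u` on `[-R,R]`. -/
lemma exists_chi (R : ℝ) (hR : 0 < R) : ∃ χ : SchwartzMap ℝ ℂ, ∀ u, |u| ≤ R → 
    χ u = -(2 * (π:ℂ) * Complex.I * (u:ℂ)) := by
  let b : ContDiffBump (0:ℝ) := ⟨R, R+1, hR, by linarith⟩
  have h1 : HasCompactSupport fun u : ℝ => ((b u : ℝ):ℂ) * -(2 * (π:ℂ) * Complex.I * (u:ℂ)) := by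
    refine HasCompactSupport.mul_right ?_
    exact b.hasCompactSupport.comp_left (g := fun u : ℝ => (u:ℂ)) (by simp)
  have h2 : ContDiff ℝ ∞ fun u : ℝ => ((b u : ℝ):ℂ) * -(2 * (π:ℂ) * Complex.I * (u:ℂ)) := by
    have h3 : ContDiff ℝ ∞ fun u : ℝ => ((b u : ℝ):ℂ) := Complex.ofRealCLM.contDiff.comp b.contDiff
    have h4 : ContDiff ℝ ∞ fun u : ℝ => (u:ℂ) := Complex.ofRealCLM.contDiff
    fun_prop
  refine ⟨h1.toSchwartzMap h2, fun u hu => ?_⟩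
  show ((b u : ℝ):ℂ) * -(2 * (π:ℂ) * Complex.I * (u:ℂ)) = _
  rw [b.one_of_mem_closedBall (by simpa using hu)]
  simp

lemma rad_repr (μ : Measure (Esp d)) [IsFiniteMeasure μ] (R : ℝ) (hR : ∀ᵐ y ∂μ, ‖y‖ ≤ R)
    (χ : SchwartzMap ℝ ℂ) (hχ : ∀ u, |u| ≤ R → χ u = -(2 * (π:ℂ) * Complex.I * (u:ℂ)))
    (ξ : Esp d) (hξ : ξ ≠ 0) :
    rad (mFT μ) ξ = (‖ξ‖:ℂ) * ∫ τ : ℝ, (𝓕 (χ : ℝ → ℂ)) τ * mFT μ ((1 - τ / ‖ξ‖) • ξ) := by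
  have hs : 0 < ‖ξ‖ := norm_pos_iff.2 hξ
  have hinv : ∀ u : ℝ, χ u = ∫ τ : ℝ, 𝐞 (τ * u) • (𝓕 (χ : ℝ → ℂ)) τ := by
    intro u
    have h : (𝓕⁻ (𝓕 χ)) u = χ u := by simp
    rw [SchwartzMap.fourierInv_coe, Real.fourierInv_eq, SchwartzMap.fourier_coe] at h
    rw [← h]
    congr 1; funext τ
    congr 2
    simp [mul_comm]
  have hIntg : Integrable (𝓕 (χ : ℝ → ℂ)) := by
    rw [← SchwartzMap.fourier_coe]; exact (𝓕 χ).integrable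
  have hcont : Continuous (𝓕 (χ : ℝ → ℂ)) := by
    rw [← SchwartzMap.fourier_coe]; exact (𝓕 χ).continuous
  rw [rad_mFT μ R hR]
  have h1 : ∀ᵐ y ∂μ, (-(2 * (π:ℂ) * Complex.I * ((⟪y, ξ⟫ : ℝ) : ℂ))) *
      Complex.exp (-(2 * (π:ℂ) * Complex.I * ((⟪y, ξ⟫ : ℝ) : ℂ))) =
      (‖ξ‖:ℂ) * ∫ τ : ℝ, (𝓕 (χ : ℝ → ℂ)) τ * (𝐞 (-⟪y, (1 - τ / ‖ξ‖) • ξ⟫) • (1:ℂ)) := by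
    refine hR.mono fun y hy => ?_
    have h2 : |⟪y, ξ⟫ / ‖ξ‖| ≤ R := by
      rw [abs_div, abs_of_pos hs, div_le_iff₀ hs]
      exact (abs_real_inner_le_norm y ξ).trans (by gcongr)
    have h3 := hχ _ h2
    rw [hinv] at h3
    have h4 : -(2 * (π:ℂ) * Complex.I * ((⟪y, ξ⟫ : ℝ) : ℂ)) =
      (‖ξ‖:ℂ) * -(2 * (π:ℂ) * Complex.I * ((⟪y, ξ⟫ / ‖ξ‖ : ℝ) : ℂ)) := by
      push_cast
      have : (‖ξ‖:ℂ) ≠ 0 := by exact_mod_cast hs.ne'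
      field_simp
    have h5 : Complex.exp (-(2 * (π:ℂ) * Complex.I * ((⟪y, ξ⟫ : ℝ) : ℂ))) = ((𝐞 (-⟪y, ξ⟫) : Circle) : ℂ) := by
      rw [Real.fourierChar_apply]
      congr 1; push_cast; ring
    rw [h5, h4, ← h3, mul_assoc, ← integral_mul_const]
    congr 2; funext τ
    have h6 : 𝐞 (-⟪y, (1 - τ / ‖ξ‖) • ξ⟫) = 𝐞 (τ * (⟪y, ξ⟫ / ‖ξ‖)) * 𝐞 (-⟪y, ξ⟫) := by
      rw [← AddChar.map_add_eq_mul]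
      congr 1
      rw [inner_smul_right]
      ring
    rw [h6]
    simp only [Circle.smul_def, smul_eq_mul, Circle.coe_mul]
    ring
  rw [integral_congr_ae h1, integral_const_mul]
  congr 1
  rw [integral_integral_swap]
  · congr 1; funext τ
    rw [integral_const_mul, mFT_eq]
  · have hi := (integrable_const (1:ℂ) : Integrable _ μ).mul_prod hIntg
    refine hi.mono ?_ (Filter.Eventually.of_forall fun z => ?_)
    · refine Continuous.aestronglyMeasurable ?_
      have h7 : Continuous fun z : Esp d × ℝ => ((𝐞 (-⟪z.1, (1 - z.2 / ‖ξ‖) • ξ⟫) : Circle) : ℂ) :=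
        continuous_echar.comp (by fun_prop)
      simp only [Function.uncurry_def, Circle.smul_def, smul_eq_mul, mul_one]
      exact (hcont.comp continuous_snd).mul h7
    · simp only [Function.uncurry]
      rw [norm_mul, norm_mul, Circle.norm_smul]
      simp

lemma rad_decay (μ : Measure (Esp d)) [IsFiniteMeasure μ] (R : ℝ) (hR0 : 0 < R) 
    (hR : ∀ᵐ y ∂μ, ‖y‖ ≤ R) (a C : ℝ) (ha : 0 < a) (hC : 0 ≤ C)
    (hdecay : ∀ ξ : Esp d, ξ ≠ 0 → ‖mFT μ ξ‖ ≤ C * ‖ξ‖ ^ (-a)) :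
    ∃ C' : ℝ, 0 ≤ C' ∧ ∀ ξ : Esp d, 1 ≤ ‖ξ‖ → ‖rad (mFT μ) ξ‖ ≤ C' * (‖ξ‖ * ‖ξ‖ ^ (-a)) := by
  obtain ⟨χ, hχ⟩ := exists_chi R hR0
  obtain ⟨N, hN⟩ := exists_nat_ge a
  have hIntg : Integrable (𝓕 (χ : ℝ → ℂ)) := by
    rw [← SchwartzMap.fourier_coe]; exact (𝓕 χ).integrable
  have hintN : Integrable fun τ : ℝ => ‖τ‖^N * ‖(𝓕 (χ : ℝ → ℂ)) τ‖ := by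
    rw [← SchwartzMap.fourier_coe]; exact (𝓕 χ).integrable_pow_mul volume N
  set M := μ.real univ with hM
  have hM0 : 0 ≤ M := measureReal_nonneg
  set bd : ℝ → ℝ := fun τ => (C * 2^a) * ‖(𝓕 (χ : ℝ → ℂ)) τ‖ + (M * 2^N) * (‖τ‖^N * ‖(𝓕 (χ : ℝ → ℂ)) τ‖) with hbd
  have hbdi : Integrable bd := (hIntg.norm.const_mul _).add (hintN.const_mul _)
  have hbd0 : ∀ τ, 0 ≤ bd τ := fun τ => by positivity
  refine ⟨∫ τ, bd τ, integral_nonneg hbd0, fun ξ hξ => ?_⟩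
  have hs : 0 < ‖ξ‖ := by linarith
  have hξ0 : ξ ≠ 0 := norm_pos_iff.1 hs
  rw [rad_repr μ R hR χ hχ ξ hξ0, norm_mul, Complex.norm_real, norm_norm, mul_left_comm]
  gcongr
  rw [← integral_mul_const]
  refine norm_integral_le_of_norm_le (hbdi.mul_const _) (Filter.Eventually.of_forall fun τ => ?_)
  rw [norm_mul]
  set X := ‖(𝓕 (χ : ℝ → ℂ)) τ‖
  have hX : 0 ≤ X := norm_nonneg _
  have hsa : 0 < ‖ξ‖^(-a) := by positivity
  have e : bd τ * ‖ξ‖^(-a) = X * ((C * 2^a) * ‖ξ‖^(-a) + M * (2^N * ‖τ‖^N) * ‖ξ‖^(-a)) := by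
    simp only [hbd]; ring
  rw [e]
  gcongr
  by_cases hτ : |τ| ≤ ‖ξ‖/2
  · have h1 : ‖ξ‖/2 ≤ ‖(1 - τ / ‖ξ‖) • ξ‖ := by
      rw [norm_smul, Real.norm_eq_abs]
      have h2 : 1/2 ≤ |1 - τ/‖ξ‖| := by
        have : |τ/‖ξ‖| ≤ 1/2 := by
          rw [abs_div, abs_of_pos hs, div_le_iff₀ hs]; linarith
        have := abs_le.1 this
        exact le_trans (by linarith [this.2]) (le_abs_self _)
      nlinarith
    have h3 : (1 - τ / ‖ξ‖) • ξ ≠ 0 := norm_pos_iff.1 (by linarith)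
    refine (hdecay _ h3).trans ?_
    have h4 : ‖(1 - τ / ‖ξ‖) • ξ‖ ^ (-a) ≤ 2^a * ‖ξ‖^(-a) := by
      calc _ ≤ (‖ξ‖/2)^(-a) := rpow_le_rpow_of_nonpos (by positivity) h1 (by linarith)
        _ = _ := by
          rw [Real.div_rpow hs.le (by norm_num), Real.rpow_neg (by norm_num : (0:ℝ) ≤ 2), div_inv_eq_mul, mul_comm]
    have h5 : 0 ≤ M * (2^N * ‖τ‖^N) * ‖ξ‖^(-a) := by positivity
    nlinarith
  · push Not at hτ
    refine (norm_mFT_le μ _).trans ?_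
    have h1 : ‖ξ‖^a ≤ 2^N * ‖τ‖^N := by
      calc ‖ξ‖^a ≤ ‖ξ‖^(N:ℝ) := rpow_le_rpow_of_exponent_le hξ hN
        _ = ‖ξ‖^N := rpow_natCast _ _
        _ ≤ (2*‖τ‖)^N := by gcongr; rw [Real.norm_eq_abs]; linarith
        _ = _ := mul_pow _ _ _
    have h2 : 1 ≤ (2^N * ‖τ‖^N) * ‖ξ‖^(-a) := by
      calc 1 = ‖ξ‖^a * ‖ξ‖^(-a) := by rw [← rpow_add hs]; simp
        _ ≤ _ := by gcongr
    have h5 : 0 ≤ (C * 2^a) * ‖ξ‖^(-a) := by positivity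
    calc M = M * 1 := by ring
      _ ≤ M * ((2^N * ‖τ‖^N) * ‖ξ‖^(-a)) := by gcongr
      _ ≤ _ := by rw [← mul_assoc]; linarith

end RdF

namespace RdF

open scoped ContDiff

/-- dilate of the measure. -/
def nuj (μ : Measure (Esp d)) (j : ℕ) : Measure (Esp d) := μ.map (fun y => (2^j:ℝ) • y)

lemma nuj_fin (μ : Measure (Esp d)) [IsFiniteMeasure μ] (j : ℕ) : IsFiniteMeasure (nuj μ j) := by
  unfold nuj; infer_instance

lemma nuj_univ (μ : Measure (Esp d)) (j : ℕ) : nuj μ j univ = μ univ := by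
  unfold nuj; rw [Measure.map_apply (by fun_prop) MeasurableSet.univ]; simp

lemma nuj_supp (μ : Measure (Esp d)) (R : ℝ) (hR : ∀ᵐ y ∂μ, ‖y‖ ≤ R) (j : ℕ) :
    ∀ᵐ y ∂(nuj μ j), ‖y‖ ≤ 2^j * R := by
  unfold nuj
  rw [ae_map_iff (by fun_prop) (isClosed_le continuous_norm continuous_const).measurableSet]
  refine hR.mono fun y hy => ?_
  rw [norm_smul, Real.norm_of_nonneg (by positivity)]
  gcongr

lemma mFT_nuj (μ : Measure (Esp d)) (j : ℕ) (ξ : Esp d) :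
    mFT (nuj μ j) ξ = mFT μ ((2^j:ℝ) • ξ) := by
  unfold mFT nuj
  rw [integral_map (by fun_prop) (Continuous.aestronglyMeasurable (by fun_prop))]
  simp only [inner_smul_left, inner_smul_right]
  rfl

lemma rad_nuj (μ : Measure (Esp d)) [IsFiniteMeasure μ] (R : ℝ) (hR : ∀ᵐ y ∂μ, ‖y‖ ≤ R) (j : ℕ) (ξ : Esp d) :
    rad (mFT (nuj μ j)) ξ = rad (mFT μ) ((2^j:ℝ) • ξ) := by
  have e : mFT (nuj μ j) = fun ξ => mFT μ ((2^j:ℝ) • ξ) := funext fun ξ => mFT_nuj μ j ξ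
  rw [e]
  unfold rad
  have h := (((contDiff_mFT μ R hR).differentiable (by simp)) ((2^j:ℝ) • ξ)).hasFDerivAt.comp ξ
    ((hasFDerivAt_id ξ).const_smul (2^j:ℝ))
  have h2 : HasFDerivAt (fun ξ => mFT μ ((2^j:ℝ) • ξ)) ((fderiv ℝ (mFT μ) ((2^j:ℝ) • ξ)).comp ((2^j:ℝ) • ContinuousLinearMap.id ℝ (Esp d))) ξ := h
  rw [h2.fderiv]
  simp

lemma rad_mul (u v : Esp d → ℂ) (hu : ContDiff ℝ ∞ u) (hv : ContDiff ℝ ∞ v) (ξ : Esp d) :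
    rad (fun η => u η * v η) ξ = u ξ * rad v ξ + v ξ * rad u ξ := by
  unfold rad
  have h := ((hu.differentiable (by simp)) ξ).hasFDerivAt.mul ((hv.differentiable (by simp)) ξ).hasFDerivAt
  have h2 : HasFDerivAt (fun η => u η * v η) (u ξ • fderiv ℝ v ξ + v ξ • fderiv ℝ u ξ) ξ := h
  rw [h2.fderiv]
  simp

lemma memLp_two_of_bdd (g : Esp d → ℂ) (hg : Integrable g) (B : ℝ) (hB : ∀ x, ‖g x‖ ≤ B) : MemLp g 2 := by
  rw [memLp_two_iff_integrable_sq_norm hg.1]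
  refine (hg.norm.const_mul B).mono' (hg.1.norm.pow 2) (Filter.Eventually.of_forall fun x => ?_)
  rw [Real.norm_of_nonneg (by positivity), pow_two]
  gcongr
  exact hB x

lemma memLp_kfam (ψ : SchwartzMap (Esp d) ℂ) (ν : Measure (Esp d)) [IsFiniteMeasure ν] (i : Idx) :
    MemLp (kfam ψ ν i) 2 := by
  obtain ⟨B, hB⟩ := bdd_ker ψ ν _ (Idx_pos i)
  refine memLp_two_of_bdd _ ⟨(continuous_ker ψ ν _ (Idx_pos i)).aestronglyMeasurable, ?_⟩ B hB
  refine (lintegral_ker_le ψ ν _ (Idx_pos i)).trans_lt ?_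
  exact ENNReal.mul_lt_top (measure_lt_top _ _) (SchwartzMap.integrable (μ := volume) ψ).2

instance : Nonempty Idx := ⟨⟨1, by norm_num⟩⟩

lemma L2_main (μ : Measure (Esp d)) [IsFiniteMeasure μ] (R : ℝ) (hR0 : 0 < R) 
    (hR : ∀ᵐ y ∂μ, ‖y‖ ≤ R) (a C : ℝ) (ha : 0 < a) (hC : 0 < C)
    (hdecay : ∀ ξ : Esp d, ξ ≠ 0 → ‖mFT μ ξ‖ ≤ C * ‖ξ‖ ^ (-a))
    (ψ : SchwartzMap (Esp d) ℂ)
    (hs : ∀ ξ, (𝓕 (ψ : Esp d → ℂ)) ξ ≠ 0 → 1/2 ≤ ‖ξ‖ ∧ ‖ξ‖ ≤ 2) :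
    ∃ K : ℝ, 0 < K ∧ ∀ j : ℕ, 1 ≤ j → ∀ g : Esp d → ℂ, MemLp g 2 →
      ∫⁻ x, TT (kfam ψ (nuj μ j)) g x ^ 2 ≤ 
        ENNReal.ofReal (K * ((2:ℝ)^j * ((2:ℝ)^j)^(-(2*a)))) * ∫⁻ x, ‖g x‖ₑ ^ 2 := by
  obtain ⟨C1, hC1, hrad⟩ := rad_decay μ R hR0 hR a C ha hC.le hdecay
  set θ := 𝓕 (ψ : Esp d → ℂ) with hθ
  have hθs : ContDiff ℝ ∞ θ := contDiff_hat ψ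
  have hθc : HasCompactSupport θ := by
    refine HasCompactSupport.intro (isCompact_closedBall (0:Esp d) 2) fun ξ hξ => ?_
    by_contra h
    exact hξ (by simpa using (hs ξ h).2)
  have hrc : HasCompactSupport (rad θ) := by
    refine HasCompactSupport.intro (isCompact_closedBall (0:Esp d) 2) fun ξ hξ => ?_
    by_contra h
    exact hξ (by simpa using (rad_supp θ hs ξ h).2)
  obtain ⟨B1, hB1⟩ := hθs.continuous.bounded_above_of_compact_support hθc
  obtain ⟨B2, hB2⟩ := (contDiff_rad θ hθs).continuous.bounded_above_of_compact_support hrc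
  set B := max (max B1 B2) 1 with hB
  have hBpos : 0 < B := lt_of_lt_of_le one_pos (le_max_right _ _)
  have hB1' : ∀ ξ, ‖θ ξ‖ ≤ B := fun ξ => (hB1 ξ).trans ((le_max_left _ _).trans (le_max_left _ _))
  have hB2' : ∀ ξ, ‖rad θ ξ‖ ≤ B := fun ξ => (hB2 ξ).trans ((le_max_right _ _).trans (le_max_left _ _))
  refine ⟨2 * (C * 2^a * B) * ((C * 2^a) * B + B * (C1 * (2 * 2^a))) * Real.log 4, ?_, fun j hj => ?_⟩
  · have : 0 < Real.log 4 := Real.log_pos (by norm_num)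
    positivity
  haveI := nuj_fin μ j
  set ν := nuj μ j with hν
  have hsup := nuj_supp μ R hR j
  have hνs : ContDiff ℝ ∞ (mFT ν) := contDiff_mFT ν _ hsup
  have h2j : (2:ℝ) ≤ 2^j := by
    calc (2:ℝ) = 2^1 := by norm_num
      _ ≤ 2^j := pow_le_pow_right₀ (by norm_num) hj
  set q : ℝ := (2:ℝ)^j with hq
  have hq0 : 0 < q := by positivity
  have hnorm : ∀ ξ : Esp d, ‖q • ξ‖ = q * ‖ξ‖ := fun ξ => by
    rw [norm_smul, Real.norm_of_nonneg hq0.le]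
  have hpow : ∀ ξ : Esp d, 1/2 ≤ ‖ξ‖ → ‖q • ξ‖^(-a) ≤ 2^a * q^(-a) := by
    intro ξ hξ
    calc _ ≤ (q/2)^(-a) := rpow_le_rpow_of_nonpos (by positivity) (by rw [hnorm]; nlinarith) (by linarith)
      _ = _ := by
        rw [Real.div_rpow hq0.le (by norm_num), Real.rpow_neg (by norm_num : (0:ℝ) ≤ 2), div_inv_eq_mul, mul_comm]
  have hmb : ∀ ξ : Esp d, 1/2 ≤ ‖ξ‖ → ‖mFT ν ξ‖ ≤ C * 2^a * q^(-a) := by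
    intro ξ hξ
    rw [hν, mFT_nuj]
    have : q • ξ ≠ 0 := norm_pos_iff.1 (by rw [hnorm]; exact mul_pos hq0 (by linarith))
    refine (hdecay _ this).trans ?_
    rw [mul_assoc]
    exact mul_le_mul_of_nonneg_left (hpow ξ hξ) hC.le
  have hmr : ∀ ξ : Esp d, 1/2 ≤ ‖ξ‖ → ‖ξ‖ ≤ 2 → ‖rad (mFT ν) ξ‖ ≤ C1 * (2 * 2^a) * (q * q^(-a)) := by
    intro ξ hξ hξ2
    rw [hν, rad_nuj μ R hR]
    refine (hrad _ (by rw [hnorm]; nlinarith)).trans ?_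
    rw [mul_assoc]
    refine mul_le_mul_of_nonneg_left ?_ hC1
    calc ‖q • ξ‖ * ‖q • ξ‖^(-a) ≤ (q * 2) * (2^a * q^(-a)) := by
          refine mul_le_mul ?_ (hpow ξ hξ) (by positivity) (by positivity)
          rw [hnorm]; gcongr
      _ = _ := by ring
  have hqa : 0 < q^(-a) := by positivity
  intro g hg
  refine L2_extend (kfam ψ ν) (fun i => continuous_ker ψ ν _ (Idx_pos i)) (memLp_kfam ψ ν) _ (by simp) 
    (fun f => ?_) g hg
  refine (L2_schwartz ψ ν (hνs.mul hθs) hs (C * 2^a * B * q^(-a)) 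
    (((C * 2^a) * B + B * (C1 * (2 * 2^a))) * (q * q^(-a))) (by positivity) (by positivity) ?_ ?_ f).trans
    (le_of_eq ?_)
  · intro ξ
    by_cases h : θ ξ = 0
    · rw [← hθ, h]; simp; positivity
    · rw [norm_mul]
      calc _ ≤ (C * 2^a * q^(-a)) * B := mul_le_mul (hmb ξ (hs ξ h).1) (hB1' ξ) (norm_nonneg _) (by positivity)
        _ = _ := by ring
  · intro ξ
    by_cases h : 1/2 ≤ ‖ξ‖ ∧ ‖ξ‖ ≤ 2
    · rw [← hθ, rad_mul _ _ hνs hθs]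
      refine (norm_add_le _ _).trans ?_
      rw [norm_mul, norm_mul, add_mul]
      refine add_le_add ?_ ?_
      · calc _ ≤ (C * 2^a * q^(-a)) * B := mul_le_mul (hmb ξ h.1) (hB2' ξ) (norm_nonneg _) (by positivity)
          _ = ((C * 2^a) * B) * (1 * q^(-a)) := by ring
          _ ≤ _ := by gcongr; linarith
      · calc _ ≤ B * (C1 * (2 * 2^a) * (q * q^(-a))) := 
              mul_le_mul (hB1' ξ) (hmr ξ h.1 h.2) (norm_nonneg _) hBpos.le
          _ = _ := by ring
    · have : rad (fun η => mFT ν η * θ η) ξ = 0 := by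
        by_contra h0
        exact h (rad_supp _ (fun ξ h => hs ξ (right_ne_zero_of_mul h)) ξ h0)
      rw [← hθ, this, norm_zero]
      positivity
  · congr 2
    have : q^(-(2*a)) = q^(-a) * q^(-a) := by rw [← rpow_add hq0]; congr 1; ring
    rw [this]
    ring

end RdF

namespace RdF

lemma Lp_zero (hd : 1 ≤ d) (p : ℝ) (hp1 : 1 < p) (hp2 : p < 2) (φ : SchwartzMap (Esp d) ℂ)
    (μ : Measure (Esp d)) [IsFiniteMeasure μ] (R : ℝ) (hR1 : 1 ≤ R) (hR : ∀ᵐ y ∂μ, ‖y‖ ≤ R) :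
    ∃ C : ℝ≥0∞, C ≠ ∞ ∧ ∀ f : Esp d → ℂ, Continuous f → Integrable f →
        ∫⁻ x, TT (kfam φ μ) f x ^ p ≤ C * ∫⁻ x, ‖f x‖ₑ ^ p := by
  obtain ⟨K, hK, hH⟩ := horm_main hd φ 1 one_pos le_rfl
  have hfin : (μ univ * ∫⁻ z, ‖φ z‖ₑ) ≠ ∞ :=
    (ENNReal.mul_lt_top (measure_lt_top _ _) (SchwartzMap.integrable (μ := volume) φ).2).ne
  refine interp_infty hd p hp1 hp2 Idx (kfam φ μ) (fun i => continuous_ker φ μ _ (Idx_pos i))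
    (fun i => bdd_ker φ μ _ (Idx_pos i)) _ ?_ (hH R hR1 μ hR) 
    ((μ univ * ∫⁻ z, ‖φ z‖ₑ).toReal + 1) (by positivity) ?_
  · finiteness
  · intro g _ _ M hM hg x
    refine (TT_infty φ μ g M hg x).trans ?_
    rw [ENNReal.ofReal_mul (by positivity)]
    gcongr
    rw [← ENNReal.ofReal_toReal hfin]
    exact ENNReal.ofReal_le_ofReal (by simp)

lemma Lp_j (hd : 1 ≤ d) (p : ℝ) (hp1 : 1 < p) (hp2 : p < 2) (ψ : SchwartzMap (Esp d) ℂ)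
    (hs : ∀ ξ, (𝓕 (ψ : Esp d → ℂ)) ξ ≠ 0 → 1/2 ≤ ‖ξ‖ ∧ ‖ξ‖ ≤ 2)
    (μ : Measure (Esp d)) [IsFiniteMeasure μ] (R : ℝ) (hR1 : 1 ≤ R) (hR : ∀ᵐ y ∂μ, ‖y‖ ≤ R)
    (a C : ℝ) (ha : 0 < a) (hC : 0 < C)
    (hdecay : ∀ ξ : Esp d, ξ ≠ 0 → ‖mFT μ ξ‖ ≤ C * ‖ξ‖ ^ (-a)) (hpa : 1 < 2*a*(p-1)) :
    ∃ K : ℝ≥0∞, K ≠ ∞ ∧ ∃ δ : ℝ, 0 < δ ∧ ∀ j : ℕ, 1 ≤ j → ∀ f : Esp d → ℂ, Continuous f → Integrable f →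
        ∫⁻ x, TT (kfam ψ (nuj μ j)) f x ^ p ≤ K * ENNReal.ofReal (((2:ℝ)^j)^(-δ)) * ∫⁻ x, ‖f x‖ₑ ^ p := by
  set ε : ℝ := min 1 ((2*a*(p-1)-1)/2) with hε
  have hε0 : 0 < ε := lt_min one_pos (by linarith)
  have hε1 : ε ≤ 1 := min_le_left _ _
  have hε2 : ε ≤ (2*a*(p-1)-1)/2 := min_le_right _ _
  obtain ⟨K1, hK1, hH⟩ := horm_main hd ψ ε hε0 hε1
  obtain ⟨K2, hK2, hL⟩ := L2_main μ R (by linarith) hR a C ha hC hdecay ψ hs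
  obtain ⟨C0, hC0, hI⟩ := interp_scaled (d := d) hd p hp1 hp2
  refine ⟨C0 * (1 + ENNReal.ofReal (R^(1+ε)) * K1 * μ univ + ENNReal.ofReal K2), by finiteness,
    2*a*(p-1)-1-ε, by linarith, ?_⟩
  intro j hj f hf hfi
  haveI := nuj_fin μ j
  set q : ℝ := (2:ℝ)^j with hq
  have hq0 : 0 < q := by positivity
  have hq1 : 1 ≤ q := one_le_pow₀ (by norm_num)
  have hA1 := hH (q * R) (by nlinarith) (nuj μ j) (nuj_supp μ R hR j)
  rw [nuj_univ] at hA1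
  have hmain := hI Idx (kfam ψ (nuj μ j)) (fun i => continuous_ker ψ _ _ (Idx_pos i))
    (fun i => bdd_ker ψ _ _ (Idx_pos i)) _ _ hA1 (fun g hg hgi hgb => by
      obtain ⟨B, hB⟩ := hgb
      exact hL j hj g (memLp_two_of_bdd g hgi B hB)) (q^(2*a)) (by positivity) f hf hfi
  refine hmain.trans ?_
  gcongr ?_ * _
  rw [← hq]
  have e1 : ENNReal.ofReal (q^(2*a)) * (ENNReal.ofReal ((q*R)^(1+ε)) * K1 * μ univ) = 
      ENNReal.ofReal (q^(2*a+1+ε)) * (ENNReal.ofReal (R^(1+ε)) * K1 * μ univ) := by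
    rw [Real.mul_rpow hq0.le (by linarith), show 2*a+1+ε = 2*a + (1+ε) by ring, Real.rpow_add hq0 (2*a) (1+ε),
      ENNReal.ofReal_mul (p := q^(1+ε)) (by positivity), ENNReal.ofReal_mul (p := q^(2*a)) (by positivity)]
    ring
  have e2 : ENNReal.ofReal ((q^(2*a))^2) * ENNReal.ofReal (K2 * (q * q^(-(2*a)))) ≤
      ENNReal.ofReal (q^(2*a+1+ε)) * ENNReal.ofReal K2 := by
    rw [← ENNReal.ofReal_mul (by positivity), ← ENNReal.ofReal_mul (by positivity)]
    refine ENNReal.ofReal_le_ofReal ?_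
    have : (q^(2*a))^2 * (K2 * (q * q^(-(2*a)))) = q^(2*a+1) * K2 := by
      rw [Real.rpow_neg hq0.le, Real.rpow_add hq0, Real.rpow_one]
      have : q^(2*a) ≠ 0 := by positivity
      field_simp
    rw [this]
    exact mul_le_mul_of_nonneg_right (Real.rpow_le_rpow_of_exponent_le hq1 (by linarith)) hK2.le
  have e3 : (1:ℝ≥0∞) ≤ ENNReal.ofReal (q^(2*a+1+ε)) * 1 := by
    rw [mul_one, ← ENNReal.ofReal_one]
    exact ENNReal.ofReal_le_ofReal (Real.one_le_rpow hq1 (by positivity))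
  calc _ ≤ C0 * ENNReal.ofReal ((q^(2*a))^(-p)) * (ENNReal.ofReal (q^(2*a+1+ε)) * 1 + 
        ENNReal.ofReal (q^(2*a+1+ε)) * (ENNReal.ofReal (R^(1+ε)) * K1 * μ univ) + 
        ENNReal.ofReal (q^(2*a+1+ε)) * ENNReal.ofReal K2) := by
        refine mul_le_mul_right ?_ _
        exact add_le_add (add_le_add e3 e1.le) e2
    _ = C0 * (1 + ENNReal.ofReal (R^(1+ε)) * K1 * μ univ + ENNReal.ofReal K2) * 
        (ENNReal.ofReal ((q^(2*a))^(-p)) * ENNReal.ofReal (q^(2*a+1+ε))) := by ring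
    _ = _ := by
        rw [← ENNReal.ofReal_mul (by positivity), ← Real.rpow_mul hq0.le, ← Real.rpow_add hq0]
        congr 3
        ring

lemma minkowski_tsum (p : ℝ) (hp : 1 ≤ p) (u : ℕ → Esp d → ℝ≥0∞) (hu : ∀ j, Measurable (u j)) :
    (∫⁻ x, (∑' j, u j x) ^ p) ^ (1/p) ≤ ∑' j, (∫⁻ x, u j x ^ p) ^ (1/p) := by
  have hp0 : 0 < p := by linarith
  have hfin : ∀ n : ℕ, (∫⁻ x, (∑ j ∈ Finset.range n, u j x) ^ p) ^ (1/p) ≤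
      ∑ j ∈ Finset.range n, (∫⁻ x, u j x ^ p) ^ (1/p) := by
    intro n
    induction n with
    | zero => simp [hp0]
    | succ n ih =>
      simp_rw [Finset.sum_range_succ]
      have := ENNReal.lintegral_Lp_add_le (μ := volume) (p := p) 
        (f := fun x => ∑ j ∈ Finset.range n, u j x) (g := u n)
        (Finset.measurable_fun_sum _ fun j _ => hu j).aemeasurable (hu n).aemeasurable hp
      exact this.trans (by gcongr)
  have hmeas : ∀ n : ℕ, Measurable fun x => (∑ j ∈ Finset.range n, u j x) ^ p := fun n =>
    (Finset.measurable_fun_sum _ fun j _ => hu j).pow_const p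
  have h1 : ∀ x, (∑' j, u j x) ^ p = ⨆ n : ℕ, (∑ j ∈ Finset.range n, u j x) ^ p := by
    intro x
    rw [ENNReal.tsum_eq_iSup_nat]
    exact (ENNReal.orderIsoRpow p hp0).map_iSup _
  simp_rw [h1]
  rw [lintegral_iSup hmeas]
  · have h2 : (⨆ n : ℕ, ∫⁻ x, (∑ j ∈ Finset.range n, u j x) ^ p) ^ (1/p) = 
      ⨆ n : ℕ, (∫⁻ x, (∑ j ∈ Finset.range n, u j x) ^ p) ^ (1/p) :=
      (ENNReal.orderIsoRpow (1/p) (by positivity)).map_iSup _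
    rw [h2]
    exact iSup_le fun n => (hfin n).trans (ENNReal.sum_le_tsum _)
  · intro m n hmn x
    refine ENNReal.rpow_le_rpow ?_ hp0.le
    exact Finset.sum_le_sum_of_subset (Finset.range_mono hmn)

end RdF

namespace RdF

open scoped ContDiff in
lemma exists_LP : ∃ χ : Esp d → ℂ, Continuous χ ∧ (∀ ξ, ‖χ ξ‖ ≤ 1) ∧ (∀ ξ, ‖ξ‖ ≤ 1 → χ ξ = 1) ∧
    ∃ φ ψ : SchwartzMap (Esp d) ℂ, 𝓕 (φ : Esp d → ℂ) = χ ∧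
      (∀ ξ, 𝓕 (ψ : Esp d → ℂ) ξ = χ ξ - χ ((2:ℝ) • ξ)) ∧
      (∀ ξ, (𝓕 (ψ : Esp d → ℂ)) ξ ≠ 0 → 1/2 ≤ ‖ξ‖ ∧ ‖ξ‖ ≤ 2) := by
  let b : ContDiffBump (0 : Esp d) := ⟨1, 2, one_pos, by norm_num⟩
  let χ : Esp d → ℂ := fun ξ => ((b ξ : ℝ) : ℂ)
  have hsm : ContDiff ℝ ∞ χ := Complex.ofRealCLM.contDiff.comp b.contDiff
  have hcs : HasCompactSupport χ := b.hasCompactSupport.comp_left (g := fun r : ℝ => (r : ℂ)) (by simp)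
  have h1 : ∀ ξ, ‖ξ‖ ≤ 1 → χ ξ = 1 := by
    intro ξ hξ
    have : b ξ = 1 := b.one_of_mem_closedBall (by simpa [b] using hξ)
    simp [χ, this]
  have h0 : ∀ ξ, 2 ≤ ‖ξ‖ → χ ξ = 0 := by
    intro ξ hξ
    have : b ξ = 0 := b.zero_of_le_dist (by simpa [b] using hξ)
    simp [χ, this]
  let χ2 : Esp d → ℂ := fun ξ => χ ξ - χ ((2:ℝ) • ξ)
  have hsm2 : ContDiff ℝ ∞ χ2 := hsm.sub (hsm.comp (contDiff_const_smul (2:ℝ)))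
  have hcs2 : HasCompactSupport χ2 := by
    refine hcs.sub (hcs.comp_homeomorph (Homeomorph.smulOfNeZero (2:ℝ) two_ne_zero))
  refine ⟨χ, hsm.continuous, ?_, h1, 𝓕⁻ (hcs.toSchwartzMap hsm), 𝓕⁻ (hcs2.toSchwartzMap hsm2), ?_, ?_, ?_⟩
  · intro ξ
    simp only [χ, Complex.norm_real, Real.norm_eq_abs, abs_of_nonneg b.nonneg]
    exact b.le_one
  · rw [← SchwartzMap.fourier_coe]
    rw [FourierTransform.fourier_fourierInv_eq]
    rfl
  · intro ξ
    rw [← SchwartzMap.fourier_coe]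
    rw [FourierTransform.fourier_fourierInv_eq]
    rfl
  · intro ξ
    rw [← SchwartzMap.fourier_coe]
    rw [FourierTransform.fourier_fourierInv_eq]
    intro h
    have h : χ ξ - χ ((2:ℝ) • ξ) ≠ 0 := h
    constructor
    · by_contra! hlt
      apply h
      rw [h1 ξ (by linarith), h1 _ (by rw [norm_smul]; simp; linarith)]
      simp
    · by_contra! hlt
      apply h
      rw [h0 ξ (by linarith), h0 _ (by rw [norm_smul]; simp; linarith)]
      simp

lemma integrable_MO (m g : Esp d → ℂ) (hm : Continuous m) (hg : Continuous g) (hgi : Integrable g)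
    (a0 : ℝ) (ha : ∀ ξ, ‖m ξ‖ ≤ a0) (t : ℝ) (x : Esp d) :
    Integrable fun ξ => 𝐞 ⟪ξ, x⟫ • (g ξ * m (t • ξ)) := by
  refine Integrable.mono' (hgi.norm.mul_const a0) ?_ ?_
  · refine Continuous.aestronglyMeasurable ?_
    have : Continuous fun ξ : Esp d => 𝐞 ⟪ξ, x⟫ := Real.continuous_fourierChar.comp (by fun_prop)
    exact this.smul (by fun_prop)
  · refine Filter.Eventually.of_forall fun ξ => ?_
    rw [Circle.norm_smul, norm_mul]
    exact mul_le_mul_of_nonneg_left (ha _) (norm_nonneg _)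

lemma MO_telescope (μ : Measure (Esp d)) [IsFiniteMeasure μ] (hmc : Continuous (mFT μ)) (χ : Esp d → ℂ)
    (hχ : Continuous χ) (hχ1 : ∀ ξ, ‖χ ξ‖ ≤ 1) (ψ : SchwartzMap (Esp d) ℂ)
    (hψ : ∀ ξ, 𝓕 (ψ : Esp d → ℂ) ξ = χ ξ - χ ((2:ℝ) • ξ))
    (g : Esp d → ℂ) (hg : Continuous g) (hgi : Integrable g) (t : ℝ) (x : Esp d) (J : ℕ) :
    MO (fun η => mFT μ η * χ (((2:ℝ)^J)⁻¹ • η)) g t x = MO (fun η => mFT μ η * χ η) g t x +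
      ∑ j ∈ Finset.range J, MO (fun η => mFT (nuj μ (j+1)) η * 𝓕 (ψ : Esp d → ℂ) η) g
        (((2:ℝ)^(j+1))⁻¹ * t) x := by
  induction J with
  | zero => simp
  | succ J ih =>
    rw [Finset.sum_range_succ, ← add_assoc, ← ih, ← sub_eq_iff_eq_add']
    unfold MO
    have hb : ∀ J : ℕ, ∀ ξ, ‖mFT μ ξ * χ (((2:ℝ)^J)⁻¹ • ξ)‖ ≤ μ.real univ * 1 := by
      intro J ξ
      rw [norm_mul]
      exact mul_le_mul (norm_mFT_le μ ξ) (hχ1 _) (norm_nonneg _) measureReal_nonneg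
    rw [← integral_sub (integrable_MO _ g (by fun_prop) hg hgi _ (hb (J+1)) t x)
      (integrable_MO _ g (by fun_prop) hg hgi _ (hb J) t x)]
    congr 1; funext ξ
    have h2 : ((2:ℝ)^(J+1)) ≠ 0 := by positivity
    rw [← smul_sub]
    beta_reduce
    rw [mFT_nuj, hψ, smul_smul, smul_smul, smul_smul, smul_smul,
      mul_inv_cancel_left₀ h2]
    have : 2 * (((2:ℝ)^(J+1))⁻¹ * t) = ((2:ℝ)^J)⁻¹ * t := by
      rw [pow_succ]; field_simp
    rw [this]
    congr 1
    ring

lemma MO_limit (m : Esp d → ℂ) (hm : Continuous m) (a0 : ℝ) (ha : ∀ ξ, ‖m ξ‖ ≤ a0) (χ : Esp d → ℂ)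
    (hχ : Continuous χ) (hχ1 : ∀ ξ, ‖χ ξ‖ ≤ 1) (hχ2 : ∀ ξ, ‖ξ‖ ≤ 1 → χ ξ = 1)
    (g : Esp d → ℂ) (hg : Continuous g) (hgi : Integrable g) (t : ℝ) (x : Esp d) :
    Filter.Tendsto (fun J : ℕ => MO (fun η => m η * χ (((2:ℝ)^J)⁻¹ • η)) g t x) Filter.atTop
      (nhds (MO m g t x)) := by
  unfold MO
  have ha0 : 0 ≤ a0 := (norm_nonneg _).trans (ha 0)
  have hb : ∀ J : ℕ, ∀ ξ, ‖m ξ * χ (((2:ℝ)^J)⁻¹ • ξ)‖ ≤ a0 * 1 := by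
    intro J ξ
    rw [norm_mul]
    exact mul_le_mul (ha ξ) (hχ1 _) (norm_nonneg _) ha0
  refine tendsto_integral_of_dominated_convergence (fun ξ => ‖g ξ‖ * (a0 * 1)) ?_
    (hgi.norm.mul_const _) ?_ ?_
  · intro J
    exact (integrable_MO _ g (by fun_prop) hg hgi _ (hb J) t x).aestronglyMeasurable
  · intro J
    refine Filter.Eventually.of_forall fun ξ => ?_
    rw [Circle.norm_smul, norm_mul]
    exact mul_le_mul_of_nonneg_left (hb _ _) (norm_nonneg _)
  · refine Filter.Eventually.of_forall fun ξ => ?_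
    refine tendsto_const_nhds.congr' ?_
    obtain ⟨N, hN⟩ := pow_unbounded_of_one_lt (‖t • ξ‖) (one_lt_two (α := ℝ))
    filter_upwards [Filter.eventually_ge_atTop N] with J hJ
    rw [hχ2 (((2:ℝ)^J)⁻¹ • (t • ξ)), mul_one]
    rw [norm_smul, norm_inv, norm_pow, Real.norm_ofNat, inv_mul_le_iff₀ (by positivity), mul_one]
    exact hN.le.trans (pow_le_pow_right₀ (by norm_num) hJ)

lemma Mmax_le (μ : Measure (Esp d)) [IsFiniteMeasure μ] (hmc : Continuous (mFT μ)) (χ : Esp d → ℂ)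
    (hχ : Continuous χ) (hχ1 : ∀ ξ, ‖χ ξ‖ ≤ 1) (hχ2 : ∀ ξ, ‖ξ‖ ≤ 1 → χ ξ = 1)
    (φ ψ : SchwartzMap (Esp d) ℂ)
    (hφ : 𝓕 (φ : Esp d → ℂ) = χ)
    (hψ : ∀ ξ, 𝓕 (ψ : Esp d → ℂ) ξ = χ ξ - χ ((2:ℝ) • ξ))
    (f : SchwartzMap (Esp d) ℂ) (x : Esp d) :
    Mmax μ f x ≤ TT (kfam φ μ) f x + ∑' j : ℕ, TT (kfam ψ (nuj μ (j+1))) f x := by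
  have hg := continuous_hat f
  have hgi := integrable_hat f
  set B := TT (kfam φ μ) f x + ∑' j : ℕ, TT (kfam ψ (nuj μ (j+1))) f x with hB
  have hrat : ∀ i : Idx, ‖MO (mFT μ) (𝓕 (f : Esp d → ℂ)) ((i:ℚ):ℝ) x‖ₑ ≤ B := by
    intro i
    have hlim := MO_limit (mFT μ) hmc _ (norm_mFT_le μ) χ hχ hχ1 hχ2 _ hg hgi ((i:ℚ):ℝ) x
    refine le_of_tendsto hlim.enorm (Filter.Eventually.of_forall fun J => ?_)
    rw [MO_telescope μ hmc χ hχ hχ1 ψ hψ _ hg hgi]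
    refine (enorm_add_le _ _).trans (add_le_add ?_ ?_)
    · rw [← hφ, ← ker_eq_MO φ μ f _ (Idx_pos i)]
      exact le_iSup (fun i : Idx => ‖∫ z, f z * kfam φ μ i (x - z)‖ₑ) i
    · refine (enorm_sum_le _ _).trans ((Finset.sum_le_sum fun j _ => ?_).trans (ENNReal.sum_le_tsum (Finset.range J)))
      haveI := nuj_fin μ (j+1)
      have hpos : (0:ℚ) < ((2:ℚ)^(j+1))⁻¹ * (i:ℚ) := mul_pos (by positivity) i.2
      have e : (((2:ℝ)^(j+1))⁻¹ * ((i:ℚ):ℝ)) = ((((2:ℚ)^(j+1))⁻¹ * (i:ℚ) : ℚ) : ℝ) := by push_cast; rfl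
      rw [e, ← ker_eq_MO ψ (nuj μ (j+1)) f _ (by exact_mod_cast hpos)]
      exact le_iSup (fun i : Idx => ‖∫ z, f z * kfam ψ (nuj μ (j+1)) i (x - z)‖ₑ) ⟨_, hpos⟩
  have hcont : Continuous fun s => ‖MO (mFT μ) (𝓕 (f : Esp d → ℂ)) s x‖ₑ :=
    (continuous_MO_left _ _ x (continuous_MO _ _ hmc hg hgi _ (norm_mFT_le μ))).enorm
  unfold Mmax
  refine iSup_le fun t => ?_
  obtain ⟨t, ht⟩ := t
  change ‖convM f μ t x‖ₑ ≤ B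
  rw [convM_eq_MO]
  by_contra! hlt
  obtain ⟨q, hq⟩ := (Rat.denseRange_cast (𝕜 := ℝ)).exists_mem_open
    ((isOpen_lt continuous_const hcont).inter isOpen_Ioi) (s := {s | B < ‖MO (mFT μ) (𝓕 (f : Esp d → ℂ)) s x‖ₑ} ∩ Ioi 0) ⟨t, hlt, ht⟩
  have hq0 : (0:ℚ) < q := by exact_mod_cast (show (0:ℝ) < q from hq.2)
  exact absurd (hrat ⟨q, hq0⟩) (not_le.mpr hq.1)

end RdF

namespace RdF

lemma geom_fin (p δ : ℝ) (hp : 0 < p) (hδ : 0 < δ) :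
    ∑' j : ℕ, ENNReal.ofReal (((2:ℝ)^(j+1))^(-δ)) ^ (1/p) ≠ ∞ := by
  set r : ℝ≥0∞ := ENNReal.ofReal ((2:ℝ)^(-δ*(1/p))) with hr
  have hr1 : r < 1 := by
    rw [hr, ← ENNReal.ofReal_one]
    refine (ENNReal.ofReal_lt_ofReal_iff one_pos).mpr ?_
    refine Real.rpow_lt_one_of_one_lt_of_neg one_lt_two ?_
    have : 0 < δ * (1/p) := by positivity
    linarith
  have h : ∀ j : ℕ, ENNReal.ofReal (((2:ℝ)^(j+1))^(-δ)) ^ (1/p) = r ^ (j+1) := by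
    intro j
    rw [ENNReal.ofReal_rpow_of_nonneg (by positivity) (by positivity), hr,
      ← ENNReal.ofReal_pow (by positivity), ← Real.rpow_mul (by positivity), ← Real.rpow_natCast,
      ← Real.rpow_natCast, ← Real.rpow_mul (by positivity), ← Real.rpow_mul (by positivity)]
    congr 2
    ring
  simp_rw [h, pow_succ]
  rw [ENNReal.tsum_mul_right, ENNReal.tsum_geometric]
  refine ENNReal.mul_ne_top ?_ (hr1.trans ENNReal.one_lt_top).ne
  rw [ENNReal.inv_ne_top]
  exact (tsub_pos_of_lt hr1).ne'

lemma Lp_small (hd : 1 ≤ d) (p : ℝ) (hp1 : 1 < p) (hp2 : p < 2)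
    (μ : Measure (Esp d)) [IsFiniteMeasure μ] (R : ℝ) (hR1 : 1 ≤ R) (hR : ∀ᵐ y ∂μ, ‖y‖ ≤ R)
    (a C : ℝ) (ha : 0 < a) (hC : 0 < C)
    (hdecay : ∀ ξ : Esp d, ξ ≠ 0 → ‖mFT μ ξ‖ ≤ C * ‖ξ‖ ^ (-a)) (hpa : 1 < 2*a*(p-1)) :
    ∃ K : ℝ≥0∞, K ≠ ∞ ∧ ∀ f : SchwartzMap (Esp d) ℂ,
        ∫⁻ x, Mmax μ f x ^ p ≤ K * ∫⁻ x, ‖f x‖ₑ ^ p := by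
  obtain ⟨χ, hχ, hχ1, hχ2, φ, ψ, hφ, hψ, hs⟩ := exists_LP (d := d)
  obtain ⟨C0, hC0, h0⟩ := Lp_zero hd p hp1 hp2 φ μ R hR1 hR
  obtain ⟨K, hK, δ, hδ, hj⟩ := Lp_j hd p hp1 hp2 ψ hs μ R hR1 hR a C ha hC hdecay hpa
  have hp0 : 0 < p := by linarith
  have hip : 0 < 1/p := by positivity
  set S := ∑' j : ℕ, ENNReal.ofReal (((2:ℝ)^(j+1))^(-δ)) ^ (1/p) with hS
  have hSf : S ≠ ∞ := geom_fin p δ hp0 hδ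
  refine ⟨(C0^(1/p) + K^(1/p) * S)^p, ?_, ?_⟩
  · refine ENNReal.rpow_ne_top_of_nonneg hp0.le ?_
    refine ENNReal.add_ne_top.mpr ⟨ENNReal.rpow_ne_top_of_nonneg hip.le hC0,
      ENNReal.mul_ne_top (ENNReal.rpow_ne_top_of_nonneg hip.le hK) hSf⟩
  intro f
  have hfc : Continuous (f : Esp d → ℂ) := f.continuous
  have hfi : Integrable (f : Esp d → ℂ) := SchwartzMap.integrable (μ := volume) f
  have hm0 : Measurable (TT (kfam φ μ) f) :=
    measurable_TT _ (fun i => continuous_ker φ μ _ (Idx_pos i)) _ hfc.measurable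
  have hmj : ∀ j : ℕ, Measurable (TT (kfam ψ (nuj μ (j+1))) f) := fun j => by
    haveI := nuj_fin μ (j+1)
    exact measurable_TT _ (fun i => continuous_ker ψ _ _ (Idx_pos i)) _ hfc.measurable
  set A := (∫⁻ x, ‖f x‖ₑ ^ p) ^ (1/p) with hA
  have hmain : (∫⁻ x, Mmax μ f x ^ p)^(1/p) ≤ (C0^(1/p) + K^(1/p) * S) * A := by
    calc (∫⁻ x, Mmax μ f x ^ p)^(1/p) ≤ (∫⁻ x, (TT (kfam φ μ) f x +
          ∑' j : ℕ, TT (kfam ψ (nuj μ (j+1))) f x) ^ p)^(1/p) := by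
          refine ENNReal.rpow_le_rpow (lintegral_mono fun x => ENNReal.rpow_le_rpow ?_ hp0.le) hip.le
          exact Mmax_le μ (contDiff_mFT μ R hR).continuous χ hχ hχ1 hχ2 φ ψ hφ hψ f x
      _ ≤ (∫⁻ x, TT (kfam φ μ) f x ^ p)^(1/p) + 
          (∫⁻ x, (∑' j : ℕ, TT (kfam ψ (nuj μ (j+1))) f x) ^ p)^(1/p) :=
          ENNReal.lintegral_Lp_add_le hm0.aemeasurable 
            (Measurable.ennreal_tsum hmj).aemeasurable hp1.le
      _ ≤ C0^(1/p) * A + K^(1/p) * S * A := by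
          refine add_le_add ?_ ?_
          · rw [hA, ← ENNReal.mul_rpow_of_nonneg _ _ hip.le]
            exact ENNReal.rpow_le_rpow (h0 f hfc hfi) hip.le
          · refine (minkowski_tsum p hp1.le _ hmj).trans ?_
            rw [hS, ← ENNReal.tsum_mul_left, ← ENNReal.tsum_mul_right]
            refine ENNReal.tsum_le_tsum fun j => ?_
            rw [hA, ← ENNReal.mul_rpow_of_nonneg _ _ hip.le, ← ENNReal.mul_rpow_of_nonneg _ _ hip.le]
            exact ENNReal.rpow_le_rpow (hj (j+1) (by omega) f hfc hfi) hip.le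
      _ = _ := by ring
  have h2 := ENNReal.rpow_le_rpow hmain hp0.le
  rw [ENNReal.mul_rpow_of_nonneg _ _ hp0.le, hA, ← ENNReal.rpow_mul, ← ENNReal.rpow_mul,
    one_div_mul_cancel hp0.ne', ENNReal.rpow_one, ENNReal.rpow_one] at h2
  exact h2

end RdF

namespace RdF

open scoped ContDiff in
/-- Smooth truncation of a Schwartz function. -/
lemma exists_trunc (f : SchwartzMap (Esp d) ℂ) (l : ℝ) (hl : 0 < l) :
    ∃ f₁ : SchwartzMap (Esp d) ℂ, (∀ x, ‖f x‖ ≤ l → f₁ x = 0) ∧ (∀ x, ‖f₁ x‖ ≤ ‖f x‖) ∧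
      (∀ x, ‖f x - f₁ x‖ ≤ 2 * l) := by
  let b : ContDiffBump (0 : ℂ) := ⟨l, 2 * l, hl, by linarith⟩
  let g : Esp d → ℂ := fun x => f x * ((1 - b (f x) : ℝ) : ℂ)
  have hb0 : ∀ z, 0 ≤ b z := fun z => b.nonneg
  have hb1 : ∀ z, b z ≤ 1 := fun z => b.le_one
  have hsm : ContDiff ℝ ∞ g := by
    have h1 : ContDiff ℝ ∞ (fun x => f x) := f.smooth ⊤
    have h2 : ContDiff ℝ ∞ (fun x => 1 - b (f x)) := contDiff_const.sub (b.contDiff.comp h1)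
    exact h1.mul (Complex.ofRealCLM.contDiff.comp h2)
  have hz : ∀ x, ‖f x‖ ≤ l → g x = 0 := by
    intro x hx
    have : b (f x) = 1 := b.one_of_mem_closedBall (by simpa [b] using hx)
    simp [g, this]
  have hcs : HasCompactSupport g := by
    rw [hasCompactSupport_iff_eventuallyEq]
    have ht : Filter.Tendsto (fun x => ‖f x‖) (Filter.cocompact (Esp d)) (nhds 0) := by
      have := (zero_at_infty f).norm
      simpa using this
    rw [← Filter.coclosedCompact_eq_cocompact] at ht
    filter_upwards [ht.eventually (gt_mem_nhds hl)] with x hx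
    exact hz x hx.le
  refine ⟨hcs.toSchwartzMap hsm, hz, ?_, ?_⟩
  · intro x
    change ‖g x‖ ≤ _
    simp only [g, norm_mul, Complex.norm_real, Real.norm_eq_abs]
    rw [abs_of_nonneg (by linarith [hb1 (f x)])]
    exact mul_le_of_le_one_right (norm_nonneg _) (by linarith [hb0 (f x)])
  · intro x
    change ‖f x - g x‖ ≤ _
    have : f x - g x = f x * ((b (f x) : ℝ) : ℂ) := by simp only [g]; push_cast; ring
    rw [this, norm_mul, Complex.norm_real, Real.norm_eq_abs, abs_of_nonneg (hb0 _)]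
    by_cases h : ‖f x‖ ≤ 2 * l
    · exact (mul_le_of_le_one_right (norm_nonneg _) (hb1 _)).trans h
    · push Not at h
      have : b (f x) = 0 := b.zero_of_le_dist (by simpa [b] using h.le)
      rw [this]; simp; linarith

lemma continuous_convM (μ : Measure (Esp d)) [IsFiniteMeasure μ] (f : SchwartzMap (Esp d) ℂ) (t : ℝ) :
    Continuous (convM f μ t) := by
  obtain ⟨B, hB0, hB⟩ := schwartz_bdd f
  unfold convM
  have hf : Continuous (f : Esp d → ℂ) := f.continuous
  refine continuous_of_dominated (bound := fun _ => B) ?_ ?_ (integrable_const _) ?_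
  · intro x
    exact (hf.comp (by fun_prop : Continuous fun y : Esp d => x - t • y)).aestronglyMeasurable
  · intro x
    exact Filter.Eventually.of_forall fun y => hB _
  · exact Filter.Eventually.of_forall fun y =>
      hf.comp (by fun_prop : Continuous fun x : Esp d => x - t • y)

lemma measurable_Mmax (μ : Measure (Esp d)) [IsFiniteMeasure μ] (f : SchwartzMap (Esp d) ℂ) :
    Measurable (Mmax μ f) := by
  refine LowerSemicontinuous.measurable ?_
  unfold Mmax
  exact lowerSemicontinuous_iSup fun t => (continuous_convM μ f t).enorm.lowerSemicontinuous

lemma Mmax_trunc (μ : Measure (Esp d)) [IsFiniteMeasure μ] (f g : SchwartzMap (Esp d) ℂ) (l : ℝ)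
    (h : ∀ x, ‖f x - g x‖ ≤ l) (x : Esp d) :
    Mmax μ f x ≤ Mmax μ g x + ENNReal.ofReal (l * μ.real univ) := by
  unfold Mmax
  refine iSup_le fun t => ?_
  refine le_trans ?_ (add_le_add_left (le_iSup (fun t : {t : ℝ // 0 < t} => (‖convM g μ t x‖₊ : ℝ≥0∞)) t) _)
  have hf : Continuous (f : Esp d → ℂ) := f.continuous
  have hg : Continuous (g : Esp d → ℂ) := g.continuous
  have hi : ∀ f : SchwartzMap (Esp d) ℂ, Integrable (fun y => f (x - (t:ℝ) • y)) μ := by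
    intro f
    have hf : Continuous (f : Esp d → ℂ) := f.continuous
    obtain ⟨B, hB0, hB⟩ := schwartz_bdd f
    exact Integrable.of_bound (hf.comp (by fun_prop : Continuous fun y : Esp d => x - (t:ℝ) • y)).aestronglyMeasurable B
      (Filter.Eventually.of_forall fun y => hB _)
  have e : convM f μ t x = convM g μ t x + ∫ y, (f (x - (t:ℝ) • y) - g (x - (t:ℝ) • y)) ∂μ := by
    rw [integral_sub (hi f) (hi g)]
    simp [convM]
  change ‖convM f μ t x‖ₑ ≤ ‖convM g μ t x‖ₑ + _
  rw [e]
  refine (enorm_add_le _ _).trans (add_le_add le_rfl ?_)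
  rw [← ofReal_norm]
  refine ENNReal.ofReal_le_ofReal ?_
  exact norm_integral_le_of_norm_le_const (Filter.Eventually.of_forall fun y => h _)

lemma layer_q (p q c : ℝ) (hq : 0 < q) (hpq : q < p) (hc : 0 < c) (f : Esp d → ℂ) (hf : Continuous f) :
    ∫⁻ s in Ioi 0, ENNReal.ofReal (s ^ (p - 1 - q)) * ∫⁻ x in {x | c * s < ‖f x‖}, ‖f x‖ₑ ^ q ≤
      ENNReal.ofReal ((c⁻¹) ^ (p-q) / (p-q)) * ∫⁻ x, ‖f x‖ₑ ^ p := by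
  rw [tonelli volume (fun s => ENNReal.ofReal (s ^ (p-1-q))) (by fun_prop) (fun x => ‖f x‖ₑ ^ q)
    (by fun_prop) (fun s x => c * s < ‖f x‖)
    (measurableSet_lt (by fun_prop) (by fun_prop)), ← lintegral_const_mul _ (by fun_prop)]
  refine lintegral_mono fun x => ?_
  by_cases h0 : f x = 0
  · simp [h0, hq]
  have hpos : 0 < ‖f x‖ := norm_pos_iff.mpr h0
  have hp' : 0 < p - q := by linarith
  calc _ ≤ ‖f x‖ₑ ^ q * ∫⁻ s in Ioo 0 (c⁻¹ * ‖f x‖), ENNReal.ofReal (s ^ (p-1-q)) := by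
        gcongr; intro s hs; exact ⟨hs.2, by rw [lt_inv_mul_iff₀ hc]; exact hs.1⟩
    _ = _ := by
        rw [lintegral_rpow_Ioo _ _ (by linarith) (by positivity), ← ofReal_norm, ENNReal.ofReal_rpow_of_pos hpos,
          ENNReal.ofReal_rpow_of_pos hpos,
          ← ENNReal.ofReal_mul (by positivity),
          ← ENNReal.ofReal_mul (by positivity)]
        congr 1
        rw [show p - 1 - q + 1 = p - q by ring, Real.mul_rpow (by positivity) hpos.le]
        have e3 : ‖f x‖ ^ p = ‖f x‖ ^ q * ‖f x‖ ^ (p - q) := by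
          rw [← Real.rpow_add hpos]
          ring_nf
        rw [e3]
        ring

lemma Lp_large (p q : ℝ) (hq : 0 < q) (hpq : q < p) (μ : Measure (Esp d)) [IsFiniteMeasure μ]
    (K : ℝ≥0∞) (hK : K ≠ ∞) (h : ∀ f : SchwartzMap (Esp d) ℂ,
        ∫⁻ x, Mmax μ f x ^ q ≤ K * ∫⁻ x, ‖f x‖ₑ ^ q) :
    ∃ K' : ℝ≥0∞, K' ≠ ∞ ∧ ∀ f : SchwartzMap (Esp d) ℂ,
        ∫⁻ x, Mmax μ f x ^ p ≤ K' * ∫⁻ x, ‖f x‖ₑ ^ p := by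
  set B := μ.real univ with hB
  have hB0 : 0 ≤ B := measureReal_nonneg
  set c : ℝ := (4 * (B + 1))⁻¹ with hc
  have hc0 : 0 < c := by positivity
  have hp0 : 0 < p := by linarith
  refine ⟨ENNReal.ofReal (p * 2^q) * K * ENNReal.ofReal ((c⁻¹) ^ (p-q) / (p-q)), by finiteness, ?_⟩
  intro f
  have hfc : Continuous (f : Esp d → ℂ) := f.continuous
  have hdist : ∀ s : ℝ, 0 < s → volume {x | ENNReal.ofReal s < Mmax μ f x} ≤
      ENNReal.ofReal (2^q * s^(-q)) * (K * ∫⁻ x in {x | c * s < ‖f x‖}, ‖f x‖ₑ ^ q) := by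
    intro s hs
    obtain ⟨g, hg0, hg1, hg2⟩ := exists_trunc f (c * s) (by positivity)
    have hsub : {x | ENNReal.ofReal s < Mmax μ f x} ⊆ {x | ENNReal.ofReal (s/2) ^ q ≤ Mmax μ g x ^ q} := by
      intro x hx
      have hx : ENNReal.ofReal s < Mmax μ f x := hx
      have h1 := hx.trans_le (Mmax_trunc μ f g _ hg2 x)
      have h2 : 2 * (c * s) * B ≤ s / 2 := by
        have : c * B ≤ 1/4 := by
          rw [hc, inv_mul_le_iff₀ (by positivity)]; linarith
        nlinarith
      refine ENNReal.rpow_le_rpow ?_ hq.le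
      by_contra! hlt
      have h3 : Mmax μ g x + ENNReal.ofReal (2 * (c * s) * B) ≤ ENNReal.ofReal (s/2) + ENNReal.ofReal (s/2) :=
        add_le_add hlt.le (ENNReal.ofReal_le_ofReal h2)
      rw [← ENNReal.ofReal_add (by positivity) (by positivity), add_halves] at h3
      exact absurd (h1.trans_le h3) (lt_irrefl _)
    have hne : ENNReal.ofReal (s/2) ^ q ≠ 0 := by
      rw [ENNReal.ofReal_rpow_of_pos (by positivity)]
      simp only [ne_eq, ENNReal.ofReal_eq_zero, not_le]; positivity
    have hnt : ENNReal.ofReal (s/2) ^ q ≠ ∞ := ENNReal.rpow_ne_top_of_nonneg hq.le ENNReal.ofReal_ne_top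
    have hmarkov := meas_ge_le_lintegral_div (μ := volume)
      ((measurable_Mmax μ g).pow_const q).aemeasurable hne hnt
    refine (measure_mono hsub).trans (hmarkov.trans ?_)
    rw [div_eq_mul_inv, mul_comm]
    have e : (ENNReal.ofReal (s/2) ^ q)⁻¹ = ENNReal.ofReal (2^q * s^(-q)) := by
      rw [ENNReal.ofReal_rpow_of_pos (by positivity), ← ENNReal.ofReal_inv_of_pos (by positivity)]
      congr 1
      rw [Real.div_rpow hs.le (by norm_num), Real.rpow_neg hs.le, inv_div, div_eq_mul_inv]
    rw [e]
    refine mul_le_mul_right ((h g).trans (mul_le_mul_right ?_ _)) _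
    have hms : MeasurableSet {x | c * s < ‖f x‖} := measurableSet_lt (by fun_prop) hfc.norm.measurable
    rw [← lintegral_indicator hms]
    refine lintegral_mono fun x => ?_
    by_cases hx : c * s < ‖f x‖
    · rw [indicator_of_mem (show x ∈ {x | c * s < ‖f x‖} from hx)]
      refine ENNReal.rpow_le_rpow ?_ hq.le
      rw [← ofReal_norm, ← ofReal_norm]
      exact ENNReal.ofReal_le_ofReal (hg1 x)
    · rw [hg0 x (not_lt.mp hx)]
      simp [hq]
  refine (lintegral_rpow_le_layer volume p hp0 _ (measurable_Mmax μ f)).trans ?_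
  calc _ ≤ ∫⁻ s in Ioi 0, ENNReal.ofReal (p * 2^q) * K * (ENNReal.ofReal (s ^ (p - 1 - q)) * 
        ∫⁻ x in {x | c * s < ‖f x‖}, ‖f x‖ₑ ^ q) := by
        refine setLIntegral_mono' measurableSet_Ioi fun s hs => ?_
        have hs : 0 < s := hs
        refine (mul_le_mul_right (hdist s hs) _).trans (le_of_eq ?_)
        have e1 : ENNReal.ofReal (p * s^(p-1)) * ENNReal.ofReal (2^q * s^(-q)) = 
            ENNReal.ofReal (p * 2^q) * ENNReal.ofReal (s ^ (p-1-q)) := by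
          rw [← ENNReal.ofReal_mul (by positivity), ← ENNReal.ofReal_mul (by positivity), 
            sub_eq_add_neg (p-1) q, Real.rpow_add hs (p-1) (-q)]
          congr 1
          ring
        rw [← mul_assoc, e1]
        ring
    _ = ENNReal.ofReal (p * 2^q) * K * ∫⁻ s in Ioi 0, (ENNReal.ofReal (s ^ (p - 1 - q)) * 
        ∫⁻ x in {x | c * s < ‖f x‖}, ‖f x‖ₑ ^ q) := lintegral_const_mul' _ _ (by finiteness)
    _ ≤ _ := by
        rw [mul_assoc _ (ENNReal.ofReal ((c⁻¹) ^ (p-q) / (p-q)))]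
        exact mul_le_mul_right (layer_q p q c hq hpq hc0 f hfc) _

end RdF

/-- Rubio de Francia's maximal theorem: if μ is a compactly supported finite Borel measure
with |μ̂(ξ)| ≤ C|ξ|^{−a}, a > 1/2, then M_μ is bounded on L^p for p > (2a+1)/(2a). -/
theorem stmt0 (d : ℕ) (hd : 1 ≤ d) (μ : Measure (EuclideanSpace ℝ (Fin d)))
    [IsFiniteMeasure μ] (hcomp : ∃ K : Set (EuclideanSpace ℝ (Fin d)), IsCompact K ∧ μ Kᶜ = 0)
    (a C : ℝ) (ha : 1/2 < a)
    (hdecay : ∀ ξ : EuclideanSpace ℝ (Fin d), ξ ≠ 0 → ‖mFT μ ξ‖ ≤ C * ‖ξ‖ ^ (-a))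
    (p : ℝ) (hp : (2*a+1)/(2*a) < p) :
    ∃ C' : ℝ, 0 < C' ∧ ∀ f : SchwartzMap (EuclideanSpace ℝ (Fin d)) ℂ,
      lpE (Mmax μ ⇑f) p ≤
        ENNReal.ofReal C' * (∫⁻ x, (‖f x‖₊ : ℝ≥0∞) ^ p) ^ (1/p) := by
  have ha0 : 0 < a := by linarith
  have hpa2 : (2*a+1)/(2*a) < 2 := by
    rw [div_lt_iff₀ (by positivity)]; linarith
  have hpa1 : 1 < (2*a+1)/(2*a) := by
    rw [lt_div_iff₀ (by positivity)]; linarith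
  obtain ⟨q, hq1, hq2⟩ := exists_between (lt_min hp hpa2)
  have hqp := lt_of_lt_of_le hq2 (min_le_left _ _)
  have hq2' := lt_of_lt_of_le hq2 (min_le_right _ _)
  have hq1' : 1 < 2*a*(q-1) := by
    rw [div_lt_iff₀ (by positivity)] at hq1; linarith
  obtain ⟨S, hS, hS0⟩ := hcomp
  obtain ⟨R, hR⟩ := hS.isBounded.exists_norm_le
  have hR' : ∀ᵐ y ∂μ, ‖y‖ ≤ max R 1 := by
    have : ∀ᵐ y ∂μ, y ∈ S := hS0
    filter_upwards [this] with y hy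
    exact (hR y hy).trans (le_max_left _ _)
  obtain ⟨K, hK, hKf⟩ := RdF.Lp_small hd q (by linarith) hq2' μ (max R 1) (le_max_right _ _) hR' a
    (|C| + 1) ha0 (by positivity) (fun ξ hξ => (hdecay ξ hξ).trans (by
      refine mul_le_mul_of_nonneg_right ?_ (by positivity)
      linarith [le_abs_self C])) hq1'
  obtain ⟨K', hK', hf⟩ := RdF.Lp_large p q (by linarith) hqp μ K hK hKf
  have hp0 : 0 < p := by linarith
  have hip : 0 < 1/p := by positivity
  refine ⟨(K'^(1/p)).toReal + 1, by positivity, fun f => ?_⟩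
  unfold lpE
  have h1 := ENNReal.rpow_le_rpow (hf f) hip.le
  rw [ENNReal.mul_rpow_of_nonneg _ _ hip.le] at h1
  refine h1.trans (mul_le_mul_left ?_ _)
  rw [← ENNReal.ofReal_toReal (ENNReal.rpow_ne_top_of_nonneg hip.le hK')]
  exact ENNReal.ofReal_le_ofReal (by rw [ENNReal.toReal_ofReal ENNReal.toReal_nonneg]; linarith)
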